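/- Let Ω ⊆ ℝ² be a bounded, simply connected domain. Then the following are equivalent: (a) Ω is a weak carrot domain; (b) Ω supports an s-Hajłasz–Trudinger imbedding for all s ∈ (0,1]; (c) Ω supports an s-Hajłasz–Trudinger imbedding for some s ∈ (0,1]. -/

import Mathlib

open MeasureTheory Metric Set
open scoped ENNReal

noncomputable section

/-- Euclidean space `ℝⁿ`. -/
abbrev Eu (n : ℕ) : Type := EuclideanSpace ℝ (Fin n)

/-- A domain: a nonempty open connected subset. -/
def IsDomainEu {n : ℕ} (Ω : Set (Eu n)) : Prop := IsOpen Ω ∧ IsConnected Ω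

/-- The Hajłasz gradient class `𝒟^{s,ρ}_ball(u)` on `Ω`: nonnegative measurable `g` such that
`|u x - u y| ≤ |x-y|^s (g x + g y)` for all `x, y ∈ Ω` off a null set with
`|x - y| < ρ · dist(x, ∂Ω)`. -/
def DBall {n : ℕ} (Ω : Set (Eu n)) (s ρ : ℝ) (u : Eu n → ℝ) : Set (Eu n → ℝ) :=
  {g | Measurable g ∧ (∀ x, 0 ≤ g x) ∧
    ∃ N : Set (Eu n), N ⊆ Ω ∧ volume N = 0 ∧
      ∀ x ∈ Ω \ N, ∀ y ∈ Ω \ N,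
        edist x y < ENNReal.ofReal ρ * EMetric.infEdist x Ωᶜ →
        |u x - u y| ≤ dist x y ^ s * (g x + g y)}

/-- The full Hajłasz gradient class `𝒟^s(u)` on `U`. -/
def DFull {n : ℕ} (U : Set (Eu n)) (s : ℝ) (u : Eu n → ℝ) : Set (Eu n → ℝ) :=
  {g | Measurable g ∧ (∀ x, 0 ≤ g x) ∧
    ∃ N : Set (Eu n), N ⊆ U ∧ volume N = 0 ∧
      ∀ x ∈ U \ N, ∀ y ∈ U \ N, |u x - u y| ≤ dist x y ^ s * (g x + g y)}

/-- `inf_{g ∈ 𝒟^{s,ρ}_ball(u)} ‖g‖_{L^p(Ω)}`. -/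
def ballNormRho {n : ℕ} (Ω : Set (Eu n)) (s p ρ : ℝ) (u : Eu n → ℝ) : ℝ≥0∞ :=
  ⨅ g ∈ DBall Ω s ρ u, eLpNorm g (ENNReal.ofReal p) (volume.restrict Ω)

/-- The `Ṁ^{s,p}_ball(Ω)` seminorm (with `ρ = 1/2`). -/
def ballNorm {n : ℕ} (Ω : Set (Eu n)) (s p : ℝ) (u : Eu n → ℝ) : ℝ≥0∞ :=
  ballNormRho Ω s p (1/2) u

/-- The `Ṁ^{s,p}(U)` seminorm. -/
def fullNorm {n : ℕ} (U : Set (Eu n)) (s p : ℝ) (u : Eu n → ℝ) : ℝ≥0∞ :=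
  ⨅ g ∈ DFull U s u, eLpNorm g (ENNReal.ofReal p) (volume.restrict U)

/-- Membership in `Ṁ^{s,p}_ball(Ω)`. -/
def MemMball {n : ℕ} (Ω : Set (Eu n)) (s p : ℝ) (u : Eu n → ℝ) : Prop :=
  Measurable u ∧ ballNorm Ω s p u < ⊤

/-- Membership in `Ṁ^{s,p}(U)`. -/
def MemMfull {n : ℕ} (U : Set (Eu n)) (s p : ℝ) (u : Eu n → ℝ) : Prop :=
  Measurable u ∧ fullNorm U s p u < ⊤

/-- `Ω` supports a `(pn/(n-ps), p)_s`-Hajłasz–Sobolev–Poincaré imbedding. -/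
def SupportsHSP {n : ℕ} (Ω : Set (Eu n)) (s p : ℝ) : Prop :=
  ∃ C : ℝ, 0 < C ∧ ∀ u : Eu n → ℝ, MemMball Ω s p u →
    eLpNorm (fun x => u x - ⨍ y in Ω, u y)
        (ENNReal.ofReal (p * n / (n - p * s))) (volume.restrict Ω)
      ≤ ENNReal.ofReal C * ballNorm Ω s p u

/-- LLC(2) with constant `b`: points of `Ω \ B(z,r)` lie in the same connected component
of `Ω \ B(z, br)`. -/
def LLC2With {n : ℕ} (Ω : Set (Eu n)) (b : ℝ) : Prop :=
  ∀ (z : Eu n) (r : ℝ), 0 < r →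
    ∀ x ∈ Ω \ ball z r, ∀ y ∈ Ω \ ball z r,
      y ∈ connectedComponentIn (Ω \ ball z (b * r)) x

/-- The LLC(2) property. -/
def LLC2 {n : ℕ} (Ω : Set (Eu n)) : Prop :=
  ∃ b : ℝ, b ∈ Set.Ioo (0:ℝ) 1 ∧ LLC2With Ω b

/-- `Ω` is an `Ṁ^{s,p}_ball`-extension domain. -/
def IsMballExtensionDomain {n : ℕ} (Ω : Set (Eu n)) (s p : ℝ) : Prop :=
  ∃ C : ℝ, 0 < C ∧ ∀ u : Eu n → ℝ, MemMball Ω s p u →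
    ∃ v : Eu n → ℝ, MemMball (Set.univ) s p v ∧ (∀ x ∈ Ω, v x = u x) ∧
      ballNorm (Set.univ) s p v ≤ ENNReal.ofReal C * ballNorm Ω s p u

/-- `Ω` is a John domain: there are `x₀ ∈ Ω` and `C > 0` such that every `x ∈ Ω` is joined to
`x₀` by a curve parametrized by arclength (here: `1`-Lipschitz) with
`dist(γ t, Ωᶜ) ≥ C t`. -/
def IsJohnDomain {n : ℕ} (Ω : Set (Eu n)) : Prop :=
  ∃ x₀ ∈ Ω, ∃ C : ℝ, 0 < C ∧ ∀ x ∈ Ω, ∃ ℓ : ℝ, 0 ≤ ℓ ∧ ∃ γ : ℝ → Eu n,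
    LipschitzOnWith 1 γ (Set.Icc 0 ℓ) ∧ γ 0 = x ∧ γ ℓ = x₀ ∧
    ∀ t ∈ Set.Icc (0:ℝ) ℓ, γ t ∈ Ω ∧ C * t ≤ infDist (γ t) Ωᶜ

/-- Quasihyperbolic distance: infimum over arclength-parametrized (`1`-Lipschitz) curves in `Ω`
joining `x` to `y` of `∫ dist(γ t, Ωᶜ)⁻¹ dt`. -/
def qhDist {n : ℕ} (Ω : Set (Eu n)) (x y : Eu n) : ℝ :=
  sInf { k : ℝ | ∃ ℓ : ℝ, 0 ≤ ℓ ∧ ∃ γ : ℝ → Eu n,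
    LipschitzOnWith 1 γ (Set.Icc 0 ℓ) ∧ γ 0 = x ∧ γ ℓ = y ∧
    (∀ t ∈ Set.Icc (0:ℝ) ℓ, γ t ∈ Ω) ∧
    k = ∫ t in (0:ℝ)..ℓ, (infDist (γ t) Ωᶜ)⁻¹ }

/-- Weak carrot domain (quasihyperbolic boundary condition). -/
def IsWeakCarrot {n : ℕ} (Ω : Set (Eu n)) : Prop :=
  ∃ x₀ ∈ Ω, ∃ C : ℝ, 1 ≤ C ∧ ∀ x ∈ Ω,
    qhDist Ω x x₀ ≤ C * Real.log (C / infDist x Ωᶜ)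

/-- The Luxemburg norm `‖u‖_{φ_s(L)(Ω)}` with `φ_s(t) = exp(t^{n/(n-s)}) - 1`
(value `⊤` when no admissible `t` exists). -/
def phiLux {n : ℕ} (Ω : Set (Eu n)) (s : ℝ) (u : Eu n → ℝ) : ℝ≥0∞ :=
  sInf (ENNReal.ofReal '' { t : ℝ | 0 < t ∧
    (∫⁻ x in Ω, ENNReal.ofReal
        (Real.exp ((|u x| / t) ^ ((n : ℝ) / ((n : ℝ) - s))) - 1)) ≤ 1 })

/-- `Ω` supports an `s`-Hajłasz–Trudinger imbedding. -/
def SupportsHT {n : ℕ} (Ω : Set (Eu n)) (s : ℝ) : Prop :=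
  ∃ C : ℝ, 0 < C ∧ ∀ u : Eu n → ℝ, MemMball Ω s ((n : ℝ) / s) u →
    phiLux Ω s (fun x => u x - ⨍ y in Ω, u y)
      ≤ ENNReal.ofReal C * ballNorm Ω s ((n : ℝ) / s) u

/-- The separation property with respect to `x₀` and `C`. -/
def SeparationProperty {n : ℕ} (Ω : Set (Eu n)) (x₀ : Eu n) (C : ℝ) : Prop :=
  ∀ x ∈ Ω, ∃ γ : ℝ → Eu n, ContinuousOn γ (Set.Icc 0 1) ∧
    (∀ t ∈ Set.Icc (0:ℝ) 1, γ t ∈ Ω) ∧ γ 0 = x ∧ γ 1 = x₀ ∧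
    ∀ t ∈ Set.Ioc (0:ℝ) 1,
      γ '' Set.Icc 0 t ⊆ ball (γ t) (C * infDist (γ t) Ωᶜ) ∨
      ∀ y ∈ γ '' Set.Icc 0 t \ ball (γ t) (C * infDist (γ t) Ωᶜ),
        connectedComponentIn (Ω \ sphere (γ t) (C * infDist (γ t) Ωᶜ)) y ≠
          connectedComponentIn (Ω \ sphere (γ t) (C * infDist (γ t) Ωᶜ)) x₀

/-- The slice property with constant `C`. Lengths of curve portions are measured via the
Lebesgue measure of parameter preimages of arclength (`1`-Lipschitz) parametrizations. -/
def SliceProperty {n : ℕ} (Ω : Set (Eu n)) (C : ℝ) : Prop :=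
  ∀ x ∈ Ω, ∀ y ∈ Ω, ∃ (j : ℕ) (S : ℕ → Set (Eu n)) (L : ℝ) (γ : ℝ → Eu n),
    0 ≤ L ∧ LipschitzOnWith 1 γ (Set.Icc 0 L) ∧ γ 0 = x ∧ γ L = y ∧
    (∀ t ∈ Set.Icc (0:ℝ) L, γ t ∈ Ω) ∧
    (∀ i ≤ j, IsOpen (S i) ∧ S i ⊆ Ω) ∧
    (∀ i ≤ j, ∀ k ≤ j, i ≠ k → Disjoint (S i) (S k)) ∧
    x ∈ S 0 ∧ y ∈ S j ∧
    (∀ i, 0 < i → i < j →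
      connectedComponentIn (Ω \ closure (S i)) x ≠
        connectedComponentIn (Ω \ closure (S i)) y) ∧
    (∀ (LF : ℝ) (F : ℝ → Eu n), 0 ≤ LF → LipschitzOnWith 1 F (Set.Icc 0 LF) →
      F '' Set.Icc 0 LF ⊆ Ω → (∃ t ∈ Set.Icc (0:ℝ) LF, F t = x) →
      (∃ t ∈ Set.Icc (0:ℝ) LF, F t = y) →
      ∀ i, 0 < i → i < j →
        Metric.diam (S i) ≤ C * (volume {t : ℝ | t ∈ Set.Icc (0:ℝ) LF ∧ F t ∈ S i}).toReal) ∧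
    (∀ t ∈ Set.Icc (0:ℝ) L,
      ball (γ t) (C⁻¹ * infDist (γ t) Ωᶜ) ⊆ ⋃ i ∈ Finset.range (j + 1), S i) ∧
    (∀ i ≤ j, ∀ z ∈ γ '' Set.Icc (0:ℝ) L ∩ S i, Metric.diam (S i) ≤ C * infDist z Ωᶜ) ∧
    (∃ xi : ℕ → Eu n, xi 0 = x ∧ xi j = y ∧
      ∀ i ≤ j, xi i ∈ S i ∧ ball (xi i) (C⁻¹ * infDist (xi i) Ωᶜ) ⊆ S i)

/-- `v : Ω → ℝⁿ` is a distributional gradient of `u` on `U`. -/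
def HasDistribGradOn {n : ℕ} (U : Set (Eu n)) (u : Eu n → ℝ) (v : Eu n → Eu n) : Prop :=
  ∀ φ : Eu n → ℝ, ContDiff ℝ (⊤ : ℕ∞) φ → HasCompactSupport φ → tsupport φ ⊆ U →
    ∀ i : Fin n,
      ∫ x in U, u x * fderiv ℝ φ x (EuclideanSpace.single i 1) = - ∫ x in U, v x i * φ x

/-- `u ∈ Ẇ^{1,p}(U)` with distributional gradient `v ∈ L^p(U;ℝⁿ)`. -/
def MemW1p {n : ℕ} (U : Set (Eu n)) (p : ℝ) (u : Eu n → ℝ) (v : Eu n → Eu n) : Prop :=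
  LocallyIntegrableOn u U volume ∧ AEMeasurable v (volume.restrict U) ∧
    eLpNorm v (ENNReal.ofReal p) (volume.restrict U) < ⊤ ∧ HasDistribGradOn U u v

/-- `Ω` is a `Ẇ^{1,p}`-extension domain. -/
def IsW1pExtensionDomain {n : ℕ} (Ω : Set (Eu n)) (p : ℝ) : Prop :=
  ∃ C : ℝ, 0 < C ∧ ∀ u v, MemW1p Ω p u v →
    ∃ u' v', MemW1p (Set.univ) p u' v' ∧ (∀ᵐ x ∂(volume.restrict Ω), u' x = u x) ∧
      eLpNorm v' (ENNReal.ofReal p) volume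
        ≤ ENNReal.ofReal C * eLpNorm v (ENNReal.ofReal p) (volume.restrict Ω)

/-- The (uncentered over radii, centered) Hardy–Littlewood maximal function, `ℝ≥0∞`-valued. -/
def HLMax {n : ℕ} (g : Eu n → ℝ) (y : Eu n) : ℝ≥0∞ :=
  ⨆ (t : ℝ) (_ : 0 < t), (volume (ball y t))⁻¹ * ∫⁻ z in ball y t, ENNReal.ofReal |g z|

/-! ### Chains of points and quasihyperbolic curves -/

lemma dpos {Ω : Set (Eu 2)} (hO : IsOpen Ω) (hne : Ωᶜ.Nonempty) {x : Eu 2} (hx : x ∈ Ω) :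
    0 < infDist x Ωᶜ :=
  (hO.isClosed_compl.notMem_iff_infDist_pos hne).1 (by simpa using hx)

lemma mem_of_dpos {Ω : Set (Eu 2)} {x : Eu 2} (h : 0 < infDist x Ωᶜ) : x ∈ Ω := by
  by_contra hx
  have := infDist_zero_of_mem (show x ∈ Ωᶜ from hx)
  linarith

lemma dlip (Ω : Set (Eu 2)) (x y : Eu 2) : infDist x Ωᶜ ≤ infDist y Ωᶜ + dist x y :=
  infDist_le_infDist_add_dist

lemma mem_of_dist_lt {Ω : Set (Eu 2)} {x y : Eu 2} (h : dist x y < infDist x Ωᶜ) : y ∈ Ω := by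
  apply mem_of_dpos
  have := dlip Ω x y
  linarith

def QC (Ω : Set (Eu 2)) (x y : Eu 2) (k : ℝ) : Prop :=
  ∃ ℓ : ℝ, 0 ≤ ℓ ∧ ∃ γ : ℝ → Eu 2,
    LipschitzOnWith 1 γ (Set.Icc 0 ℓ) ∧ γ 0 = x ∧ γ ℓ = y ∧
    (∀ t ∈ Set.Icc (0:ℝ) ℓ, γ t ∈ Ω) ∧
    k = ∫ t in (0:ℝ)..ℓ, (infDist (γ t) Ωᶜ)⁻¹

def Adj (Ω : Set (Eu 2)) (x y : Eu 2) : Prop := dist x y ≤ infDist x Ωᶜ / 8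

def Chain (Ω : Set (Eu 2)) (N : ℕ) (x y : Eu 2) : Prop :=
  ∃ f : ℕ → Eu 2, f 0 = x ∧ f N = y ∧ (∀ i < N, Adj Ω (f i) (f (i+1))) ∧ (∀ i ≤ N, f i ∈ Ω)

lemma QC_nonneg {Ω : Set (Eu 2)} {x y : Eu 2} {k : ℝ} (h : QC Ω x y k) : 0 ≤ k := by
  obtain ⟨ℓ, hl, γ, h1, h2, h3, h4, rfl⟩ := h
  exact intervalIntegral.integral_nonneg hl (fun t _ => inv_nonneg.2 infDist_nonneg)

lemma curve_cont {Ω : Set (Eu 2)} (hO : IsOpen Ω) (hne : Ωᶜ.Nonempty) {γ : ℝ → Eu 2} {S : Set ℝ}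
    (h1 : LipschitzOnWith 1 γ S) (h4 : ∀ t ∈ S, γ t ∈ Ω) :
    ContinuousOn (fun t => (infDist (γ t) Ωᶜ)⁻¹) S := by
  apply ContinuousOn.inv₀
  · exact (continuous_infDist_pt _).comp_continuousOn h1.continuousOn
  · intro t ht
    exact (dpos hO hne (h4 t ht)).ne'

lemma QC_trans {Ω : Set (Eu 2)} (hO : IsOpen Ω) (hne : Ωᶜ.Nonempty) {x y z : Eu 2} {k k' : ℝ}
    (h : QC Ω x y k) (h' : QC Ω y z k') : QC Ω x z (k + k') := by
  obtain ⟨ℓ, hl, γ, h1, h2, h3, h4, rfl⟩ := h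
  obtain ⟨m, hm, δ, g1, g2, g3, g4, rfl⟩ := h'
  have e1 : ∀ t ∈ Icc (0:ℝ) ℓ, (if t ≤ ℓ then γ t else δ (t - ℓ)) = γ t := by
    intro t ht
    simp [ht.2]
  have e2 : ∀ t ∈ Icc ℓ (ℓ + m), (if t ≤ ℓ then γ t else δ (t - ℓ)) = δ (t - ℓ) := by
    intro t ht
    split_ifs with h
    · have : t = ℓ := le_antisymm h ht.1
      simp [this, h3, g2]
    · rfl
  have key : ∀ a ∈ Icc (0:ℝ) (ℓ + m), ∀ b ∈ Icc (0:ℝ) (ℓ + m), a ≤ b →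
      dist (if a ≤ ℓ then γ a else δ (a - ℓ)) (if b ≤ ℓ then γ b else δ (b - ℓ)) ≤ b - a := by
    intro a ha b hb hab
    have G1 : ∀ a ∈ Icc (0:ℝ) ℓ, ∀ b ∈ Icc (0:ℝ) ℓ, a ≤ b → dist (γ a) (γ b) ≤ b - a := by
      intro a ha b hb hab
      have := h1.dist_le_mul a ha b hb
      rw [Real.dist_eq, abs_sub_comm, abs_of_nonneg (by linarith)] at this
      simpa using this
    have G2 : ∀ a ∈ Icc (0:ℝ) m, ∀ b ∈ Icc (0:ℝ) m, a ≤ b → dist (δ a) (δ b) ≤ b - a := by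
      intro a ha b hb hab
      have := g1.dist_le_mul a ha b hb
      rw [Real.dist_eq, abs_sub_comm, abs_of_nonneg (by linarith)] at this
      simpa using this
    rcases le_total b ℓ with hbl | hbl
    · rw [e1 a ⟨ha.1, hab.trans hbl⟩, e1 b ⟨hb.1, hbl⟩]
      exact G1 _ ⟨ha.1, hab.trans hbl⟩ _ ⟨hb.1, hbl⟩ hab
    · rcases le_total a ℓ with hal | hal
      · rw [e1 a ⟨ha.1, hal⟩, e2 b ⟨hbl, hb.2⟩]
        have q1 := G1 a ⟨ha.1, hal⟩ ℓ ⟨hl, le_rfl⟩ hal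
        have q2 := G2 0 ⟨le_rfl, hm⟩ (b - ℓ) ⟨by linarith, by linarith [hb.2]⟩ (by linarith)
        rw [h3] at q1
        rw [g2] at q2
        linarith [dist_triangle (γ a) y (δ (b - ℓ))]
      · rw [e2 a ⟨hal, ha.2⟩, e2 b ⟨hbl, hb.2⟩]
        have q2 := G2 (a - ℓ) ⟨by linarith, by linarith [ha.2]⟩ (b - ℓ)
          ⟨by linarith, by linarith [hb.2]⟩ (by linarith)
        linarith
  have hmem : ∀ t ∈ Icc (0:ℝ) (ℓ + m), (if t ≤ ℓ then γ t else δ (t - ℓ)) ∈ Ω := by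
    intro t ht
    rcases le_total t ℓ with h | h
    · rw [e1 t ⟨ht.1, h⟩]
      exact h4 t ⟨ht.1, h⟩
    · rw [e2 t ⟨h, ht.2⟩]
      exact g4 _ ⟨by linarith, by linarith [ht.2]⟩
  have hlip : LipschitzOnWith 1 (fun t => if t ≤ ℓ then γ t else δ (t - ℓ)) (Icc 0 (ℓ + m)) := by
    apply LipschitzOnWith.of_dist_le_mul
    intro a ha b hb
    simp only [NNReal.coe_one, one_mul]
    rcases le_total a b with h | h
    · rw [Real.dist_eq, abs_sub_comm, abs_of_nonneg (by linarith)]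
      exact key a ha b hb h
    · rw [Real.dist_eq, abs_of_nonneg (by linarith), dist_comm]
      exact key b hb a ha h
  refine ⟨ℓ + m, by linarith, fun t => if t ≤ ℓ then γ t else δ (t - ℓ), hlip, ?_, ?_, hmem, ?_⟩
  · simp [hl, h2]
  · have := e2 (ℓ + m) ⟨by linarith, le_rfl⟩
    simp only at this ⊢
    rw [this]
    simpa using g3
  · have hc := curve_cont hO hne hlip hmem
    have i1 : IntervalIntegrable
        (fun t => (infDist (if t ≤ ℓ then γ t else δ (t - ℓ)) Ωᶜ)⁻¹) volume 0 ℓ := by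
      apply ContinuousOn.intervalIntegrable_of_Icc hl
      exact hc.mono (Icc_subset_Icc le_rfl (by linarith))
    have i2 : IntervalIntegrable
        (fun t => (infDist (if t ≤ ℓ then γ t else δ (t - ℓ)) Ωᶜ)⁻¹) volume ℓ (ℓ + m) := by
      apply ContinuousOn.intervalIntegrable_of_Icc (by linarith)
      exact hc.mono (Icc_subset_Icc hl le_rfl)
    rw [← intervalIntegral.integral_add_adjacent_intervals i1 i2]
    congr 1
    · apply intervalIntegral.integral_congr
      intro t ht
      rw [uIcc_of_le hl] at ht
      simp only [e1 t ht]
    · have : ∫ t in ℓ..(ℓ + m), (infDist (if t ≤ ℓ then γ t else δ (t - ℓ)) Ωᶜ)⁻¹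
          = ∫ t in ℓ..(ℓ + m), (infDist (δ (t - ℓ)) Ωᶜ)⁻¹ := by
        apply intervalIntegral.integral_congr
        intro t ht
        rw [uIcc_of_le (by linarith)] at ht
        simp only [e2 t ht]
      rw [this]
      have := intervalIntegral.integral_comp_sub_right (a := ℓ) (b := ℓ + m)
        (fun t => (infDist (δ t) Ωᶜ)⁻¹) ℓ
      simp only [this]
      simp

lemma QC_seg {Ω : Set (Eu 2)} (hO : IsOpen Ω) (hne : Ωᶜ.Nonempty) {x y : Eu 2}
    (hx : x ∈ Ω) (h : dist x y ≤ infDist x Ωᶜ / 2) : ∃ k ≤ 1, QC Ω x y k := by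
  have hd := dpos hO hne hx
  rcases eq_or_ne x y with rfl | hxy
  · refine ⟨0, zero_le_one, 0, le_rfl, fun _ => x, LipschitzOnWith.of_dist_le_mul (by simp), rfl,
      rfl, fun _ _ => hx, by simp⟩
  have hD : 0 < dist x y := dist_pos.2 hxy
  set γ : ℝ → Eu 2 := fun t => x + (t / dist x y) • (y - x) with hγ
  have hdist : ∀ a b, dist (γ a) (γ b) = |a - b| := by
    intro a b
    simp only [hγ, dist_add_left]
    rw [dist_eq_norm, ← sub_smul, norm_smul, ← dist_eq_norm y x, dist_comm y x, ← sub_div,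
      Real.norm_eq_abs, abs_div, abs_of_pos hD]
    field_simp
  have g0 : γ 0 = x := by simp [hγ]
  have hmem0 : ∀ t ∈ Icc (0:ℝ) (dist x y), infDist x Ωᶜ / 2 ≤ infDist (γ t) Ωᶜ := by
    intro t ht
    have h1 := dlip Ω x (γ t)
    have h2 := hdist 0 t
    rw [g0] at h2
    rw [h2] at h1
    rw [zero_sub, abs_neg, abs_of_nonneg ht.1] at h1
    linarith [ht.2]
  have hmem : ∀ t ∈ Icc (0:ℝ) (dist x y), γ t ∈ Ω := by
    intro t ht
    apply mem_of_dpos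
    linarith [hmem0 t ht]
  have hlip : LipschitzOnWith 1 γ (Icc 0 (dist x y)) := by
    apply LipschitzOnWith.of_dist_le_mul
    intro a _ b _
    simp [hdist, Real.dist_eq]
  refine ⟨_, ?_, dist x y, hD.le, γ, hlip, g0, ?_, hmem, rfl⟩
  · have hc := curve_cont hO hne hlip hmem
    have : ∫ t in (0:ℝ)..(dist x y), (infDist (γ t) Ωᶜ)⁻¹
        ≤ ∫ t in (0:ℝ)..(dist x y), (infDist x Ωᶜ / 2)⁻¹ := by
      apply intervalIntegral.integral_mono_on hD.le
      · exact hc.intervalIntegrable_of_Icc hD.le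
      · simp
      · intro t ht
        exact inv_anti₀ (by linarith) (hmem0 t ht)
    refine this.trans ?_
    simp only [intervalIntegral.integral_const, sub_zero, smul_eq_mul]
    rw [← div_eq_mul_inv, div_le_one (by linarith)]
    exact h
  · simp only [hγ]
    rw [div_self hD.ne']
    simp

lemma Chain.to_QC {Ω : Set (Eu 2)} (hO : IsOpen Ω) (hne : Ωᶜ.Nonempty) {N : ℕ} {x y : Eu 2}
    (h : Chain Ω N x y) : ∃ k ≤ (N : ℝ), QC Ω x y k := by
  obtain ⟨f, rfl, rfl, hA, hm⟩ := h
  induction N with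
  | zero =>
    refine ⟨0, by simp, 0, le_rfl, fun _ => f 0, LipschitzOnWith.of_dist_le_mul (by simp), rfl,
      rfl, fun _ _ => hm 0 le_rfl, by simp⟩
  | succ n ih =>
    obtain ⟨k, hk, hq⟩ := ih (fun i hi => hA i (by omega)) (fun i hi => hm i (by omega))
    obtain ⟨k', hk', hq'⟩ := QC_seg hO hne (hm n (by omega)) (y := f (n+1)) (by
      have := hA n (by omega)
      have h2 := dpos hO hne (hm n (by omega))
      unfold Adj at this
      linarith)
    exact ⟨k + k', by push_cast; linarith, QC_trans hO hne hq hq'⟩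

lemma chain_cons {Ω : Set (Eu 2)} {N : ℕ} {x y z : Eu 2} (hx : x ∈ Ω) (h : Adj Ω x y)
    (h' : Chain Ω N y z) : Chain Ω (N+1) x z := by
  obtain ⟨f, rfl, rfl, hA, hm⟩ := h'
  refine ⟨fun i => Nat.casesOn i x f, rfl, rfl, ?_, ?_⟩
  · intro i hi
    cases i with
    | zero => exact h
    | succ j => exact hA j (by omega)
  · intro i hi
    cases i with
    | zero => exact hx
    | succ j => exact hm j (by omega)

lemma chain_refl {Ω : Set (Eu 2)} {x : Eu 2} (hx : x ∈ Ω) : Chain Ω 0 x x :=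
  ⟨fun _ => x, rfl, rfl, by simp, fun _ _ => hx⟩

lemma QC_to_chain {Ω : Set (Eu 2)} (hO : IsOpen Ω) (hne : Ωᶜ.Nonempty) (n : ℕ) :
    ∀ (x y : Eu 2) (k : ℝ), QC Ω x y k → k ≤ n / 9 → ∃ N ≤ n + 1, Chain Ω N x y := by
  induction n with
  | zero =>
    rintro x y k ⟨ℓ, hl, γ, h1, rfl, rfl, h4, rfl⟩ hk
    have hx := h4 0 ⟨le_rfl, hl⟩
    have hd := dpos hO hne hx
    rcases hl.eq_or_lt with h | h
    · subst h
      exact ⟨0, by simp, chain_refl hx⟩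
    · exfalso
      have : 0 < ∫ t in (0:ℝ)..ℓ, (infDist (γ t) Ωᶜ)⁻¹ := by
        apply intervalIntegral.intervalIntegral_pos_of_pos_on
        · exact (curve_cont hO hne h1 h4).intervalIntegrable_of_Icc hl
        · intro t ht
          exact inv_pos.2 (dpos hO hne (h4 t ⟨ht.1.le, ht.2.le⟩))
        · exact h
      simp at hk
      linarith
  | succ n ih =>
    rintro x y k ⟨ℓ, hl, γ, h1, rfl, rfl, h4, rfl⟩ hk
    have hx := h4 0 ⟨le_rfl, hl⟩
    have hd := dpos hO hne hx
    set d := infDist (γ 0) Ωᶜ with hdd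
    have hdist : ∀ t ∈ Icc (0:ℝ) ℓ, dist (γ 0) (γ t) ≤ t := by
      intro t ht
      have := h1.dist_le_mul 0 ⟨le_rfl, hl⟩ t ht
      simpa [Real.dist_eq, abs_of_nonneg ht.1] using this
    rcases le_total ℓ (d / 8) with h | h
    · refine ⟨1, by omega, ?_⟩
      apply chain_cons hx _ (chain_refl (h4 ℓ ⟨hl, le_rfl⟩))
      exact (hdist ℓ ⟨hl, le_rfl⟩).trans h
    · have hsub : Icc (0:ℝ) (d/8) ⊆ Icc 0 ℓ := Icc_subset_Icc le_rfl h
      have hmem : d / 8 ∈ Icc (0:ℝ) ℓ := ⟨by linarith, h⟩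
      have hc := curve_cont hO hne h1 h4
      have i1 : IntervalIntegrable (fun t => (infDist (γ t) Ωᶜ)⁻¹) volume 0 (d/8) :=
        (hc.mono hsub).intervalIntegrable_of_Icc (by linarith)
      have i2 : IntervalIntegrable (fun t => (infDist (γ t) Ωᶜ)⁻¹) volume (d/8) ℓ :=
        (hc.mono (Icc_subset_Icc (by linarith) le_rfl)).intervalIntegrable_of_Icc h
      have hsplit := intervalIntegral.integral_add_adjacent_intervals i1 i2
      have hlow : (1:ℝ)/9 ≤ ∫ t in (0:ℝ)..(d/8), (infDist (γ t) Ωᶜ)⁻¹ := by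
        have : ∫ t in (0:ℝ)..(d/8), (9 * d / 8)⁻¹ ≤ ∫ t in (0:ℝ)..(d/8), (infDist (γ t) Ωᶜ)⁻¹ := by
          apply intervalIntegral.integral_mono_on (by linarith) (by simp) i1
          intro t ht
          apply inv_anti₀ (dpos hO hne (h4 t (hsub ht)))
          have := dlip Ω (γ t) (γ 0)
          rw [dist_comm] at this
          linarith [hdist t (hsub ht), ht.2]
        refine le_trans (le_of_eq ?_) this
        simp only [intervalIntegral.integral_const, sub_zero, smul_eq_mul]
        field_simp
      obtain ⟨N, hN, hch⟩ := ih (γ (d/8)) (γ ℓ) (∫ t in (d/8)..ℓ, (infDist (γ t) Ωᶜ)⁻¹) (by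
        refine ⟨ℓ - d/8, by linarith, fun t => γ (t + d/8), ?_, by simp, by simp, ?_, ?_⟩
        · apply LipschitzOnWith.of_dist_le_mul
          intro a ha b hb
          have := h1.dist_le_mul (a + d/8) ⟨by linarith [ha.1], by linarith [ha.2]⟩ (b + d/8)
            ⟨by linarith [hb.1], by linarith [hb.2]⟩
          simpa using this
        · intro t ht
          exact h4 _ ⟨by linarith [ht.1], by linarith [ht.2]⟩
        · have := intervalIntegral.integral_comp_add_right (a := 0) (b := ℓ - d/8)
            (fun t => (infDist (γ t) Ωᶜ)⁻¹) (d/8)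
          simp only [this]
          simp) (by push_cast at hk; linarith)
      exact ⟨N + 1, by omega, chain_cons hx (hdist _ hmem) hch⟩

lemma chain_exists {Ω : Set (Eu 2)} (hO : IsOpen Ω) (hne : Ωᶜ.Nonempty) (hc : IsPreconnected Ω)
    {x y : Eu 2} (hx : x ∈ Ω) (hy : y ∈ Ω) : ∃ k, QC Ω x y k := by
  have hsub : Ω ⊆ {z | ∃ k, QC Ω x z k} := by
    apply hc.subset_of_closure_inter_subset
    · rw [isOpen_iff]
      rintro z ⟨k, hk⟩
      have hz : z ∈ Ω := by
        obtain ⟨ℓ, hl, γ, h1, rfl, rfl, h4, rfl⟩ := hk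
        exact h4 ℓ ⟨hl, le_rfl⟩
      have hd := dpos hO hne hz
      refine ⟨infDist z Ωᶜ / 2, by linarith, fun w hw => ?_⟩
      obtain ⟨k', _, hk'⟩ := QC_seg hO hne hz (y := w) (by rw [mem_ball'] at hw; exact hw.le)
      exact ⟨k + k', QC_trans hO hne hk hk'⟩
    · exact ⟨x, hx, 0, 0, le_rfl, fun _ => x, LipschitzOnWith.of_dist_le_mul (by simp), rfl,
        rfl, fun _ _ => hx, by simp⟩
    · rintro z ⟨hz1, hz⟩
      have hd := dpos hO hne hz
      obtain ⟨w, ⟨k, hk⟩, hw⟩ := Metric.mem_closure_iff.1 hz1 (infDist z Ωᶜ / 4) (by linarith)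
      have hwd := dlip Ω z w
      have hwΩ : w ∈ Ω := mem_of_dpos (by linarith)
      obtain ⟨k', _, hk'⟩ := QC_seg hO hne hwΩ (y := z) (by rw [dist_comm]; linarith)
      exact ⟨k + k', QC_trans hO hne hk hk'⟩
  exact hsub hy

lemma qhDist_le_of_QC {Ω : Set (Eu 2)} {x y : Eu 2} {k : ℝ} (h : QC Ω x y k) :
    qhDist Ω x y ≤ k :=
  csInf_le ⟨0, fun _ h => QC_nonneg h⟩ h

lemma QC_of_qhDist {Ω : Set (Eu 2)} (hO : IsOpen Ω) (hne : Ωᶜ.Nonempty) (hc : IsPreconnected Ω)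
    {x y : Eu 2} (hx : x ∈ Ω) (hy : y ∈ Ω) {k : ℝ} (hk : qhDist Ω x y < k) :
    ∃ k' < k, QC Ω x y k' := by
  obtain ⟨k', h1, h2⟩ := exists_lt_of_csInf_lt (chain_exists hO hne hc hx hy) hk
  exact ⟨k', h2, h1⟩

/-- minimal chains -/
lemma min_chain {Ω : Set (Eu 2)} (hO : IsOpen Ω) (hne : Ωᶜ.Nonempty) {N : ℕ} {x y : Eu 2}
    (h : Chain Ω N x y) : ∃ M ≤ N, ∃ f : ℕ → Eu 2, f 0 = x ∧ f M = y ∧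
      (∀ i < M, Adj Ω (f i) (f (i+1))) ∧ (∀ i ≤ M, f i ∈ Ω) ∧
      (∀ i j, i + 1 < j → j ≤ M → infDist (f i) Ωᶜ / 8 < dist (f i) (f j)) := by
  classical
  have hex : ∃ N, Chain Ω N x y := ⟨N, h⟩
  refine ⟨Nat.find hex, Nat.find_min' hex h, ?_⟩
  obtain ⟨f, h0, hM, hA, hm⟩ := Nat.find_spec hex
  refine ⟨f, h0, hM, hA, hm, ?_⟩
  intro i j hij hj
  by_contra hcon
  push Not at hcon
  apply Nat.find_min hex (m := Nat.find hex - (j - i - 1)) (by omega)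
  refine ⟨fun k => if k ≤ i then f k else f (k + (j - i - 1)), by simp [h0], ?_, ?_, ?_⟩
  · have : ¬ (Nat.find hex - (j - i - 1) ≤ i) := by omega
    simp only [this, if_false]
    rw [Nat.sub_add_cancel (by omega), hM]
  · intro k hk
    rcases lt_trichotomy k i with h | h | h
    · simp only [h.le, show k + 1 ≤ i from h, if_true]
      exact hA k (by omega)
    · subst h
      simp only [le_refl, if_true, show ¬ (k + 1 ≤ k) by omega, if_false]
      rw [show k + 1 + (j - k - 1) = j by omega]
      exact hcon
    · simp only [show ¬ (k ≤ i) by omega, show ¬ (k + 1 ≤ i) by omega, if_false]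
      rw [show k + 1 + (j - i - 1) = k + (j - i - 1) + 1 by omega]
      exact hA _ (by omega)
  · intro k hk
    dsimp only
    split_ifs
    · exact hm _ (by omega)
    · exact hm _ (by omega)

/-! ### Exponential integrability of the distance to the boundary -/

def Lg (Ω : Set (Eu 2)) (x : Eu 2) : ℝ := Real.log (1 + (infDist x Ωᶜ)⁻¹)

lemma Lg_nonneg (Ω : Set (Eu 2)) (x : Eu 2) : 0 ≤ Lg Ω x := by
  apply Real.log_nonneg
  have : 0 ≤ (infDist x Ωᶜ)⁻¹ := inv_nonneg.2 infDist_nonneg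
  linarith

lemma Lg_meas (Ω : Set (Eu 2)) : Measurable (Lg Ω) :=
  Real.measurable_log.comp (measurable_const.add measurable_infDist.inv)

lemma carrot_chain {Ω : Set (Eu 2)} (hO : IsOpen Ω) (hne : Ωᶜ.Nonempty) (hc : IsPreconnected Ω)
    (hw : IsWeakCarrot Ω) : ∃ x₀ ∈ Ω, ∃ A : ℝ, 1 ≤ A ∧ ∀ x ∈ Ω, ∃ N : ℕ, Chain Ω N x x₀ ∧
      (N : ℝ) ≤ A * (1 + Lg Ω x) := by
  obtain ⟨x₀, hx₀, C, hC, h⟩ := hw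
  have hlC := Real.log_nonneg hC
  refine ⟨x₀, hx₀, 9 * C + 9 * C * Real.log C + 11, by nlinarith, fun x hx => ?_⟩
  have hd := dpos hO hne hx
  obtain ⟨k, hk, hq⟩ := QC_of_qhDist hO hne hc hx hx₀ (lt_add_one (qhDist Ω x x₀))
  have hk0 := QC_nonneg hq
  obtain ⟨N, hN, hch⟩ := QC_to_chain hO hne ⌈9 * k⌉₊ x x₀ k hq (by
    have := Nat.le_ceil (9 * k)
    linarith)
  refine ⟨N, hch, ?_⟩
  have h1 : (N : ℝ) ≤ ⌈9 * k⌉₊ + 1 := by exact_mod_cast hN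
  have h2 := Nat.ceil_lt_add_one (show 0 ≤ 9 * k by linarith)
  have h3 : Real.log (C / infDist x Ωᶜ) ≤ Real.log C + Lg Ω x := by
    rw [Lg, ← Real.log_mul (by linarith) (by positivity)]
    apply Real.log_le_log (by positivity)
    rw [div_eq_mul_inv]
    apply mul_le_mul_of_nonneg_left _ (by linarith)
    linarith
  have h4 := h x hx
  have h5 := Lg_nonneg Ω x
  have h6 : C * Real.log (C / infDist x Ωᶜ) ≤ C * (Real.log C + Lg Ω x) :=
    mul_le_mul_of_nonneg_left h3 (by linarith)
  have h7 : 0 ≤ C * Real.log C := by positivity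
  nlinarith [mul_nonneg h7 h5]

lemma ball_disj {Ω : Set (Eu 2)} {x y : Eu 2} (hx : x ∈ Ω)
    (h : infDist x Ωᶜ / 8 < dist x y) :
    Disjoint (ball x (infDist x Ωᶜ / 64)) (ball y (infDist y Ωᶜ / 64)) := by
  apply ball_disjoint_ball
  have := dlip Ω y x
  rw [dist_comm] at this
  have := infDist_nonneg (x := x) (s := Ωᶜ)
  linarith

lemma sum_lintegral_le {Ω : Set (Eu 2)} (S : Finset ℕ) (B : ℕ → Set (Eu 2))
    (hB : ∀ i ∈ S, MeasurableSet (B i)) (hBΩ : ∀ i ∈ S, B i ⊆ Ω)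
    (hd : ∀ i ∈ S, ∀ j ∈ S, i + 1 < j → Disjoint (B i) (B j)) (h : Eu 2 → ℝ≥0∞) :
    ∑ i ∈ S, ∫⁻ y in B i, h y ≤ 2 * ∫⁻ y in Ω, h y := by
  have key : ∀ T ⊆ S, (∀ i ∈ T, ∀ j ∈ T, i < j → i + 1 < j) →
      ∑ i ∈ T, ∫⁻ y in B i, h y ≤ ∫⁻ y in Ω, h y := by
    intro T hT hTT
    rw [← lintegral_biUnion_finset]
    · apply lintegral_mono_set
      exact iUnion₂_subset fun i hi => hBΩ i (hT hi)
    · intro i hi j hj hij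
      rcases lt_or_gt_of_ne hij with h | h
      · exact hd i (hT hi) j (hT hj) (hTT i hi j hj h)
      · exact (hd j (hT hj) i (hT hi) (hTT j hj i hi h)).symm
    · exact fun i hi => hB i (hT hi)
  rw [← Finset.sum_filter_add_sum_filter_not S (fun i => i % 2 = 0), two_mul]
  apply add_le_add
  · apply key _ (Finset.filter_subset _ _)
    intro i hi j hj hij
    simp only [Finset.mem_filter] at hi hj
    omega
  · apply key _ (Finset.filter_subset _ _)
    intro i hi j hj hij
    simp only [Finset.mem_filter] at hi hj
    omega

def fK (Ω : Set (Eu 2)) (lam : ℝ) (x y : Eu 2) : ℝ≥0∞ :=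
  {q : Eu 2 × Eu 2 | dist q.1 q.2 < lam * infDist q.2 Ωᶜ}.indicator
    (fun q => ENNReal.ofReal ((infDist q.2 Ωᶜ)⁻¹ ^ 2)) (x, y)

lemma fK_meas (Ω : Set (Eu 2)) (lam : ℝ) : Measurable (Function.uncurry (fK Ω lam)) := by
  have : Function.uncurry (fK Ω lam) =
    {q : Eu 2 × Eu 2 | dist q.1 q.2 < lam * infDist q.2 Ωᶜ}.indicator
    (fun q => ENNReal.ofReal ((infDist q.2 Ωᶜ)⁻¹ ^ 2)) := by
    ext ⟨a, b⟩
    rfl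
  rw [this]
  apply Measurable.indicator
  · apply ENNReal.measurable_ofReal.comp
    exact ((measurable_infDist.comp measurable_snd).inv).pow_const 2
  · apply measurableSet_lt
    · exact measurable_dist
    · exact (measurable_infDist.comp measurable_snd).const_mul lam

lemma f_lower {Ω : Set (Eu 2)} (hO : IsOpen Ω) (hne : Ωᶜ.Nonempty) {x₀ : Eu 2} (hx₀ : x₀ ∈ Ω)
    {A D : ℝ} (hA : 1 ≤ A) (hD : ∀ x ∈ Ω, infDist x Ωᶜ ≤ D)
    (hch : ∀ x ∈ Ω, ∃ N : ℕ, Chain Ω N x x₀ ∧ (N : ℝ) ≤ A * (1 + Lg Ω x)) :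
    ∃ c b : ℝ, 0 < c ∧ 0 ≤ b ∧ ∀ x ∈ Ω,
      ENNReal.ofReal (c * (Lg Ω x - b)) ≤ ∫⁻ y in Ω, fK Ω (4 * A) x y := by
  have hd0 := dpos hO hne hx₀
  have hDpos : 0 < D := hd0.trans_le (hD _ hx₀)
  set b0 := |Real.log (infDist x₀ Ωᶜ)| + Real.log (1 + D) with hb0
  have hb00 : 0 ≤ b0 := add_nonneg (abs_nonneg _) (Real.log_nonneg (by linarith))
  refine ⟨Real.pi / 4225 / 4, 2 * b0 + 1, by positivity, by linarith, fun x hx => ?_⟩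
  have hd := dpos hO hne hx
  obtain ⟨N, hN, hNA⟩ := hch x hx
  obtain ⟨M, hMN, f, h0, hM, hadj, hmem, hsep⟩ := min_chain hO hne hN
  set d := infDist x Ωᶜ with hdd
  set ρ : ℕ → ℝ := fun i => dist x (f i) with hρ
  set e : ℕ → ℝ := fun i => infDist (f i) Ωᶜ with he
  have hρ0 : ∀ i, 0 ≤ ρ i := fun i => dist_nonneg
  have hepos : ∀ i ≤ M, 0 < e i := fun i hi => dpos hO hne (hmem i hi)
  have hele : ∀ i, e i ≤ ρ i + d := by
    intro i
    have := dlip Ω (f i) x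
    rw [dist_comm] at this
    simp only [he, hρ]
    linarith
  have hth : ∀ i ≤ M, e i / (ρ i + d) ≤ 1 := by
    intro i hi
    rw [div_le_one (by linarith [hρ0 i])]
    exact hele i
  -- telescoping
  have htel : Real.log (ρ M + d) - Real.log (ρ 0 + d) ≤
      ∑ i ∈ Finset.range M, e i / (ρ i + d) := by
    rw [← Finset.sum_range_sub (fun i => Real.log (ρ i + d))]
    apply Finset.sum_le_sum
    intro i hi
    have hi' : i < M := Finset.mem_range.1 hi
    have p1 : 0 < ρ i + d := by linarith [hρ0 i]
    have p2 : 0 < ρ (i+1) + d := by linarith [hρ0 (i+1)]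
    rw [← Real.log_div p2.ne' p1.ne']
    have := Real.log_le_sub_one_of_pos (div_pos p2 p1)
    refine this.trans ?_
    rw [div_sub_one p1.ne']
    apply div_le_div_of_nonneg_right _ p1.le
    have t := dist_triangle x (f i) (f (i+1))
    have a := hadj i hi'
    unfold Adj at a
    have := hepos i hi'.le
    simp only [hρ, he] at *
    linarith
  have hρ00 : ρ 0 = 0 := by simp [hρ, h0]
  have hρM : infDist x₀ Ωᶜ ≤ ρ M + d := by
    have := hele M
    simp only [he, hM] at this
    exact this
  have hlow : Lg Ω x - b0 ≤ ∑ i ∈ Finset.range M, e i / (ρ i + d) := by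
    refine le_trans ?_ htel
    rw [hρ00, zero_add]
    have h1 : Real.log (infDist x₀ Ωᶜ) ≤ Real.log (ρ M + d) := Real.log_le_log hd0 hρM
    have h2 : Lg Ω x = Real.log (1 + d) - Real.log d := by
      rw [Lg, ← hdd, ← Real.log_div (by linarith) hd.ne']
      congr 1
      rw [add_div, div_self hd.ne', one_div, add_comm]
    have h3 : Real.log (1 + d) ≤ Real.log (1 + D) :=
      Real.log_le_log (by linarith) (by linarith [hD x hx])
    have h4 := neg_abs_le (Real.log (infDist x₀ Ωᶜ))
    rw [h2]
    linarith
  classical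
  set S := (Finset.range M).filter (fun i => 1 / (2 * A) ≤ e i / (ρ i + d)) with hS
  have hsum : ∑ i ∈ Finset.range M, e i / (ρ i + d) ≤ S.card + M * (1 / (2 * A)) := by
    rw [← Finset.sum_filter_add_sum_filter_not (Finset.range M)
      (fun i => 1 / (2 * A) ≤ e i / (ρ i + d))]
    apply add_le_add
    · have := Finset.sum_le_card_nsmul S (fun i => e i / (ρ i + d)) 1 (by
        intro i hi
        simp only [hS, Finset.mem_filter, Finset.mem_range] at hi
        exact hth i hi.1.le)
      simpa only [nsmul_eq_mul, mul_one] using this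
    · refine (Finset.sum_le_card_nsmul _ _ (1 / (2 * A)) ?_).trans ?_
      · intro i hi
        simp only [Finset.mem_filter, not_le] at hi
        exact hi.2.le
      · rw [nsmul_eq_mul]
        apply mul_le_mul_of_nonneg_right _ (by positivity)
        have := Finset.card_filter_le (Finset.range M)
          (fun i => ¬ (1 / (2 * A) ≤ e i / (ρ i + d)))
        rw [Finset.card_range] at this
        exact_mod_cast this
  have hcard : (Lg Ω x - (2 * b0 + 1)) / 2 ≤ S.card := by
    have hMA : (M : ℝ) ≤ A * (1 + Lg Ω x) := le_trans (by exact_mod_cast hMN) hNA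
    have : (M : ℝ) * (1 / (2 * A)) ≤ (1 + Lg Ω x) / 2 := by
      rw [mul_one_div, div_le_div_iff₀ (by positivity) (by norm_num)]
      nlinarith
    linarith
  have hSM : ∀ i ∈ S, i < M := by
    intro i hi
    simp only [hS, Finset.mem_filter, Finset.mem_range] at hi
    exact hi.1
  have hInt0 := sum_lintegral_le (Ω := Ω) S (fun i => ball (f i) (e i / 64))
    (fun i _ => measurableSet_ball) (by
      intro i hi y hy
      apply mem_of_dist_lt (x := f i)
      rw [mem_ball'] at hy
      have := hepos i (hSM i hi).le
      simp only [he] at *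
      linarith) (by
      intro i hi j hj hij
      exact ball_disj (hmem i (hSM i hi).le) (hsep i j hij (hSM j hj).le)) (fK Ω (4 * A) x)
  have heach : ∀ i ∈ S, ENNReal.ofReal (Real.pi / 4225) ≤
      ∫⁻ y in ball (f i) (e i / 64), fK Ω (4 * A) x y := by
    intro i hi
    have hei := hepos i (hSM i hi).le
    have hbig : ρ i + d ≤ 2 * A * e i := by
      simp only [hS, Finset.mem_filter, Finset.mem_range] at hi
      have := hi.2
      rw [div_le_div_iff₀ (by positivity) (by linarith [hρ0 i])] at this
      linarith
    have : ∫⁻ y in ball (f i) (e i / 64), ENNReal.ofReal ((65 / 64 * e i)⁻¹ ^ 2) ≤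
        ∫⁻ y in ball (f i) (e i / 64), fK Ω (4 * A) x y := by
      apply setLIntegral_mono' measurableSet_ball
      intro y hy
      have hy' : dist (f i) y < e i / 64 := by rw [mem_ball'] at hy; exact hy
      have q1 : e i ≤ infDist y Ωᶜ + dist (f i) y := dlip Ω (f i) y
      have q2 : infDist y Ωᶜ ≤ e i + dist (f i) y := by
        have := dlip Ω y (f i)
        rwa [dist_comm] at this
      have q3 : dist x y < 4 * A * infDist y Ωᶜ := by
        have := dist_triangle x (f i) y
        have t1 : A * (63 / 64 * e i) ≤ A * infDist y Ωᶜ :=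
          mul_le_mul_of_nonneg_left (by linarith) (by linarith)
        have t2 : e i ≤ A * e i := by nlinarith
        simp only [hρ] at hbig
        nlinarith
      rw [fK, indicator_of_mem (by exact q3)]
      apply ENNReal.ofReal_le_ofReal
      apply pow_le_pow_left₀ (by positivity)
      apply inv_anti₀ (by linarith)
      linarith
    refine le_trans (le_of_eq ?_) this
    rw [setLIntegral_const, EuclideanSpace.volume_ball_fin_two, ← ENNReal.ofReal_pow (by positivity),
      ← ENNReal.ofReal_mul (by positivity), ← ENNReal.ofReal_mul (by positivity)]
    congr 1
    field_simp
    norm_num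
  have h1 : (S.card : ℝ≥0∞) * ENNReal.ofReal (Real.pi / 4225) ≤
      2 * ∫⁻ y in Ω, fK Ω (4 * A) x y := by
    refine le_trans ?_ hInt0
    rw [← nsmul_eq_mul]
    exact Finset.card_nsmul_le_sum _ _ _ heach
  have h2 : ENNReal.ofReal (2 * (Real.pi / 4225 / 4 * (Lg Ω x - (2 * b0 + 1)))) ≤
      2 * ∫⁻ y in Ω, fK Ω (4 * A) x y := by
    refine le_trans ?_ h1
    rw [← ENNReal.ofReal_natCast, ← ENNReal.ofReal_mul (by positivity)]
    apply ENNReal.ofReal_le_ofReal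
    have : 0 < Real.pi / 4225 := by positivity
    nlinarith
  rw [ENNReal.ofReal_mul (by norm_num), ENNReal.ofReal_ofNat] at h2
  exact (ENNReal.mul_le_mul_iff_right (by norm_num) (by norm_num)).1 h2

def ME (Ω E : Set (Eu 2)) (lam : ℝ) (y : Eu 2) : ℝ≥0∞ := ∫⁻ x in E, fK Ω lam x y

lemma ME_eq (Ω E : Set (Eu 2)) (lam : ℝ) (y : Eu 2) :
    ME Ω E lam y =
      ENNReal.ofReal ((infDist y Ωᶜ)⁻¹ ^ 2) * volume (ball y (lam * infDist y Ωᶜ) ∩ E) := by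
  have : ∀ x, fK Ω lam x y = (ball y (lam * infDist y Ωᶜ)).indicator
      (fun _ => ENNReal.ofReal ((infDist y Ωᶜ)⁻¹ ^ 2)) x := by
    intro x
    simp only [fK, indicator, mem_ball, mem_setOf_eq]
  simp only [ME, this]
  rw [lintegral_indicator measurableSet_ball, lintegral_const, Measure.restrict_restrict
    measurableSet_ball]
  simp

lemma ME_meas (Ω E : Set (Eu 2)) (lam : ℝ) : Measurable (ME Ω E lam) := by
  unfold ME
  exact Measurable.lintegral_prod_left (fK_meas Ω lam)

lemma ME_le {Ω : Set (Eu 2)} (hO : IsOpen Ω) (hne : Ωᶜ.Nonempty) (E : Set (Eu 2)) {lam : ℝ}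
    (hl : 0 ≤ lam) {y : Eu 2} (hy : y ∈ Ω) : ME Ω E lam y ≤ ENNReal.ofReal (Real.pi * lam ^ 2) := by
  have hd := dpos hO hne hy
  rw [ME_eq]
  calc _ ≤ ENNReal.ofReal ((infDist y Ωᶜ)⁻¹ ^ 2) * volume (ball y (lam * infDist y Ωᶜ)) := by
        gcongr
        exact inter_subset_left
    _ = _ := by
        rw [EuclideanSpace.volume_ball_fin_two, ← ENNReal.ofReal_pow (by positivity),
          ← ENNReal.ofReal_mul (by positivity), ← ENNReal.ofReal_mul (by positivity)]
        congr 1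
        field_simp

lemma weak_type {Ω : Set (Eu 2)} (hO : IsOpen Ω) (hne : Ωᶜ.Nonempty) {E : Set (Eu 2)}
    (hE : MeasurableSet E) {lam D : ℝ}
    (hl : 0 < lam) (hD : ∀ x ∈ Ω, infDist x Ωᶜ ≤ D) (t : ℝ≥0∞) :
    t * volume {y ∈ Ω | t < ME Ω E lam y} ≤ ENNReal.ofReal (25 * Real.pi * lam ^ 2) * volume E := by
  obtain ⟨u, hu, hdisj, hcov⟩ := Vitali.exists_disjoint_subfamily_covering_enlargement_closedBall
    {y ∈ Ω | t < ME Ω E lam y} id (fun y => lam * infDist y Ωᶜ) (lam * D)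
    (fun a ha => mul_le_mul_of_nonneg_left (hD a ha.1) hl.le) 5 (by norm_num)
  have hpos : ∀ a ∈ u, 0 < lam * infDist a Ωᶜ := fun a ha => mul_pos hl (dpos hO hne (hu ha).1)
  have hcount : u.Countable := by
    apply hdisj.countable_of_nonempty_interior
    intro i hi
    exact ⟨i, ball_subset_interior_closedBall (mem_ball_self (hpos i hi))⟩
  have hsub : {y ∈ Ω | t < ME Ω E lam y} ⊆ ⋃ b ∈ u, closedBall b (5 * (lam * infDist b Ωᶜ)) := by
    intro a ha
    obtain ⟨b, hb, hab⟩ := hcov a ha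
    refine mem_biUnion hb (hab (mem_closedBall_self ?_))
    exact mul_nonneg hl.le infDist_nonneg
  calc t * volume {y ∈ Ω | t < ME Ω E lam y}
      ≤ t * ∑' b : u, volume (closedBall (b : Eu 2) (5 * (lam * infDist (b : Eu 2) Ωᶜ))) := by
        gcongr
        exact (measure_mono hsub).trans (measure_biUnion_le _ hcount _)
    _ = ∑' b : u, t * volume (closedBall (b : Eu 2) (5 * (lam * infDist (b : Eu 2) Ωᶜ))) := by
        rw [ENNReal.tsum_mul_left]
    _ ≤ ∑' b : u, ENNReal.ofReal (25 * Real.pi * lam ^ 2) *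
          volume (closedBall (b : Eu 2) (lam * infDist (b : Eu 2) Ωᶜ) ∩ E) := by
        apply ENNReal.tsum_le_tsum
        rintro ⟨b, hb⟩
        have hd := dpos hO hne (hu hb).1
        have hlt := (hu hb).2
        rw [ME_eq] at hlt
        simp only
        rw [EuclideanSpace.volume_closedBall_fin_two, ← ENNReal.ofReal_pow (by positivity),
          ← ENNReal.ofReal_mul (by positivity)]
        calc t * ENNReal.ofReal ((5 * (lam * infDist b Ωᶜ)) ^ 2 * Real.pi)
            ≤ (ENNReal.ofReal ((infDist b Ωᶜ)⁻¹ ^ 2) * volume (ball b (lam * infDist b Ωᶜ) ∩ E)) *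
              ENNReal.ofReal ((5 * (lam * infDist b Ωᶜ)) ^ 2 * Real.pi) := by gcongr
          _ = ENNReal.ofReal (25 * Real.pi * lam ^ 2) * volume (ball b (lam * infDist b Ωᶜ) ∩ E) := by
              rw [mul_right_comm, ← ENNReal.ofReal_mul (by positivity)]
              congr 2
              field_simp
              norm_num
          _ ≤ _ := by
              gcongr
              exact ball_subset_closedBall
    _ = ENNReal.ofReal (25 * Real.pi * lam ^ 2) *
          ∑' b : u, volume (closedBall (b : Eu 2) (lam * infDist (b : Eu 2) Ωᶜ) ∩ E) := by
        rw [ENNReal.tsum_mul_left]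
    _ ≤ _ := by
        gcongr
        rw [← measure_biUnion hcount (f := fun b => closedBall b (lam * infDist b Ωᶜ) ∩ E)]
        · exact measure_mono (iUnion₂_subset fun _ _ => inter_subset_right)
        · intro a ha b hb hab
          exact (hdisj ha hb hab).mono inter_subset_left inter_subset_left
        · exact fun b _ => measurableSet_closedBall.inter hE

lemma layer (V a : ℝ≥0∞) (h : a ≤ V) (K : ℕ) :
    a ≤ V * 2⁻¹ ^ K + ∑ k ∈ Finset.range K, if V * 2⁻¹ ^ (k+1) < a then V * 2⁻¹ ^ k else 0 := by
  induction K with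
  | zero => simpa using h
  | succ n ih =>
    rw [Finset.sum_range_succ]
    split_ifs with hh
    · refine ih.trans ?_
      rw [add_comm (V * _)]
      calc _ ≤ _ := le_self_add (a := _) (b := V * 2⁻¹ ^ (n+1))
        _ = _ := by ring
    · push Not at hh
      exact hh.trans le_self_add

lemma ME_int {Ω : Set (Eu 2)} (hO : IsOpen Ω) (hne : Ωᶜ.Nonempty) {E : Set (Eu 2)}
    (hE : MeasurableSet E) {lam D : ℝ}
    (hl : 0 < lam) (hD : ∀ x ∈ Ω, infDist x Ωᶜ ≤ D) (K : ℕ) :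
    ∫⁻ y in Ω, ME Ω E lam y ≤ ENNReal.ofReal (Real.pi * lam ^ 2) * 2⁻¹ ^ K * volume Ω +
      K * (2 * (ENNReal.ofReal (25 * Real.pi * lam ^ 2) * volume E)) := by
  set V := ENNReal.ofReal (Real.pi * lam ^ 2) with hV
  have hms : ∀ k : ℕ, MeasurableSet {y | V * 2⁻¹ ^ (k+1) < ME Ω E lam y} := fun k =>
    measurableSet_lt measurable_const (ME_meas Ω E lam)
  calc ∫⁻ y in Ω, ME Ω E lam y ≤ ∫⁻ y in Ω, (V * 2⁻¹ ^ K + ∑ k ∈ Finset.range K,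
          ({y | V * 2⁻¹ ^ (k+1) < ME Ω E lam y}.indicator (fun _ => V * 2⁻¹ ^ k) y)) := by
        apply setLIntegral_mono' hO.measurableSet
        intro y hy
        refine (layer V _ (ME_le hO hne E hl.le hy) K).trans (le_of_eq ?_)
        simp [indicator]
    _ = V * 2⁻¹ ^ K * volume Ω + ∑ k ∈ Finset.range K,
          V * 2⁻¹ ^ k * volume {y ∈ Ω | V * 2⁻¹ ^ (k+1) < ME Ω E lam y} := by
        rw [lintegral_add_left measurable_const, lintegral_finsetSum]
        · congr 1
          · simp
          · apply Finset.sum_congr rfl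
            intro k _
            rw [lintegral_indicator (hms k), setLIntegral_const, Measure.restrict_apply (hms k)]
            congr 2
            ext y
            simp [and_comm]
        · intro k _
          exact measurable_const.indicator (hms k)
    _ ≤ _ := by
        gcongr
        refine (Finset.sum_le_card_nsmul _ _
          (2 * (ENNReal.ofReal (25 * Real.pi * lam ^ 2) * volume E)) ?_).trans ?_
        · intro k _
          have := weak_type hO hne hE hl hD (V * 2⁻¹ ^ (k+1))
          calc V * 2⁻¹ ^ k * volume {y ∈ Ω | V * 2⁻¹ ^ (k+1) < ME Ω E lam y}
              = 2 * (V * 2⁻¹ ^ (k+1) * volume {y ∈ Ω | V * 2⁻¹ ^ (k+1) < ME Ω E lam y}) := by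
                have h2 : (2:ℝ≥0∞) * 2⁻¹ = 1 := ENNReal.mul_inv_cancel (by norm_num) (by norm_num)
                rw [pow_succ]
                calc _ = V * 2⁻¹ ^ k * (2 * 2⁻¹) *
                    volume {y ∈ Ω | V * (2⁻¹ ^ k * 2⁻¹) < ME Ω E lam y} := by
                      rw [h2, mul_one]
                  _ = _ := by ring
            _ ≤ _ := by gcongr
        · simp


lemma exp_decay {Ω : Set (Eu 2)} (hO : IsOpen Ω) (hne : Ωᶜ.Nonempty) (hbd : Bornology.IsBounded Ω)
    {x₀ : Eu 2} (hx₀ : x₀ ∈ Ω)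
    {A D : ℝ} (hA : 1 ≤ A) (hD : ∀ x ∈ Ω, infDist x Ωᶜ ≤ D)
    (hch : ∀ x ∈ Ω, ∃ N : ℕ, Chain Ω N x x₀ ∧ (N : ℝ) ≤ A * (1 + Lg Ω x)) :
    ∃ Q C : ℝ, 0 < Q ∧ 0 < C ∧ ∀ j : ℕ, volume {x ∈ Ω | Q * j ≤ Lg Ω x} ≤
      ENNReal.ofReal (C * (1/2)^j) := by
  obtain ⟨c, b, hc, hb, hlow⟩ := f_lower hO hne hx₀ hA hD hch
  have hfin : volume Ω ≠ ⊤ := hbd.measure_lt_top.ne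
  set w := (volume Ω).toReal with hw
  have hw0 : 0 ≤ w := ENNReal.toReal_nonneg
  have hwe : volume Ω = ENNReal.ofReal w := (ENNReal.ofReal_toReal hfin).symm
  set V := Real.pi * (4 * A) ^ 2 with hV
  set W := 25 * Real.pi * (4 * A) ^ 2 with hW
  have hV0 : 0 < V := by positivity
  have hW0 : 0 < W := by positivity
  set Q := (2 * W + 1) / c with hQ
  have hQ0 : 0 < Q := by positivity
  have hcQ : c * Q = 2 * W + 1 := by rw [hQ]; field_simp
  set C := V * w + w * 2 ^ (⌈c * b⌉₊ + 1) + 1 with hC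
  have hC0 : 0 < C := by positivity
  refine ⟨Q, C, hQ0, hC0, fun j => ?_⟩
  set E := {x ∈ Ω | Q * j ≤ Lg Ω x} with hE
  have hEm : MeasurableSet E := hO.measurableSet.inter (measurableSet_le measurable_const (Lg_meas Ω))
  have hEΩ : E ⊆ Ω := fun x hx => hx.1
  have hEfin : volume E ≠ ⊤ := ((measure_mono hEΩ).trans_lt hfin.lt_top).ne
  set m := (volume E).toReal with hm
  have hm0 : 0 ≤ m := ENNReal.toReal_nonneg
  have hme : volume E = ENNReal.ofReal m := (ENNReal.ofReal_toReal hEfin).symm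
  have hmw : m ≤ w := ENNReal.toReal_mono hfin (measure_mono hEΩ)
  rw [hme]
  apply ENNReal.ofReal_le_ofReal
  by_cases hj : j < ⌈c * b⌉₊ + 1
  · have h1 : (1:ℝ) ≤ 2 ^ (⌈c * b⌉₊ + 1) * (1/2)^j := by
      rw [one_div, inv_pow, ← div_eq_mul_inv, one_le_div (by positivity)]
      exact pow_le_pow_right₀ (by norm_num) hj.le
    have h2 : (0:ℝ) < (1/2)^j := by positivity
    calc m ≤ w := hmw
      _ ≤ w * (2 ^ (⌈c * b⌉₊ + 1) * (1/2)^j) := le_mul_of_one_le_right hw0 h1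
      _ ≤ C * (1/2)^j := by
        rw [hC, ← mul_assoc]
        apply mul_le_mul_of_nonneg_right _ h2.le
        nlinarith [mul_nonneg hV0.le hw0]
  · have hj' : c * b + 1 ≤ j := by
      push Not at hj
      have : ((⌈c * b⌉₊ + 1 : ℕ) : ℝ) ≤ j := by exact_mod_cast hj
      push_cast at this
      linarith [Nat.le_ceil (c * b)]
    have h1 : ENNReal.ofReal (c * (Q * j - b)) * volume E ≤
        ENNReal.ofReal V * 2⁻¹ ^ j * volume Ω + j * (2 * (ENNReal.ofReal W * volume E)) := by
      refine le_trans ?_ (ME_int hO hne hEm (lam := 4 * A) (by positivity) hD j)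
      have : ∫⁻ y in Ω, ME Ω E (4 * A) y = ∫⁻ x in E, ∫⁻ y in Ω, fK Ω (4 * A) x y := by
        unfold ME
        rw [lintegral_lintegral_swap]
        exact ((fK_meas Ω (4*A)).comp measurable_swap).aemeasurable
      rw [this, ← setLIntegral_const]
      apply setLIntegral_mono' hEm
      intro x hx
      refine le_trans ?_ (hlow x hx.1)
      apply ENNReal.ofReal_le_ofReal
      apply mul_le_mul_of_nonneg_left _ hc.le
      linarith [hx.2]
    have hpos : 0 ≤ c * (Q * j - b) := by
      have : c * (Q * j - b) = (2 * W + 1) * j - c * b := by rw [← hcQ]; ring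
      rw [this]
      have : (0:ℝ) ≤ j := Nat.cast_nonneg j
      nlinarith
    have e1 : (2⁻¹ : ℝ≥0∞) ^ j = ENNReal.ofReal ((1/2)^j) := by
      rw [ENNReal.ofReal_pow (by norm_num)]
      congr 1
      rw [one_div, ENNReal.ofReal_inv_of_pos (by norm_num)]
      norm_num
    have e2 : (j : ℝ≥0∞) = ENNReal.ofReal j := (ENNReal.ofReal_natCast j).symm
    have e3 : (2 : ℝ≥0∞) = ENNReal.ofReal 2 := by norm_num
    rw [e1, e2, hme, hwe, e3, ← ENNReal.ofReal_mul hpos, ← ENNReal.ofReal_mul hV0.le,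
      ← ENNReal.ofReal_mul (by positivity), ← ENNReal.ofReal_mul hW0.le,
      ← ENNReal.ofReal_mul (by norm_num), ← ENNReal.ofReal_mul (by positivity),
      ← ENNReal.ofReal_add (by positivity) (by positivity),
      ENNReal.ofReal_le_ofReal_iff (by positivity)] at h1
    have h2 : (j - c * b) * m ≤ V * (1/2)^j * w := by
      have : c * (Q * j - b) = (2 * W + 1) * j - c * b := by rw [← hcQ]; ring
      rw [this] at h1
      nlinarith
    have h3 : m ≤ V * (1/2)^j * w := by nlinarith
    have h4 : (0:ℝ) < (1/2)^j := by positivity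
    calc m ≤ (V * w) * (1/2)^j := by linarith
      _ ≤ C * (1/2)^j := by
        apply mul_le_mul_of_nonneg_right _ h4.le
        rw [hC]
        have : 0 ≤ w * 2 ^ (⌈c * b⌉₊ + 1) := by positivity
        linarith

lemma exp_int {Ω : Set (Eu 2)} (hO : IsOpen Ω) (hne : Ωᶜ.Nonempty) (hbd : Bornology.IsBounded Ω)
    {x₀ : Eu 2} (hx₀ : x₀ ∈ Ω)
    {A D : ℝ} (hA : 1 ≤ A) (hD : ∀ x ∈ Ω, infDist x Ωᶜ ≤ D)
    (hch : ∀ x ∈ Ω, ∃ N : ℕ, Chain Ω N x x₀ ∧ (N : ℝ) ≤ A * (1 + Lg Ω x)) :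
    ∃ τ : ℝ, 0 < τ ∧ ∫⁻ x in Ω, ENNReal.ofReal (Real.exp (τ * Lg Ω x)) < ⊤ := by
  obtain ⟨Q, C, hQ, hC, h⟩ := exp_decay hO hne hbd hx₀ hA hD hch
  have hl : 0 < Real.log (3/2) := Real.log_pos (by norm_num)
  refine ⟨Real.log (3/2) / Q, by positivity, ?_⟩
  have hEm : ∀ j : ℕ, MeasurableSet {x ∈ Ω | Q * j ≤ Lg Ω x} := fun j =>
    hO.measurableSet.inter (measurableSet_le measurable_const (Lg_meas Ω))
  calc ∫⁻ x in Ω, ENNReal.ofReal (Real.exp (Real.log (3/2) / Q * Lg Ω x))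
      ≤ ∫⁻ x in Ω, ∑' j : ℕ, {x ∈ Ω | Q * j ≤ Lg Ω x}.indicator
          (fun _ => ENNReal.ofReal ((3/2)^(j+1))) x := by
        apply setLIntegral_mono' hO.measurableSet
        intro x hx
        set j := ⌊Lg Ω x / Q⌋₊ with hj
        refine le_trans ?_ (ENNReal.le_tsum j)
        have h1 : (j : ℝ) ≤ Lg Ω x / Q := Nat.floor_le (div_nonneg (Lg_nonneg Ω x) hQ.le)
        have h2 : Lg Ω x / Q < j + 1 := Nat.lt_floor_add_one _
        rw [indicator_of_mem (by
          refine ⟨hx, ?_⟩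
          rw [le_div_iff₀ hQ] at h1
          linarith)]
        apply ENNReal.ofReal_le_ofReal
        have : ((3:ℝ)/2)^(j+1) = Real.exp (Real.log (3/2) * (j+1)) := by
          rw [Real.exp_mul, Real.exp_log (by norm_num)]
          norm_cast
        rw [this]
        apply Real.exp_le_exp.2
        calc Real.log (3/2) / Q * Lg Ω x = Real.log (3/2) * (Lg Ω x / Q) := by ring
          _ ≤ _ := mul_le_mul_of_nonneg_left h2.le hl.le
    _ = ∑' j : ℕ, ∫⁻ x in Ω, {x ∈ Ω | Q * j ≤ Lg Ω x}.indicator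
          (fun _ => ENNReal.ofReal ((3/2)^(j+1))) x :=
        lintegral_tsum (fun j => (measurable_const.indicator (hEm j)).aemeasurable)
    _ ≤ ∑' j : ℕ, ENNReal.ofReal (3/2 * C) * (ENNReal.ofReal (3/4)) ^ j := by
        apply ENNReal.tsum_le_tsum
        intro j
        refine (setLIntegral_le_lintegral _ _).trans ?_
        rw [lintegral_indicator_const (hEm j)]
        calc _ ≤ ENNReal.ofReal ((3/2)^(j+1)) * ENNReal.ofReal (C * (1/2)^j) := by
              gcongr
              exact h j
          _ = _ := by
              rw [← ENNReal.ofReal_mul (by positivity), ← ENNReal.ofReal_pow (by norm_num),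
                ← ENNReal.ofReal_mul (by positivity)]
              congr 1
              have : ((3:ℝ)/4)^j = (3/2)^j * (1/2)^j := by rw [← mul_pow]; norm_num
              rw [this, pow_succ]
              ring
    _ < ⊤ := by
        rw [ENNReal.tsum_mul_left, ENNReal.tsum_geometric]
        apply ENNReal.mul_lt_top ENNReal.ofReal_lt_top
        rw [ENNReal.inv_lt_top]
        apply tsub_pos_of_lt
        rw [ENNReal.ofReal_lt_one]
        norm_num

lemma exists_D {Ω : Set (Eu 2)} (hne : Ωᶜ.Nonempty) (hbd : Bornology.IsBounded Ω) :
    ∃ D : ℝ, 0 < D ∧ ∀ x ∈ Ω, infDist x Ωᶜ ≤ D := by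
  obtain ⟨a, ha⟩ := hne
  obtain ⟨R, hR⟩ := hbd.subset_closedBall a
  refine ⟨max R 1, by positivity, fun x hx => ?_⟩
  exact (infDist_le_dist_of_mem ha).trans ((hR hx).trans (le_max_left _ _))


lemma good_point {Ω : Set (Eu 2)} {s : ℝ} (hs : 0 < s) {g : Eu 2 → ℝ} (hg : Measurable g)
    (hg0 : ∀ x, 0 ≤ g x) {N : Set (Eu 2)} (hN : volume N = 0)
    (hI : ∫⁻ x in Ω, ENNReal.ofReal (g x ^ (2/s)) ≤ 1)
    (c : Eu 2) {r : ℝ} (hr : 0 < r) (hB : ball c r ⊆ Ω) :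
    ∃ y ∈ ball c r, y ∉ N ∧
      ENNReal.ofReal ((r ^ s * g y) ^ (2/s)) ≤ ∫⁻ x in ball c r, ENNReal.ofReal (g x ^ (2/s)) := by
  have hgm : Measurable (fun x => ENNReal.ofReal (g x ^ (2/s))) :=
    (hg.pow_const _).ennreal_ofReal
  have hvol : volume (ball c r) = ENNReal.ofReal (Real.pi * r ^ 2) := by
    rw [EuclideanSpace.volume_ball_fin_two, ← ENNReal.ofReal_pow hr.le,
      ← ENNReal.ofReal_mul (by positivity), mul_comm]
  have hrs : ∀ y, (r ^ s * g y) ^ (2/s) = r ^ 2 * g y ^ (2/s) := by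
    intro y
    rw [Real.mul_rpow (by positivity) (hg0 y), ← Real.rpow_mul hr.le, mul_div_cancel₀ _ hs.ne']
    norm_cast
  by_contra! hcon
  set T := ∫⁻ x in ball c r, ENNReal.ofReal (g x ^ (2/s)) with hT
  have hTfin : T ≠ ⊤ := by
    refine ((lintegral_mono_set hB).trans hI |>.trans_lt ENNReal.one_lt_top).ne
  have hlt : ENNReal.ofReal (r^2) ≠ 0 := by simp; positivity
  have key : T < T := by
    calc T ≤ ENNReal.ofReal Real.pi * T := by
          apply le_mul_of_one_le_left' 
          rw [ENNReal.one_le_ofReal]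
          linarith [Real.pi_gt_three]
      _ = ∫⁻ x in ball c r, (ENNReal.ofReal (r^2))⁻¹ * T := by
          rw [setLIntegral_const, hvol, ENNReal.ofReal_mul Real.pi_pos.le]
          rw [mul_comm, mul_assoc, mul_left_comm]
          conv_lhs => rw [← one_mul T, ← ENNReal.inv_mul_cancel hlt ENNReal.ofReal_ne_top]
          ring
      _ < ∫⁻ x in ball c r, ENNReal.ofReal (g x ^ (2/s)) := by
          apply setLIntegral_strict_mono measurableSet_ball
          · rw [hvol]; simp; positivity
          · exact hgm
          · rw [setLIntegral_const, hvol]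
            exact (ENNReal.mul_lt_top (ENNReal.mul_lt_top (by simp; positivity) hTfin.lt_top)
              ENNReal.ofReal_lt_top).ne
          · have : ∀ᵐ x, x ∉ N := measure_eq_zero_iff_ae_notMem.1 hN
            filter_upwards [this] with x hx hxB
            have := hcon x hxB hx
            rw [hrs, ENNReal.ofReal_mul (by positivity)] at this
            rw [mul_comm, ← div_eq_mul_inv]
            exact ENNReal.div_lt_of_lt_mul' this
  exact lt_irrefl _ key

lemma chain_bound {Ω : Set (Eu 2)} {s : ℝ} (hs : 0 < s) (hs1 : s ≤ 1) {u g : Eu 2 → ℝ}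
    (hg0 : ∀ x, 0 ≤ g x) {N : Set (Eu 2)}
    (hI : ∫⁻ x in Ω, ENNReal.ofReal (g x ^ (2/s)) ≤ 1)
    (H : ∀ x ∈ Ω \ N, ∀ y ∈ Ω \ N, dist x y < infDist x Ωᶜ / 2 →
      |u x - u y| ≤ dist x y ^ s * (g x + g y))
    (M : ℕ) (c y : ℕ → Eu 2) (r : ℕ → ℝ) (hr : ∀ i ≤ M, 0 < r i)
    (hB : ∀ i ≤ M, ball (c i) (r i) ⊆ Ω) (hy : ∀ i ≤ M, y i ∈ Ω \ N)
    (hgy : ∀ i ≤ M, ENNReal.ofReal ((r i ^ s * g (y i)) ^ (2/s)) ≤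
      ∫⁻ x in ball (c i) (r i), ENNReal.ofReal (g x ^ (2/s)))
    (hdis : ∀ i j, i + 1 < j → j ≤ M → Disjoint (ball (c i) (r i)) (ball (c j) (r j)))
    (h1 : ∀ i < M, dist (y i) (y (i+1)) ≤ 16 * r i)
    (h2 : ∀ i < M, dist (y i) (y (i+1)) ≤ 16 * r (i+1))
    (h3 : ∀ i < M, dist (y i) (y (i+1)) < infDist (y i) Ωᶜ / 2) :
    |u (y 0) - u (y M)| ^ (2/(2-s)) ≤ 4096 * (M+1) := by
  set a : ℕ → ℝ := fun i => r i ^ s * g (y i) with ha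
  have ha0 : ∀ i ≤ M, 0 ≤ a i := fun i hi => mul_nonneg (Real.rpow_nonneg (hr i hi).le _) (hg0 _)
  have hp : 0 < 2/s := by positivity
  have hq : 0 < 2/(2-s) := by apply div_pos <;> linarith
  have hpq : (2/s).HolderConjugate (2/(2-s)) := by
    rw [Real.holderConjugate_iff]
    refine ⟨by rw [lt_div_iff₀ hs]; linarith, ?_⟩
    field_simp
    ring
  have h16 : (16:ℝ)^s ≤ 16 := by
    calc (16:ℝ)^s ≤ 16 ^ (1:ℝ) := Real.rpow_le_rpow_of_exponent_le (by norm_num) hs1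
      _ = 16 := by simp
  have hstep : ∀ i < M, |u (y i) - u (y (i+1))| ≤ 16 * (a i + a (i+1)) := by
    intro i hi
    have A := H _ (hy i hi.le) _ (hy (i+1) hi) (h3 i hi)
    have b1 : dist (y i) (y (i+1)) ^ s ≤ 16 * r i ^ s := by
      calc _ ≤ (16 * r i) ^ s := Real.rpow_le_rpow dist_nonneg (h1 i hi) hs.le
        _ = 16 ^ s * r i ^ s := Real.mul_rpow (by norm_num) (hr i hi.le).le
        _ ≤ _ := mul_le_mul_of_nonneg_right h16 (Real.rpow_nonneg (hr i hi.le).le _)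
    have b2 : dist (y i) (y (i+1)) ^ s ≤ 16 * r (i+1) ^ s := by
      calc _ ≤ (16 * r (i+1)) ^ s := Real.rpow_le_rpow dist_nonneg (h2 i hi) hs.le
        _ = 16 ^ s * r (i+1) ^ s := Real.mul_rpow (by norm_num) (hr (i+1) hi).le
        _ ≤ _ := mul_le_mul_of_nonneg_right h16 (Real.rpow_nonneg (hr (i+1) hi).le _)
    have c1 := mul_le_mul_of_nonneg_right b1 (hg0 (y i))
    have c2 := mul_le_mul_of_nonneg_right b2 (hg0 (y (i+1)))
    simp only [ha]
    nlinarith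
  have hsum : |u (y 0) - u (y M)| ≤ 32 * ∑ i ∈ Finset.range (M+1), a i := by
    have e1 : u (y 0) - u (y M) = ∑ i ∈ Finset.range M, (u (y i) - u (y (i+1))) :=
      (Finset.sum_range_sub' (fun i => u (y i)) M).symm
    rw [e1]
    refine (Finset.abs_sum_le_sum_abs _ _).trans ?_
    refine (Finset.sum_le_sum (fun i hi => hstep i (Finset.mem_range.1 hi))).trans ?_
    rw [← Finset.mul_sum, Finset.sum_add_distrib]
    have s1 : ∑ i ∈ Finset.range M, a i ≤ ∑ i ∈ Finset.range (M+1), a i := by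
      rw [Finset.sum_range_succ]
      linarith [ha0 M le_rfl]
    have s2 : ∑ i ∈ Finset.range M, a (i+1) ≤ ∑ i ∈ Finset.range (M+1), a i := by
      rw [Finset.sum_range_succ']
      linarith [ha0 0 (Nat.zero_le _)]
    linarith
  have hap : ∑ i ∈ Finset.range (M+1), a i ^ (2/s) ≤ 2 := by
    have := sum_lintegral_le (Ω := Ω) (Finset.range (M+1)) (fun i => ball (c i) (r i))
      (fun i _ => measurableSet_ball) (fun i hi => hB i (by simpa [Nat.lt_succ_iff] using hi))
      (fun i _ j hj hij => hdis i j hij (by simpa [Nat.lt_succ_iff] using hj))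
      (fun x => ENNReal.ofReal (g x ^ (2/s)))
    have h5 : ENNReal.ofReal (∑ i ∈ Finset.range (M+1), a i ^ (2/s)) ≤ ENNReal.ofReal 2 := by
      rw [ENNReal.ofReal_sum_of_nonneg (fun i hi =>
        Real.rpow_nonneg (ha0 i (by simpa [Nat.lt_succ_iff] using hi)) _)]
      calc _ ≤ _ := Finset.sum_le_sum (fun i hi => hgy i (by simpa [Nat.lt_succ_iff] using hi))
        _ ≤ _ := this
        _ ≤ 2 * 1 := by gcongr
        _ = _ := by norm_num
    exact (ENNReal.ofReal_le_ofReal_iff (by norm_num)).1 h5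
  have hhol : ∑ i ∈ Finset.range (M+1), a i ≤ 2 * ((M:ℝ)+1) ^ (1/(2/(2-s))) := by
    have := Real.inner_le_Lp_mul_Lq_of_nonneg (Finset.range (M+1)) hpq (f := a) (g := fun _ => 1)
      (fun i hi => ha0 i (by simpa [Nat.lt_succ_iff] using hi)) (fun _ _ => zero_le_one)
    simp only [mul_one, Real.one_rpow, Finset.sum_const, Finset.card_range, nsmul_eq_mul] at this
    push_cast at this
    refine this.trans ?_
    apply mul_le_mul_of_nonneg_right _ (Real.rpow_nonneg (by positivity) _)
    have hnn : 0 ≤ ∑ i ∈ Finset.range (M+1), a i ^ (2/s) := Finset.sum_nonneg (fun i hi =>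
      Real.rpow_nonneg (ha0 i (by simpa [Nat.lt_succ_iff] using hi)) _)
    calc _ ≤ (2:ℝ) ^ (1/(2/s)) := Real.rpow_le_rpow hnn hap (by positivity)
      _ ≤ 2 ^ (1:ℝ) := Real.rpow_le_rpow_of_exponent_le (by norm_num) (by
          rw [one_div_div]; linarith)
      _ = 2 := by simp
  have hfin : |u (y 0) - u (y M)| ≤ 64 * ((M:ℝ)+1) ^ (1/(2/(2-s))) := by linarith
  calc _ ≤ (64 * ((M:ℝ)+1) ^ (1/(2/(2-s)))) ^ (2/(2-s)) :=
        Real.rpow_le_rpow (abs_nonneg _) hfin hq.le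
    _ = 64 ^ (2/(2-s)) * (M+1) := by
        rw [Real.mul_rpow (by norm_num) (Real.rpow_nonneg (by positivity) _),
          ← Real.rpow_mul (by positivity), one_div_mul_cancel hq.ne', Real.rpow_one]
    _ ≤ 64 ^ (2:ℝ) * (M+1) := by
        gcongr
        · norm_num
        · rw [div_le_iff₀ (by linarith)]; linarith
    _ = _ := by norm_num


/-- The data used to derive pointwise bounds. -/
structure GD (Ω : Set (Eu 2)) (s : ℝ) (u g : Eu 2 → ℝ) (N : Set (Eu 2))
    (Y : Eu 2 → ℝ → Eu 2) : Prop where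
  hO : IsOpen Ω
  hne : Ωᶜ.Nonempty
  hs : 0 < s
  hs1 : s ≤ 1
  hg0 : ∀ x, 0 ≤ g x
  hI : ∫⁻ x in Ω, ENNReal.ofReal (g x ^ (2/s)) ≤ 1
  H : ∀ x ∈ Ω \ N, ∀ y ∈ Ω \ N, dist x y < infDist x Ωᶜ / 2 →
      |u x - u y| ≤ dist x y ^ s * (g x + g y)
  hY : ∀ c r, 0 < r → ball c r ⊆ Ω → Y c r ∈ ball c r ∧ Y c r ∉ N ∧
      ENNReal.ofReal ((r ^ s * g (Y c r)) ^ (2/s)) ≤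
        ∫⁻ x in ball c r, ENNReal.ofReal (g x ^ (2/s))

lemma ball_sub_of {Ω : Set (Eu 2)} {x c : Eu 2} {r : ℝ} (h : dist x c + r ≤ infDist x Ωᶜ) :
    ball c r ⊆ Ω := by
  intro y hy
  apply mem_of_dist_lt (x := x)
  have := dist_triangle x c y
  rw [mem_ball, dist_comm] at hy
  linarith

lemma path_part {Ω : Set (Eu 2)} {s : ℝ} {u g : Eu 2 → ℝ} {N : Set (Eu 2)}
    {Y : Eu 2 → ℝ → Eu 2} (h : GD Ω s u g N Y) {x x₀ : Eu 2} {n : ℕ} (hc : Chain Ω n x x₀) :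
    |u (Y x (infDist x Ωᶜ / 64)) - u (Y x₀ (infDist x₀ Ωᶜ / 64))| ^ (2/(2-s)) ≤
      4096 * (n+1) := by
  obtain ⟨M, hMN, f, h0, hM, hadj, hmem, hsep⟩ := min_chain h.hO h.hne hc
  have hd : ∀ i ≤ M, 0 < infDist (f i) Ωᶜ := fun i hi => dpos h.hO h.hne (hmem i hi)
  have hB : ∀ i ≤ M, ball (f i) (infDist (f i) Ωᶜ / 64) ⊆ Ω := by
    intro i hi
    apply ball_sub_of (x := f i)
    rw [dist_self]
    linarith [hd i hi]
  have hYb : ∀ i ≤ M, _ := fun i hi => h.hY (f i) _ (by linarith [hd i hi]) (hB i hi)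
  have dd : ∀ i < M, dist (Y (f i) (infDist (f i) Ωᶜ / 64))
        (Y (f (i+1)) (infDist (f (i+1)) Ωᶜ / 64)) ≤ 81/512 * infDist (f i) Ωᶜ ∧
        infDist (f i) Ωᶜ ≤ 8/7 * infDist (f (i+1)) Ωᶜ := by
    intro i hi
    have a := (hYb i hi.le).1
    have b := (hYb (i+1) hi).1
    rw [mem_ball] at a b
    have t1 := dist_triangle4 (Y (f i) (infDist (f i) Ωᶜ / 64)) (f i) (f (i+1))
      (Y (f (i+1)) (infDist (f (i+1)) Ωᶜ / 64))
    rw [dist_comm (f (i+1))] at t1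
    have t2 := hadj i hi
    unfold Adj at t2
    have t3 := dlip Ω (f i) (f (i+1))
    have t4 := dlip Ω (f (i+1)) (f i)
    rw [dist_comm (f (i+1))] at t4
    constructor <;> linarith
  have := chain_bound h.hs h.hs1 h.hg0 h.hI h.H M f
    (fun i => Y (f i) (infDist (f i) Ωᶜ / 64)) (fun i => infDist (f i) Ωᶜ / 64)
    (fun i hi => by linarith [hd i hi]) hB
    (fun i hi => ⟨hB i hi (hYb i hi).1, (hYb i hi).2.1⟩)
    (fun i hi => (hYb i hi).2.2)
    (fun i j hij hj => ball_disj (hmem i (by omega)) (hsep i j hij hj))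
    (fun i hi => by have := (dd i hi).1; have := hd i hi.le; linarith)
    (fun i hi => by have := dd i hi; have := hd i hi.le; linarith)
    (fun i hi => by
      have := (dd i hi).1
      have a := (hYb i hi.le).1
      rw [mem_ball, dist_comm] at a
      have := dlip Ω (f i) (Y (f i) (infDist (f i) Ωᶜ / 64))
      have := hd i hi.le
      linarith)
  simp only [h0, hM] at this
  refine this.trans ?_
  have : (M:ℝ) ≤ n := by exact_mod_cast hMN
  linarith

/-- a unit vector -/
def e1 : Eu 2 := EuclideanSpace.single 0 1

lemma norm_e1 : ‖e1‖ = 1 := by simp [e1]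

/-- centres of the shrinking chain -/
def cC (Ω : Set (Eu 2)) (x : Eu 2) (i : ℕ) : Eu 2 := x + ((1/2)^i * (infDist x Ωᶜ / 16)) • e1

/-- radii of the shrinking chain -/
def cR (Ω : Set (Eu 2)) (x : Eu 2) (i : ℕ) : ℝ := (1/2)^i * (infDist x Ωᶜ / 16) / 8

lemma cC_dist (Ω : Set (Eu 2)) (x : Eu 2) (i : ℕ) : dist x (cC Ω x i) = 8 * cR Ω x i := by
  have : 0 ≤ infDist x Ωᶜ := infDist_nonneg
  rw [cC, cR, dist_self_add_right, norm_smul, norm_e1, Real.norm_of_nonneg (by positivity)]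
  ring

lemma cC_dist2 (Ω : Set (Eu 2)) (x : Eu 2) {i j : ℕ} (hij : i ≤ j) :
    dist (cC Ω x i) (cC Ω x j) = 8 * (cR Ω x i - cR Ω x j) := by
  have h0 : 0 ≤ infDist x Ωᶜ := infDist_nonneg
  have : ((1:ℝ)/2)^j ≤ (1/2)^i := pow_le_pow_of_le_one (by norm_num) (by norm_num) hij
  rw [cC, cC, cR, cR, dist_add_left, dist_eq_norm, ← sub_smul, norm_smul, norm_e1,
    Real.norm_of_nonneg]
  · ring
  · rw [← sub_mul]
    apply mul_nonneg <;> linarith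

lemma cR_succ (Ω : Set (Eu 2)) (x : Eu 2) (i : ℕ) : cR Ω x (i+1) = cR Ω x i / 2 := by
  rw [cR, cR, pow_succ]; ring

lemma cR_le (Ω : Set (Eu 2)) (x : Eu 2) {i j : ℕ} (hij : i ≤ j) : cR Ω x j ≤ cR Ω x i := by
  have h0 : 0 ≤ infDist x Ωᶜ := infDist_nonneg
  have : ((1:ℝ)/2)^j ≤ (1/2)^i := pow_le_pow_of_le_one (by norm_num) (by norm_num) hij
  unfold cR
  gcongr

lemma cR_zero (Ω : Set (Eu 2)) (x : Eu 2) : cR Ω x 0 = infDist x Ωᶜ / 128 := by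
  unfold cR; ring

lemma cR_pos {Ω : Set (Eu 2)} {x : Eu 2} (hd : 0 < infDist x Ωᶜ) (i : ℕ) : 0 < cR Ω x i := by
  unfold cR; positivity

lemma cB {Ω : Set (Eu 2)} {x : Eu 2} (hd : 0 < infDist x Ωᶜ) (i : ℕ) :
    ball (cC Ω x i) (cR Ω x i) ⊆ Ω := by
  apply ball_sub_of (x := x)
  rw [cC_dist]
  have := cR_le Ω x (Nat.zero_le i)
  rw [cR_zero] at this
  linarith

lemma cY_dist {Ω : Set (Eu 2)} {s : ℝ} {u g : Eu 2 → ℝ} {N : Set (Eu 2)}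
    {Y : Eu 2 → ℝ → Eu 2} (h : GD Ω s u g N Y) {x : Eu 2} (hd : 0 < infDist x Ωᶜ) (i : ℕ) :
    dist x (Y (cC Ω x i) (cR Ω x i)) ≤ 9 * cR Ω x i := by
  have a := (h.hY _ _ (cR_pos hd i) (cB hd i)).1
  rw [mem_ball, dist_comm] at a
  have := dist_triangle x (cC Ω x i) (Y (cC Ω x i) (cR Ω x i))
  rw [cC_dist] at this
  linarith

lemma down_part {Ω : Set (Eu 2)} {s : ℝ} {u g : Eu 2 → ℝ} {N : Set (Eu 2)}
    {Y : Eu 2 → ℝ → Eu 2} (h : GD Ω s u g N Y) {x : Eu 2} (hd : 0 < infDist x Ωᶜ) (J : ℕ) :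
    |u (Y (cC Ω x 0) (cR Ω x 0)) - u (Y (cC Ω x J) (cR Ω x J))| ^ (2/(2-s)) ≤
      4096 * (J+1) := by
  have hYb : ∀ i, _ := fun i => h.hY (cC Ω x i) _ (cR_pos hd i) (cB hd i)
  have dd : ∀ i, dist (Y (cC Ω x i) (cR Ω x i)) (Y (cC Ω x (i+1)) (cR Ω x (i+1))) ≤
      8 * cR Ω x i := by
    intro i
    have a := (hYb i).1
    have b := (hYb (i+1)).1
    rw [mem_ball] at a b
    have t1 := dist_triangle4 (Y (cC Ω x i) (cR Ω x i)) (cC Ω x i) (cC Ω x (i+1))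
      (Y (cC Ω x (i+1)) (cR Ω x (i+1)))
    rw [dist_comm (cC Ω x (i+1)), cC_dist2 Ω x (Nat.le_succ i)] at t1
    rw [cR_succ] at *
    have := cR_pos hd i
    linarith
  apply chain_bound h.hs h.hs1 h.hg0 h.hI h.H J (cC Ω x)
    (fun i => Y (cC Ω x i) (cR Ω x i)) (cR Ω x)
    (fun i _ => cR_pos hd i) (fun i _ => cB hd i)
    (fun i _ => ⟨cB hd i (hYb i).1, (hYb i).2.1⟩)
    (fun i _ => (hYb i).2.2)
  · intro i j hij hj
    apply ball_disjoint_ball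
    rw [cC_dist2 Ω x (by omega)]
    have h1 := cR_le Ω x (show i + 1 ≤ j by omega)
    rw [cR_succ] at h1
    have := cR_pos hd i
    linarith
  · intro i hi
    have := dd i
    have := cR_pos hd i
    linarith
  · intro i hi
    have := dd i
    rw [cR_succ Ω x i] at *
    linarith
  · intro i hi
    have := dd i
    have a := cY_dist h hd i
    have b := dlip Ω x (Y (cC Ω x i) (cR Ω x i))
    have c := cR_le Ω x (Nat.zero_le i)
    rw [cR_zero] at c
    linarith

lemma mid_part {Ω : Set (Eu 2)} {s : ℝ} {u g : Eu 2 → ℝ} {N : Set (Eu 2)}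
    {Y : Eu 2 → ℝ → Eu 2} (h : GD Ω s u g N Y) {x : Eu 2} (hd : 0 < infDist x Ωᶜ) :
    |u (Y (cC Ω x 0) (cR Ω x 0)) - u (Y x (infDist x Ωᶜ / 64))| ^ (2/(2-s)) ≤
      4096 * (1+1) := by
  have hB2 : ball x (infDist x Ωᶜ / 64) ⊆ Ω := by
    apply ball_sub_of (x := x)
    rw [dist_self]
    linarith
  have y1 := h.hY _ _ (cR_pos hd 0) (cB hd 0)
  have y2 := h.hY x _ (by linarith) hB2
  have a := cY_dist h hd 0
  have b := y2.1
  rw [mem_ball] at b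
  have c := dlip Ω x (Y (cC Ω x 0) (cR Ω x 0))
  have t := dist_triangle_left (Y (cC Ω x 0) (cR Ω x 0)) (Y x (infDist x Ωᶜ / 64)) x
  rw [dist_comm x (Y x (infDist x Ωᶜ / 64))] at t
  rw [cR_zero] at *
  have key := chain_bound h.hs h.hs1 h.hg0 h.hI h.H 1
    (fun i => if i = 0 then cC Ω x 0 else x)
    (fun i => if i = 0 then Y (cC Ω x 0) (infDist x Ωᶜ / 128) else Y x (infDist x Ωᶜ / 64))
    (fun i => if i = 0 then infDist x Ωᶜ / 128 else infDist x Ωᶜ / 64)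
  simp only [if_true, one_ne_zero, if_false] at key
  have e : ∀ i : ℕ, i ≤ 1 → i = 0 ∨ i = 1 := by omega
  have := cB hd 0
  rw [cR_zero] at this
  have := key (by intro i hi; rcases e i hi with rfl | rfl <;> simp <;> linarith)
    (by intro i hi; rcases e i hi with rfl | rfl <;> simp <;> assumption)
    (by
      intro i hi; rcases e i hi with rfl | rfl
      · exact ⟨this y1.1, y1.2.1⟩
      · exact ⟨hB2 y2.1, y2.2.1⟩)
    (by
      intro i hi; rcases e i hi with rfl | rfl
      · exact y1.2.2
      · exact y2.2.2)
    (by intro i j h1 h2; omega)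
    (by intro i hi; have : i = 0 := by omega
        subst this; simp; linarith)
    (by intro i hi; have : i = 0 := by omega
        subst this; simp; linarith)
    (by intro i hi; have : i = 0 := by omega
        subst this; simp; linarith)
  simpa using this

lemma end_part {Ω : Set (Eu 2)} {s : ℝ} {u g : Eu 2 → ℝ} {N : Set (Eu 2)}
    {Y : Eu 2 → ℝ → Eu 2} (h : GD Ω s u g N Y) {D : ℝ} {x : Eu 2}
    (hD : infDist x Ωᶜ ≤ D) (hx : x ∈ Ω \ N) :
    ∃ J : ℕ, (J : ℝ) ≤ 1 + 2 / s * Real.log (1 + g x) ∧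
    |u x - u (Y (cC Ω x J) (cR Ω x J))| ≤ D + 10 := by
  have hs := h.hs
  have hd := dpos h.hO h.hne hx.1
  have hl0 : 0 ≤ Real.log (1 + g x) := Real.log_nonneg (by linarith [h.hg0 x])
  set J := ⌈2 / s * Real.log (1 + g x)⌉₊ with hJ
  refine ⟨J, ?_, ?_⟩
  · have := Nat.ceil_lt_add_one (show 0 ≤ 2 / s * Real.log (1 + g x) by positivity)
    linarith
  have hJ1 : 2 / s * Real.log (1 + g x) ≤ J := Nat.le_ceil _
  have y1 := h.hY _ _ (cR_pos hd J) (cB hd J)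
  have a := cY_dist h hd J
  have c := cR_le Ω x (Nat.zero_le J)
  rw [cR_zero] at c
  have key := h.H x hx _ ⟨cB hd J y1.1, y1.2.1⟩ (by linarith)
  have hrp := cR_pos hd J
  have h9 : (9:ℝ) ^ s ≤ 9 := by
    calc (9:ℝ)^s ≤ 9 ^ (1:ℝ) := Real.rpow_le_rpow_of_exponent_le (by norm_num) h.hs1
      _ = 9 := by simp
  have b1 : dist x (Y (cC Ω x J) (cR Ω x J)) ^ s ≤ 9 * cR Ω x J ^ s := by
    calc _ ≤ (9 * cR Ω x J) ^ s := Real.rpow_le_rpow dist_nonneg a hs.le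
      _ = 9 ^ s * cR Ω x J ^ s := Real.mul_rpow (by norm_num) hrp.le
      _ ≤ _ := mul_le_mul_of_nonneg_right h9 (Real.rpow_nonneg hrp.le _)
  have ha1 : cR Ω x J ^ s * g (Y (cC Ω x J) (cR Ω x J)) ≤ 1 := by
    have h1 := (y1.2.2.trans (lintegral_mono_set (cB hd J))).trans h.hI
    rw [ENNReal.ofReal_le_one] at h1
    have h0 : 0 ≤ cR Ω x J ^ s * g (Y (cC Ω x J) (cR Ω x J)) :=
      mul_nonneg (Real.rpow_nonneg hrp.le _) (h.hg0 _)
    by_contra hcon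
    push Not at hcon
    have := Real.one_lt_rpow hcon (show 0 < 2 / s by positivity)
    linarith
  have b2 : dist x (Y (cC Ω x J) (cR Ω x J)) ^ s * g x ≤ D + 1 := by
    have q1 : 9 * cR Ω x J ≤ (1/2)^J * (D + 1) := by
      unfold cR
      have : (0:ℝ) < (1/2)^J := by positivity
      nlinarith
    have q2 : ((1:ℝ)/2)^J = (2:ℝ) ^ (-(J:ℝ)) := by
      rw [Real.rpow_neg (by norm_num), Real.rpow_natCast, one_div, inv_pow]
    have q3 : (((1:ℝ)/2)^J) ^ s * g x ≤ 1 := by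
      rw [q2, ← Real.rpow_mul (by norm_num), neg_mul, Real.rpow_neg (by norm_num)]
      rw [inv_mul_le_iff₀ (by positivity), mul_one]
      calc g x ≤ 1 + g x := by linarith
        _ = Real.exp (Real.log (1 + g x)) := (Real.exp_log (by linarith [h.hg0 x])).symm
        _ ≤ Real.exp (Real.log 2 * (J * s)) := by
            apply Real.exp_le_exp.2
            have l2 := Real.log_two_gt_d9
            have : 2 * Real.log (1 + g x) ≤ J * s := by
              have := mul_le_mul_of_nonneg_right hJ1 hs.le
              have e : 2 / s * Real.log (1 + g x) * s = 2 * Real.log (1 + g x) := by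
                field_simp
              linarith
            nlinarith
        _ = 2 ^ (J * s) := by rw [Real.exp_mul, Real.exp_log (by norm_num)]
    have hD0 : 0 < D := by linarith
    have q4 : (D+1) ^ s ≤ D + 1 := by
      calc (D+1)^s ≤ (D+1) ^ (1:ℝ) := Real.rpow_le_rpow_of_exponent_le (by linarith) h.hs1
        _ = D+1 := by simp
    calc _ ≤ ((1/2)^J * (D + 1)) ^ s * g x := by
          apply mul_le_mul_of_nonneg_right _ (h.hg0 x)
          exact Real.rpow_le_rpow dist_nonneg (a.trans q1) hs.le
      _ = (((1/2)^J) ^ s * g x) * (D+1)^s := by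
          rw [Real.mul_rpow (by positivity) (by positivity)]; ring
      _ ≤ 1 * (D+1)^s := mul_le_mul_of_nonneg_right q3 (by positivity)
      _ ≤ _ := by linarith
  have b3 := mul_le_mul_of_nonneg_right b1 (h.hg0 (Y (cC Ω x J) (cR Ω x J)))
  nlinarith

lemma sum4 {q a b c d : ℝ} (hq : 0 < q) (hq2 : q ≤ 2) :
    |a + b + c + d| ^ q ≤ 16 * (|a|^q + |b|^q + |c|^q + |d|^q) := by
  set m := max (max |a| |b|) (max |c| |d|) with hm
  have ha : |a| ≤ m := by simp [hm]
  have hb : |b| ≤ m := by simp [hm]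
  have hc : |c| ≤ m := by simp [hm]
  have hd : |d| ≤ m := by simp [hm]
  have hm0 : 0 ≤ m := (abs_nonneg a).trans ha
  have h1 : |a + b + c + d| ≤ 4 * m := by
    have := abs_add_le (a + b + c) d
    have := abs_add_le (a + b) c
    have := abs_add_le a b
    linarith
  have h2 : m ^ q ≤ |a|^q + |b|^q + |c|^q + |d|^q := by
    have pa := Real.rpow_nonneg (abs_nonneg a) q
    have pb := Real.rpow_nonneg (abs_nonneg b) q
    have pc := Real.rpow_nonneg (abs_nonneg c) q
    have pd := Real.rpow_nonneg (abs_nonneg d) q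
    rcases max_choice (max |a| |b|) (max |c| |d|) with e | e
    · rcases max_choice |a| |b| with e' | e' <;> rw [hm, e, e'] <;> linarith
    · rcases max_choice |c| |d| with e' | e' <;> rw [hm, e, e'] <;> linarith
  have h4 : (4:ℝ)^q ≤ 16 := by
    calc (4:ℝ)^q ≤ 4 ^ (2:ℝ) := Real.rpow_le_rpow_of_exponent_le (by norm_num) hq2
      _ = 16 := by norm_num
  calc _ ≤ (4 * m)^q := Real.rpow_le_rpow (abs_nonneg _) h1 hq.le
    _ = 4^q * m^q := Real.mul_rpow (by norm_num) hm0
    _ ≤ 16 * m^q := mul_le_mul_of_nonneg_right h4 (Real.rpow_nonneg hm0 _)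
    _ ≤ _ := by linarith

lemma pointwise {Ω : Set (Eu 2)} (hO : IsOpen Ω) (hne : Ωᶜ.Nonempty) {x₀ : Eu 2}
    {A D : ℝ} (hA : 1 ≤ A) (hD : ∀ x ∈ Ω, infDist x Ωᶜ ≤ D) (hD0 : 0 < D)
    (hch : ∀ x ∈ Ω, ∃ N : ℕ, Chain Ω N x x₀ ∧ (N : ℝ) ≤ A * (1 + Lg Ω x))
    {s : ℝ} (hs : 0 < s) (hs1 : s ≤ 1) :
    ∃ C : ℝ, 0 < C ∧ ∀ (u g : Eu 2 → ℝ) (N : Set (Eu 2)), Measurable g → (∀ x, 0 ≤ g x) →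
      volume N = 0 → ∫⁻ x in Ω, ENNReal.ofReal (g x ^ (2/s)) ≤ 1 →
      (∀ x ∈ Ω \ N, ∀ y ∈ Ω \ N, dist x y < infDist x Ωᶜ / 2 →
        |u x - u y| ≤ dist x y ^ s * (g x + g y)) →
      ∃ c0, ∀ x ∈ Ω \ N, |u x - c0| ^ (2/(2-s)) ≤ C * (1 + Lg Ω x + Real.log (1 + g x)) := by
  refine ⟨16 * ((D+10)^2 + 4096 * (2 + 2/s) + 8192 + 4096 * (A + 1)), by positivity, ?_⟩
  intro u g N hg hg0 hN hI H
  have hex : ∀ c r, ∃ y : Eu 2, 0 < r → ball c r ⊆ Ω → y ∈ ball c r ∧ y ∉ N ∧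
      ENNReal.ofReal ((r ^ s * g y) ^ (2/s)) ≤
        ∫⁻ x in ball c r, ENNReal.ofReal (g x ^ (2/s)) := by
    intro c r
    by_cases hh : 0 < r ∧ ball c r ⊆ Ω
    · obtain ⟨y, h1, h2, h3⟩ := good_point hs hg hg0 hN hI c hh.1 hh.2
      exact ⟨y, fun _ _ => ⟨h1, h2, h3⟩⟩
    · exact ⟨c, fun h1 h2 => absurd ⟨h1, h2⟩ hh⟩
  choose Y hY using hex
  have h : GD Ω s u g N Y := ⟨hO, hne, hs, hs1, hg0, hI, H, hY⟩
  refine ⟨u (Y x₀ (infDist x₀ Ωᶜ / 64)), fun x hx => ?_⟩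
  have hd := dpos hO hne hx.1
  obtain ⟨n, hn, hnA⟩ := hch x hx.1
  obtain ⟨J, hJ, hJu⟩ := end_part h (hD x hx.1) hx
  have hq : 0 < 2/(2-s) := by apply div_pos <;> linarith
  have hq2 : 2/(2-s) ≤ 2 := by rw [div_le_iff₀ (by linarith)]; linarith
  have p1 := path_part h hn
  have p2 := down_part h hd J
  have p3 := mid_part h hd
  have p4 : |u x - u (Y (cC Ω x J) (cR Ω x J))| ^ (2/(2-s)) ≤ (D+10)^2 := by
    calc _ ≤ (D+10) ^ (2/(2-s)) := Real.rpow_le_rpow (abs_nonneg _) hJu hq.le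
      _ ≤ (D+10) ^ (2:ℝ) := Real.rpow_le_rpow_of_exponent_le (by linarith) hq2
      _ = _ := by norm_cast
  rw [abs_sub_comm] at p2
  have hl0 : 0 ≤ Real.log (1 + g x) := Real.log_nonneg (by linarith [hg0 x])
  have hL := Lg_nonneg Ω x
  have s4 := sum4 (a := u x - u (Y (cC Ω x J) (cR Ω x J)))
    (b := u (Y (cC Ω x J) (cR Ω x J)) - u (Y (cC Ω x 0) (cR Ω x 0)))
    (c := u (Y (cC Ω x 0) (cR Ω x 0)) - u (Y x (infDist x Ωᶜ / 64)))
    (d := u (Y x (infDist x Ωᶜ / 64)) - u (Y x₀ (infDist x₀ Ωᶜ / 64))) hq hq2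
  rw [sub_add_sub_cancel, sub_add_sub_cancel, sub_add_sub_cancel] at s4
  refine s4.trans ?_
  rw [mul_assoc]
  apply mul_le_mul_of_nonneg_left _ (by norm_num)
  set t := 1 + Lg Ω x + Real.log (1 + g x) with ht
  have t1 : 1 ≤ t := by linarith
  have k1 : (D+10)^2 ≤ (D+10)^2 * t := le_mul_of_one_le_right (by positivity) t1
  have k2 : (J:ℝ) + 1 ≤ (2 + 2/s) * t := by
    have : 0 < 2/s := by positivity
    have : 2 / s * Real.log (1 + g x) ≤ 2/s * t := by
      apply mul_le_mul_of_nonneg_left _ this.le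
      linarith
    linarith
  have k3 : (n:ℝ) + 1 ≤ (A + 1) * t := by
    have : A * (1 + Lg Ω x) ≤ A * t := mul_le_mul_of_nonneg_left (by linarith) (by linarith)
    linarith
  linarith


lemma trud_core {Ω : Set (Eu 2)} (hO : IsOpen Ω) (hne : Ωᶜ.Nonempty) (hΩ : Ω.Nonempty)
    (hbd : Bornology.IsBounded Ω) (hc : IsPreconnected Ω) (hw : IsWeakCarrot Ω)
    {s : ℝ} (hs : 0 < s) (hs1 : s ≤ 1) :
    ∃ ε K : ℝ, 0 < ε ∧ 0 < K ∧ ∀ (u g : Eu 2 → ℝ) (N : Set (Eu 2)), Measurable g → (∀ x, 0 ≤ g x) →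
      volume N = 0 → ∫⁻ x in Ω, ENNReal.ofReal (g x ^ (2/s)) ≤ 1 →
      (∀ x ∈ Ω \ N, ∀ y ∈ Ω \ N, dist x y < infDist x Ωᶜ / 2 →
        |u x - u y| ≤ dist x y ^ s * (g x + g y)) →
      ∃ c0, ∫⁻ x in Ω, ENNReal.ofReal (Real.exp (ε * |u x - c0| ^ (2/(2-s)))) ≤
        ENNReal.ofReal K := by
  obtain ⟨x₀, hx₀, A, hA, hch⟩ := carrot_chain hO hne hc hw
  obtain ⟨D, hD0, hD⟩ := exists_D hne hbd
  obtain ⟨τ, hτ, hfin⟩ := exp_int hO hne hbd hx₀ hA hD hch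
  obtain ⟨C, hC, hpt⟩ := pointwise hO hne hA hD hD0 hch hs hs1
  have hvfin : volume Ω ≠ ⊤ := hbd.measure_lt_top.ne
  set I := ∫⁻ x in Ω, ENNReal.ofReal (Real.exp (τ * Lg Ω x)) with hI
  set T := ENNReal.ofReal (Real.exp (1/2)) * (I + (2 * volume Ω + 1)) with hT
  have hTfin : T ≠ ⊤ := by
    refine ENNReal.mul_ne_top ENNReal.ofReal_ne_top ?_
    exact ENNReal.add_ne_top.2 ⟨hfin.ne, ENNReal.add_ne_top.2
      ⟨ENNReal.mul_ne_top (by norm_num) hvfin, ENNReal.one_ne_top⟩⟩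
  set ε := min (τ/2) (1/2) / C with hε
  have hε0 : 0 < ε := by positivity
  have hεC : ε * C = min (τ/2) (1/2) := by rw [hε]; field_simp
  refine ⟨ε, T.toReal + 1, hε0, by positivity, ?_⟩
  intro u g N hg hg0 hN hI1 H
  obtain ⟨c0, hc0⟩ := hpt u g N hg hg0 hN hI1 H
  refine ⟨c0, ?_⟩
  have hTT : T ≤ ENNReal.ofReal (T.toReal + 1) := by
    rw [ENNReal.le_ofReal_iff_toReal_le hTfin (by positivity)]
    linarith
  refine le_trans ?_ hTT
  have hNae : ∀ᵐ x, x ∉ N := measure_eq_zero_iff_ae_notMem.1 hN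
  have m1 : Measurable (fun x => ENNReal.ofReal (Real.exp (τ * Lg Ω x))) :=
    (Real.measurable_exp.comp (measurable_const.mul (Lg_meas Ω))).ennreal_ofReal
  calc _ ≤ ∫⁻ x in Ω, ENNReal.ofReal (Real.exp (1/2)) *
        (ENNReal.ofReal (Real.exp (τ * Lg Ω x)) + (2 + ENNReal.ofReal (g x ^ (2/s)))) := by
        apply lintegral_mono_ae
        filter_upwards [ae_restrict_of_ae hNae, ae_restrict_mem hO.measurableSet] with x hxN hxO
        have hb := hc0 x ⟨hxO, hxN⟩
        have hL := Lg_nonneg Ω x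
        have hgx := hg0 x
        have hgp := Real.rpow_nonneg hgx (2/s)
        rw [show (2:ℝ≥0∞) = ENNReal.ofReal 2 by norm_num, ← ENNReal.ofReal_add (by norm_num) hgp,
          ← ENNReal.ofReal_add (by positivity) (by positivity), ← ENNReal.ofReal_mul (by positivity)]
        apply ENNReal.ofReal_le_ofReal
        have hl0 : 0 ≤ Real.log (1 + g x) := Real.log_nonneg (by linarith)
        have e1 : ε * |u x - c0| ^ (2/(2-s)) ≤
            1/2 + (τ * Lg Ω x / 2 + Real.log (1 + g x) / 2) := by
          have a1 : ε * |u x - c0| ^ (2/(2-s)) ≤ ε * C * (1 + Lg Ω x + Real.log (1 + g x)) := by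
            rw [mul_assoc]; exact mul_le_mul_of_nonneg_left hb hε0.le
          rw [hεC] at a1
          have a2 : min (τ/2) (1/2) ≤ τ/2 := min_le_left _ _
          have a3 : min (τ/2) (1/2) ≤ 1/2 := min_le_right _ _
          have a4 := mul_le_mul_of_nonneg_right a2 hL
          have a5 := mul_le_mul_of_nonneg_right a3 hl0
          linarith
        refine (Real.exp_le_exp.2 e1).trans ?_
        rw [Real.exp_add]
        apply mul_le_mul_of_nonneg_left _ (Real.exp_pos _).le
        rw [Real.exp_add]
        set α := Real.exp (τ * Lg Ω x / 2) with hα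
        set β := Real.exp (Real.log (1 + g x) / 2) with hβ
        have hα2 : Real.exp (τ * Lg Ω x) = α ^ 2 := by
          rw [hα, ← Real.exp_nat_mul]; congr 1; push_cast; ring
        have hβ2 : 1 + g x = β ^ 2 := by
          rw [hβ, ← Real.exp_nat_mul]
          rw [show ((2:ℕ):ℝ) * (Real.log (1 + g x) / 2) = Real.log (1 + g x) by push_cast; ring,
            Real.exp_log (by linarith)]
        have hgp1 : g x ≤ 1 + g x ^ (2/s) := by
          by_cases h1 : g x ≤ 1
          · linarith
          · push Not at h1
            have : g x ^ (1:ℝ) ≤ g x ^ (2/s) := Real.rpow_le_rpow_of_exponent_le h1.le (by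
              rw [le_div_iff₀ hs]; linarith)
            rw [Real.rpow_one] at this
            linarith
        nlinarith [sq_nonneg (α - β), sq_nonneg (α + β), sq_nonneg α]
    _ = ENNReal.ofReal (Real.exp (1/2)) * (I + (2 * volume Ω +
          ∫⁻ x in Ω, ENNReal.ofReal (g x ^ (2/s)))) := by
        rw [lintegral_const_mul' _ _ ENNReal.ofReal_ne_top, lintegral_add_left m1,
          lintegral_add_left measurable_const, setLIntegral_const]
    _ ≤ T := by rw [hT]; gcongr

lemma trud_main {Ω : Set (Eu 2)} (hO : IsOpen Ω) (hne : Ωᶜ.Nonempty) (hΩ : Ω.Nonempty)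
    (hbd : Bornology.IsBounded Ω) (hc : IsPreconnected Ω) (hw : IsWeakCarrot Ω)
    {s : ℝ} (hs : 0 < s) (hs1 : s ≤ 1) :
    ∃ C : ℝ, 0 < C ∧ ∀ (u g : Eu 2 → ℝ) (N : Set (Eu 2)), Measurable u → Measurable g →
      (∀ x, 0 ≤ g x) →
      volume N = 0 → ∫⁻ x in Ω, ENNReal.ofReal (g x ^ (2/s)) ≤ 1 →
      (∀ x ∈ Ω \ N, ∀ y ∈ Ω \ N, dist x y < infDist x Ωᶜ / 2 →
        |u x - u y| ≤ dist x y ^ s * (g x + g y)) →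
      ∫⁻ x in Ω, ENNReal.ofReal
        (Real.exp ((|u x - ⨍ y in Ω, u y| / C) ^ (2/(2-s))) - 1) ≤ 1 := by
  obtain ⟨ε, K, hε, hK, hcore⟩ := trud_core hO hne hΩ hbd hc hw hs hs1
  have hvfin : volume Ω ≠ ⊤ := hbd.measure_lt_top.ne
  have hv0 : volume Ω ≠ 0 := (hO.measure_pos volume hΩ).ne'
  set w := (volume Ω).toReal with hw'
  have hw0 : 0 < w := ENNReal.toReal_pos hv0 hvfin
  have hq : 0 < 2/(2-s) := by apply div_pos <;> linarith
  have hq1 : 1 ≤ 2/(2-s) := by rw [le_div_iff₀ (by linarith)]; linarith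
  have hq2 : 2/(2-s) ≤ 2 := by rw [div_le_iff₀ (by linarith)]; linarith
  set q := 2/(2-s) with hqdef
  set C4 := 1 + (1/ε) * K / w with hC4
  have hC40 : 0 < C4 := by positivity
  set K' := Real.exp (ε * 4 * C4 ^ q) * K with hK'
  obtain ⟨M, hM⟩ := exists_nat_gt (max K' 1)
  have hMK : K' ≤ M := (le_max_left _ _).trans hM.le
  have hM1 : (1:ℝ) ≤ M := (le_max_right _ _).trans hM.le
  set C := ((16/ε) * M) ^ (1/q) with hC
  have hC0 : 0 < C := by positivity
  have hCq : C ^ q = (16/ε) * M := by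
    rw [hC, ← Real.rpow_mul (by positivity), one_div_mul_cancel hq.ne', Real.rpow_one]
  refine ⟨C, hC0, ?_⟩
  intro u g N hu hg hg0 hN hI1 H
  obtain ⟨c0, hc0⟩ := hcore u g N hg hg0 hN hI1 H
  have : IsFiniteMeasure (volume.restrict Ω) := ⟨by simpa using hvfin.lt_top⟩
  -- integrability
  have hpt : ∀ t : ℝ, |t| ≤ 1 + (1/ε) * Real.exp (ε * |t|^q) := by
    intro t
    have h1 : ε * |t|^q ≤ Real.exp (ε * |t|^q) := by
      have := Real.add_one_le_exp (ε * |t|^q); linarith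
    have h2 : |t|^q ≤ (1/ε) * Real.exp (ε * |t|^q) := by
      rw [one_div, ← div_eq_inv_mul, le_div_iff₀ hε]; linarith
    by_cases h : |t| ≤ 1
    · have := Real.rpow_nonneg (abs_nonneg t) q
      linarith
    · push Not at h
      have : |t| ^ (1:ℝ) ≤ |t|^q := Real.rpow_le_rpow_of_exponent_le h.le hq1
      rw [Real.rpow_one] at this
      linarith
  have hmE : Measurable (fun x => Real.exp (ε * |u x - c0| ^ q)) :=
    Real.measurable_exp.comp (measurable_const.mul
      (((measurable_norm.comp (hu.sub_const c0))).pow_const q))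
  have hiE : Integrable (fun x => Real.exp (ε * |u x - c0| ^ q)) (volume.restrict Ω) := by
    refine ⟨hmE.aestronglyMeasurable, ?_⟩
    rw [hasFiniteIntegral_iff_ofReal (Filter.Eventually.of_forall fun x => (Real.exp_pos _).le)]
    exact hc0.trans_lt ENNReal.ofReal_lt_top
  have hiEle : ∫ x in Ω, Real.exp (ε * |u x - c0| ^ q) ≤ K := by
    rw [integral_eq_lintegral_of_nonneg_ae (Filter.Eventually.of_forall fun x => (Real.exp_pos _).le)
      hmE.aestronglyMeasurable]
    exact ENNReal.toReal_le_of_le_ofReal hK.le hc0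
  have hidom : Integrable (fun x => 1 + (1/ε) * Real.exp (ε * |u x - c0| ^ q))
      (volume.restrict Ω) := (integrable_const _).add (hiE.const_mul _)
  have hiu0 : Integrable (fun x => u x - c0) (volume.restrict Ω) :=
    hidom.mono' (hu.sub_const c0).aestronglyMeasurable
      (Filter.Eventually.of_forall fun x => hpt (u x - c0))
  have hiu : Integrable u (volume.restrict Ω) := by
    have := hiu0.add (integrable_const c0)
    refine this.congr (Filter.Eventually.of_forall fun x => ?_)
    simp only [Pi.add_apply, sub_add_cancel]
  have hmean : |(⨍ y in Ω, u y) - c0| ≤ C4 := by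
    have e1 : (⨍ y in Ω, u y) - c0 = w⁻¹ * ∫ y in Ω, (u y - c0) := by
      rw [setAverage_eq, integral_sub hiu (integrable_const _), setIntegral_const, smul_eq_mul,
        smul_eq_mul, Measure.real, mul_sub, ← mul_assoc, inv_mul_cancel₀ hw0.ne', one_mul]
    rw [e1, abs_mul, abs_of_pos (inv_pos.2 hw0), inv_mul_le_iff₀ hw0]
    calc |∫ y in Ω, (u y - c0)| ≤ ∫ y in Ω, |u y - c0| := abs_integral_le_integral_abs
      _ ≤ ∫ y in Ω, (1 + (1/ε) * Real.exp (ε * |u y - c0| ^ q)) :=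
          integral_mono hiu0.abs hidom (fun y => hpt _)
      _ = w + (1/ε) * ∫ y in Ω, Real.exp (ε * |u y - c0| ^ q) := by
          rw [integral_add (integrable_const _) (hiE.const_mul _), integral_const_mul,
            setIntegral_const]
          simp [Measure.real, hw']
      _ ≤ w + (1/ε) * K := by gcongr
      _ = w * C4 := by rw [hC4]; field_simp
  set m := ⨍ y in Ω, u y with hm
  calc _ ≤ ∫⁻ x in Ω, ENNReal.ofReal ((1/M) * Real.exp (ε * 4 * C4 ^ q)) *
        ENNReal.ofReal (Real.exp (ε * |u x - c0| ^ q)) := by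
        apply lintegral_mono
        intro x
        simp only
        rw [← ENNReal.ofReal_mul (by positivity)]
        apply ENNReal.ofReal_le_ofReal
        have h1 : |u x - m| ^ q ≤ 16 * (|u x - c0|^q + C4^q) := by
          have := sum4 (a := u x - c0) (b := -(m - c0)) (c := 0) (d := 0) hq hq2
          rw [abs_zero, Real.zero_rpow hq.ne', abs_neg] at this
          have e : u x - c0 + -(m - c0) + 0 + 0 = u x - m := by ring
          rw [e] at this
          have := Real.rpow_le_rpow (abs_nonneg _) hmean hq.le
          linarith
        set t := ε * (|u x - c0|^q + C4^q) with ht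
        have h2 : (|u x - m| / C) ^ q ≤ t / M := by
          rw [Real.div_rpow (abs_nonneg _) hC0.le, hCq, div_le_div_iff₀ (by positivity) (by positivity)]
          have : t * (16 / ε * M) = 16 * (|u x - c0|^q + C4^q) * M := by rw [ht]; field_simp
          rw [this]
          exact mul_le_mul_of_nonneg_right h1 (by positivity)
        have h3 : Real.exp (t / M) - 1 ≤ (1/M) * Real.exp t := by
          have hb := one_add_mul_le_pow (a := Real.exp (t/M) - 1)
            (by linarith [Real.exp_pos (t/M)]) M
          rw [add_sub_cancel, ← Real.exp_nat_mul, mul_div_cancel₀ _ (by positivity)] at hb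
          rw [one_div, ← div_eq_inv_mul, le_div_iff₀ (by positivity)]
          linarith
        have h4 := Real.exp_le_exp.2 h2
        have h5 : Real.exp t ≤ Real.exp (ε * 4 * C4 ^ q) * Real.exp (ε * |u x - c0| ^ q) := by
          rw [← Real.exp_add]
          apply Real.exp_le_exp.2
          rw [ht]
          have : 0 ≤ ε * C4^q := by positivity
          linarith
        have h6 := mul_le_mul_of_nonneg_left h5 (show (0:ℝ) ≤ 1/M by positivity)
        linarith
    _ = ENNReal.ofReal ((1/M) * Real.exp (ε * 4 * C4 ^ q)) *
        ∫⁻ x in Ω, ENNReal.ofReal (Real.exp (ε * |u x - c0| ^ q)) :=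
        lintegral_const_mul' _ _ ENNReal.ofReal_ne_top
    _ ≤ ENNReal.ofReal ((1/M) * Real.exp (ε * 4 * C4 ^ q)) * ENNReal.ofReal K := by gcongr
    _ ≤ 1 := by
        rw [← ENNReal.ofReal_mul (by positivity), ENNReal.ofReal_le_one]
        rw [mul_assoc, ← hK', one_div, ← div_eq_inv_mul, div_le_one (by positivity)]
        exact hMK

lemma infEdist_ofReal {Ω : Set (Eu 2)} (hne : Ωᶜ.Nonempty) (x : Eu 2) :
    Metric.infEDist x Ωᶜ = ENNReal.ofReal (infDist x Ωᶜ) := by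
  rw [infDist, ENNReal.ofReal_toReal (Metric.infEDist_ne_top hne)]

lemma edist_cond {Ω : Set (Eu 2)} (hne : Ωᶜ.Nonempty) (x y : Eu 2) :
    edist x y < ENNReal.ofReal (1/2) * Metric.infEDist x Ωᶜ ↔ dist x y < infDist x Ωᶜ / 2 := by
  rw [infEdist_ofReal hne, edist_dist, ← ENNReal.ofReal_mul (by norm_num),
    ENNReal.ofReal_lt_ofReal_iff_of_nonneg dist_nonneg, one_div, ← div_eq_inv_mul]

theorem carrot_HT {Ω : Set (Eu 2)} (hO : IsOpen Ω) (hne : Ωᶜ.Nonempty) (hΩ : Ω.Nonempty)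
    (hbd : Bornology.IsBounded Ω) (hc : IsPreconnected Ω) (hw : IsWeakCarrot Ω)
    {s : ℝ} (hs : 0 < s) (hs1 : s ≤ 1) : SupportsHT Ω s := by
  obtain ⟨C, hC, hmain⟩ := trud_main hO hne hΩ hbd hc hw hs hs1
  refine ⟨C, hC, fun u hu => ?_⟩
  obtain ⟨hum, hufin⟩ := hu
  set B := ballNorm Ω s ((2:ℕ)/s) u with hB
  have hp : 0 < 2/s := by positivity
  have key : ∀ a : ℝ, 0 < a → B < ENNReal.ofReal a →
      phiLux Ω s (fun x => u x - ⨍ y in Ω, u y) ≤ ENNReal.ofReal C * ENNReal.ofReal a := by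
    intro a ha hBa
    rw [hB, ballNorm, ballNormRho] at hBa
    simp only [iInf_lt_iff] at hBa
    obtain ⟨g, ⟨hgm, hg0, N, hNΩ, hN, hH⟩, hglt⟩ := hBa
    have hI : ∫⁻ x in Ω, ENNReal.ofReal ((a⁻¹ * g x) ^ (2/s)) ≤ 1 := by
      rw [eLpNorm_eq_lintegral_rpow_enorm_toReal (by simpa using hs) ENNReal.ofReal_ne_top,
        ENNReal.toReal_ofReal (by positivity)] at hglt
      have h1 := ENNReal.rpow_le_rpow hglt.le hp.le
      push_cast at h1
      rw [← ENNReal.rpow_mul, one_div_mul_cancel hp.ne', ENNReal.rpow_one,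
        ENNReal.ofReal_rpow_of_nonneg ha.le hp.le] at h1
      have h2 : ∀ x, ENNReal.ofReal ((a⁻¹ * g x) ^ (2/s)) =
          ENNReal.ofReal (a⁻¹ ^ (2/s)) * ‖g x‖ₑ ^ (2/s) := by
        intro x
        rw [Real.mul_rpow (by positivity) (hg0 x), ENNReal.ofReal_mul (by positivity),
          Real.enorm_of_nonneg (hg0 x), ENNReal.ofReal_rpow_of_nonneg (hg0 x) hp.le]
      simp only [h2]
      rw [lintegral_const_mul' _ _ ENNReal.ofReal_ne_top]
      calc _ ≤ ENNReal.ofReal (a⁻¹ ^ (2/s)) * ENNReal.ofReal (a ^ (2/s)) := by gcongr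
        _ = 1 := by
          rw [← ENNReal.ofReal_mul (by positivity), ← Real.mul_rpow (by positivity) ha.le,
            inv_mul_cancel₀ ha.ne', Real.one_rpow, ENNReal.ofReal_one]
    have hm := hmain (fun x => a⁻¹ * u x) (fun x => a⁻¹ * g x) N (hum.const_mul _) (hgm.const_mul _)
      (fun x => mul_nonneg (by positivity) (hg0 x)) hN hI (by
        intro x hx y hy hxy
        have := hH x hx y hy ((edist_cond hne x y).2 hxy)
        rw [← mul_sub, abs_mul, abs_of_pos (inv_pos.2 ha), ← mul_add, mul_left_comm]
        exact mul_le_mul_of_nonneg_left this (by positivity))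
    rw [← ENNReal.ofReal_mul hC.le]
    apply sInf_le
    refine ⟨C * a, ⟨by positivity, ?_⟩, rfl⟩
    refine le_trans (le_of_eq ?_) hm
    congr 1
    ext x
    congr 3
    have e : (⨍ y in Ω, a⁻¹ * u y) = a⁻¹ * ⨍ y in Ω, u y := by
      rw [setAverage_eq, setAverage_eq, integral_const_mul, smul_eq_mul, smul_eq_mul]; ring
    rw [e, ← mul_sub, abs_mul, abs_of_pos (inv_pos.2 ha)]
    push_cast
    congr 1
    field_simp
  -- pass to the limit
  have hBfin : B ≠ ⊤ := hufin.ne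
  rw [mul_comm, ← ENNReal.div_le_iff (by simpa using hC) ENNReal.ofReal_ne_top]
  apply le_of_forall_gt_imp_ge_of_dense
  intro b hb
  by_cases hbt : b = ⊤
  · simp [hbt]
  · have hb0 : 0 < b := pos_of_gt hb
    rw [ENNReal.div_le_iff (by simpa using hC) ENNReal.ofReal_ne_top, mul_comm]
    have := key b.toReal (ENNReal.toReal_pos hb0.ne' hbt) (by rwa [ENNReal.ofReal_toReal hbt])
    rwa [ENNReal.ofReal_toReal hbt] at this


lemma sqrt_branch {U : Set ℂ} (hU : IsOpen U) (hsc : IsSimplyConnected U) {G : ℂ → ℂ}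
    (hG : DifferentiableOn ℂ G U) (h0 : ∀ z ∈ U, G z ≠ 0) :
    ∃ r : ℂ → ℂ, DifferentiableOn ℂ r U ∧ ∀ z ∈ U, r z ^ 2 = G z := by
  obtain ⟨f, hf, hfe⟩ := Complex.exists_continuousOn_pow_eq hsc hU hG.continuousOn
    (by rintro ⟨z, hz, h⟩; exact h0 z hz h) (n := 2) two_ne_zero
  refine ⟨f, ?_, fun z hz => hfe z⟩
  intro z hz
  have hn := hU.mem_nhds hz
  have hfz : f z ≠ 0 := by
    intro h
    apply h0 z hz
    rw [← hfe z, h]; norm_num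
  have h1 : HasDerivAt (fun w : ℂ => w ^ 2) (2 * f z) (f z) := by
    simpa using hasDerivAt_pow 2 (f z)
  have h2 := (hG.differentiableAt hn).hasDerivAt
  have := HasDerivAt.of_comp_left (hf.continuousAt hn) h1 h2 (by simpa using hfz)
    (Filter.Eventually.of_forall fun w => by simp [hfe w])
  exact this.differentiableAt.differentiableWithinAt

/-- Moebius map of the disk. -/
def mob (a w : ℂ) : ℂ := (w - a) / (1 - (starRingEnd ℂ) a * w)

lemma mob_den {a w : ℂ} (ha : ‖a‖ < 1) (hw : ‖w‖ < 1) : 1 - (starRingEnd ℂ) a * w ≠ 0 := by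
  intro h
  have : (starRingEnd ℂ) a * w = 1 := (sub_eq_zero.1 h).symm
  have h2 : ‖(starRingEnd ℂ) a * w‖ = 1 := by rw [this]; simp
  rw [norm_mul, RCLike.norm_conj] at h2
  nlinarith [norm_nonneg a, norm_nonneg w]

lemma mob_norm {a w : ℂ} (ha : ‖a‖ < 1) (hw : ‖w‖ < 1) : ‖mob a w‖ < 1 := by
  have hd := mob_den ha hw
  unfold mob
  rw [norm_div, div_lt_one (norm_pos_iff.2 hd)]
  apply lt_of_pow_lt_pow_left₀ 2 (norm_nonneg _)
  rw [← Complex.normSq_eq_norm_sq, ← Complex.normSq_eq_norm_sq]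
  have ha' : Complex.normSq a < 1 := by
    rw [Complex.normSq_eq_norm_sq]; nlinarith [norm_nonneg a]
  have hw' : Complex.normSq w < 1 := by
    rw [Complex.normSq_eq_norm_sq]; nlinarith [norm_nonneg w]
  have key : Complex.normSq (1 - (starRingEnd ℂ) a * w) - Complex.normSq (w - a)
      = (1 - Complex.normSq a) * (1 - Complex.normSq w) := by
    simp only [Complex.normSq_apply, Complex.sub_re, Complex.sub_im, Complex.one_re,
      Complex.one_im, Complex.mul_re, Complex.mul_im, Complex.conj_re, Complex.conj_im]
    ring
  nlinarith

lemma conj_mul_self_norm (a : ℂ) : (starRingEnd ℂ) a * a = ((‖a‖ ^ 2 : ℝ) : ℂ) := by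
  rw [← Complex.normSq_eq_norm_sq, Complex.normSq_eq_conj_mul_self]

lemma mob_inj {a w w' : ℂ} (ha : ‖a‖ < 1) (hw : ‖w‖ < 1) (hw' : ‖w'‖ < 1)
    (h : mob a w = mob a w') : w = w' := by
  unfold mob at h
  rw [div_eq_div_iff (mob_den ha hw) (mob_den ha hw')] at h
  have h2 : (w - w') * (1 - (starRingEnd ℂ) a * a) = 0 := by linear_combination h
  rcases mul_eq_zero.1 h2 with h3 | h3
  · exact sub_eq_zero.1 h3
  · exact absurd h3 (mob_den ha ha)

lemma mob_zero {a w : ℂ} (ha : ‖a‖ < 1) (hw : ‖w‖ < 1) : mob a w = 0 ↔ w = a := by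
  unfold mob
  rw [div_eq_zero_iff]
  simp [mob_den ha hw, sub_eq_zero]

lemma mob_deriv {a w : ℂ} (ha : ‖a‖ < 1) (hw : ‖w‖ < 1) :
    HasDerivAt (mob a) ((1 - (‖a‖ ^ 2 : ℝ)) / (1 - (starRingEnd ℂ) a * w) ^ 2) w := by
  have h1 : HasDerivAt (fun w : ℂ => w - a) 1 w := (hasDerivAt_id w).sub_const a
  have h2 : HasDerivAt (fun w : ℂ => 1 - (starRingEnd ℂ) a * w) (-(starRingEnd ℂ) a) w := by
    simpa using ((hasDerivAt_id w).const_mul ((starRingEnd ℂ) a)).const_sub 1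
  have h3 := h1.fun_div h2 (mob_den ha hw)
  have e : (1 * (1 - (starRingEnd ℂ) a * w) - (w - a) * -(starRingEnd ℂ) a) =
      (1 - (‖a‖ ^ 2 : ℝ)) := by
    rw [← conj_mul_self_norm]
    ring
  rw [e] at h3
  exact h3

/-- the class of normalized injective maps into the disk -/
structure Fam (U : Set ℂ) (z0 : ℂ) (f : ℂ → ℂ) : Prop where
  diff : DifferentiableOn ℂ f U
  inj : InjOn f U
  der : ∀ z ∈ U, deriv f z ≠ 0
  maps : ∀ z ∈ U, ‖f z‖ < 1
  zero : f z0 = 0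

lemma Fam.hasDeriv {U : Set ℂ} {z0 : ℂ} {f : ℂ → ℂ} (h : Fam U z0 f) (hU : IsOpen U) {z : ℂ}
    (hz : z ∈ U) : HasDerivAt f (deriv f z) z :=
  (h.diff.differentiableAt (hU.mem_nhds hz)).hasDerivAt

/-- Koebe square root trick. -/
lemma Fam.improve {U : Set ℂ} {z0 : ℂ} {f : ℂ → ℂ} (h : Fam U z0 f) (hU : IsOpen U)
    (hsc : IsSimplyConnected U) (hz0 : z0 ∈ U) {a : ℂ} (ha : ‖a‖ < 1)
    (hna : ∀ z ∈ U, f z ≠ a) :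
    ∃ g, Fam U z0 g ∧ ‖deriv g z0‖ = (1 + ‖a‖) / (2 * Real.sqrt ‖a‖) * ‖deriv f z0‖ := by
  have ha0 : a ≠ 0 := by
    intro h0; exact hna z0 hz0 (by rw [h.zero, h0])
  have hap : 0 < ‖a‖ := norm_pos_iff.2 ha0
  set G : ℂ → ℂ := fun z => mob a (f z) with hG
  have hGd : ∀ z ∈ U, HasDerivAt G ((1 - (‖a‖ ^ 2 : ℝ)) / (1 - (starRingEnd ℂ) a * f z) ^ 2 *
      deriv f z) z := fun z hz => (mob_deriv ha (h.maps z hz)).comp z (h.hasDeriv hU hz)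
  have hG0 : ∀ z ∈ U, G z ≠ 0 := fun z hz h0 =>
    hna z hz ((mob_zero ha (h.maps z hz)).1 h0)
  have hG1 : ∀ z ∈ U, ‖G z‖ < 1 := fun z hz => mob_norm ha (h.maps z hz)
  obtain ⟨r, hr, hre⟩ := sqrt_branch hU hsc
    (fun z hz => (hGd z hz).differentiableAt.differentiableWithinAt) hG0
  have hr1 : ∀ z ∈ U, ‖r z‖ < 1 := by
    intro z hz
    have := hG1 z hz
    rw [← hre z hz, norm_pow] at this
    by_contra hc
    push Not at hc
    nlinarith
  have hr0 : ∀ z ∈ U, r z ≠ 0 := by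
    intro z hz h0
    apply hG0 z hz
    rw [← hre z hz, h0]; norm_num
  have hrd : ∀ z ∈ U, HasDerivAt r (deriv r z) z := fun z hz =>
    (hr.differentiableAt (hU.mem_nhds hz)).hasDerivAt
  have hrr : ∀ z ∈ U, 2 * r z * deriv r z = (1 - (‖a‖ ^ 2 : ℝ)) /
      (1 - (starRingEnd ℂ) a * f z) ^ 2 * deriv f z := by
    intro z hz
    have h1 : HasDerivAt (fun w => r w ^ 2) (2 * r z * deriv r z) z := by
      have := (hrd z hz).fun_pow 2
      simpa using this
    have h2 : (fun w => r w ^ 2) =ᶠ[nhds z] G := by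
      filter_upwards [hU.mem_nhds hz] with w hw using hre w hw
    exact h1.unique ((hGd z hz).congr_of_eventuallyEq h2)
  have ha1 : (1 - (‖a‖ ^ 2 : ℝ) : ℂ) ≠ 0 := by
    norm_cast
    nlinarith
  set b := r z0 with hb
  have hb1 : ‖b‖ < 1 := hr1 z0 hz0
  have hb0 : b ≠ 0 := hr0 z0 hz0
  have hgd : ∀ z ∈ U, HasDerivAt (fun z => mob b (r z))
      ((1 - (‖b‖ ^ 2 : ℝ)) / (1 - (starRingEnd ℂ) b * r z) ^ 2 * deriv r z) z :=
    fun z hz => (mob_deriv hb1 (hr1 z hz)).comp z (hrd z hz)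
  have hb2 : (1 - (‖b‖ ^ 2 : ℝ) : ℂ) ≠ 0 := by
    norm_cast
    nlinarith [norm_nonneg b]
  refine ⟨fun z => mob b (r z), ⟨?_, ?_, ?_, ?_, ?_⟩, ?_⟩
  · exact fun z hz => (hgd z hz).differentiableAt.differentiableWithinAt
  · intro z hz w hw hzw
    have h1 := mob_inj hb1 (hr1 z hz) (hr1 w hw) hzw
    have h2 : G z = G w := by rw [← hre z hz, ← hre w hw, h1]
    exact h.inj hz hw (mob_inj ha (h.maps z hz) (h.maps w hw) h2)
  · intro z hz
    rw [(hgd z hz).deriv]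
    have h3 : deriv r z ≠ 0 := by
      intro h0
      have := hrr z hz
      rw [h0, mul_zero] at this
      exact (mul_ne_zero (div_ne_zero ha1 (pow_ne_zero 2 (mob_den ha (h.maps z hz))))
        (h.der z hz)) this.symm
    exact mul_ne_zero (div_ne_zero hb2 (pow_ne_zero 2 (mob_den hb1 (hr1 z hz)))) h3
  · exact fun z hz => mob_norm hb1 (hr1 z hz)
  · exact (mob_zero hb1 hb1).2 rfl
  · rw [(hgd z0 hz0).deriv]
    have e1 := hrr z0 hz0
    rw [h.zero, mul_zero, sub_zero, one_pow, div_one, ← hb] at e1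
    have e2 : ‖b‖ ^ 2 = ‖a‖ := by
      rw [← norm_pow, hre z0 hz0]
      simp [hG, h.zero, mob]
    have e3 : Real.sqrt ‖a‖ = ‖b‖ := by
      rw [← e2, Real.sqrt_sq (norm_nonneg b)]
    have e4 : 2 * ‖b‖ * ‖deriv r z0‖ = (1 - ‖a‖ ^ 2) * ‖deriv f z0‖ := by
      have := congrArg norm e1
      rw [norm_mul, norm_mul, norm_mul] at this
      have e5 : ‖(1 - (‖a‖ ^ 2 : ℝ) : ℂ)‖ = 1 - ‖a‖ ^ 2 := by
        rw [← Complex.ofReal_one, ← Complex.ofReal_sub, Complex.norm_real, Real.norm_eq_abs,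
          abs_of_pos (by nlinarith)]
      rw [e5] at this
      simpa using this
    rw [← hb, conj_mul_self_norm, norm_mul, norm_div, norm_pow, e3, e2]
    have e5 : ‖(1 - (‖a‖ : ℝ) : ℂ)‖ = 1 - ‖a‖ := by
      rw [← Complex.ofReal_one, ← Complex.ofReal_sub, Complex.norm_real, Real.norm_eq_abs,
        abs_of_pos (by nlinarith)]
    rw [e5]
    have hbp : 0 < ‖b‖ := norm_pos_iff.2 hb0
    have h1a : 1 - ‖a‖ ≠ 0 := by linarith
    field_simp
    linear_combination e4


lemma near_ext {U : Set ℂ} {z0 : ℂ} (hU : IsOpen U) (hsc : IsSimplyConnected U) (hz0 : z0 ∈ U)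
    (hbd : Bornology.IsBounded U) {δ : ℝ} (hδ : 0 < δ) (hδ1 : δ < 1) :
    ∃ f, Fam U z0 f ∧ ∀ a : ℂ, ‖a‖ ≤ 1 - δ → ∃ z ∈ U, f z = a := by
  obtain ⟨R, hR, hUR⟩ := hbd.subset_ball_lt 0 z0
  obtain ⟨r, hr, hrU⟩ := Metric.isOpen_iff.1 hU z0 hz0
  set A : Set ℝ := {t | ∃ f, Fam U z0 f ∧ t = ‖deriv f z0‖} with hA
  have hAb : BddAbove A := by
    refine ⟨1 / r, ?_⟩
    rintro t ⟨f, hf, rfl⟩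
    apply Complex.norm_deriv_le_div_of_mapsTo_ball (hf.diff.mono hrU) _ hr
    intro z hz
    rw [hf.zero]
    simpa using (hf.maps z (hrU hz)).le
  have hRc : (R : ℂ) ≠ 0 := by exact_mod_cast hR.ne'
  have hder : ∀ z, HasDerivAt (fun z : ℂ => (z - z0) / R) (1 / R) z := fun z =>
    ((hasDerivAt_id z).sub_const z0).div_const (R : ℂ)
  have hA1 : (1 / R) ∈ A := by
    refine ⟨fun z => (z - z0) / R, ⟨?_, ?_, ?_, ?_, ?_⟩, ?_⟩
    · exact fun z _ => (hder z).differentiableAt.differentiableWithinAt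
    · intro z _ w _ h
      have : (z - z0) / R = (w - z0) / R := h
      field_simp at this
      simpa using this
    · intro z _
      rw [(hder z).deriv]
      simpa using hRc
    · intro z hz
      have := hUR hz
      rw [mem_ball, dist_eq_norm] at this
      rw [norm_div, Complex.norm_real, Real.norm_eq_abs, abs_of_pos hR, div_lt_one hR]
      exact this
    · simp
    · rw [(hder z0).deriv]
      simp [abs_of_pos hR]
  have hS : 1 / R ≤ sSup A := le_csSup hAb hA1
  have hSp : 0 < sSup A := lt_of_lt_of_le (by positivity) hS
  have hlt : sSup A / (1 + δ ^ 2 / 8) < sSup A := by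
    apply div_lt_self hSp
    have : 0 < δ ^ 2 := by positivity
    linarith
  obtain ⟨_, ⟨f, hf, rfl⟩, hft⟩ := exists_lt_of_lt_csSup ⟨_, hA1⟩ hlt
  refine ⟨f, hf, ?_⟩
  intro a ha
  by_contra hc
  push Not at hc
  obtain ⟨g, hg, hge⟩ := hf.improve hU hsc hz0 (a := a) (by linarith) hc
  have hgA : ‖deriv g z0‖ ≤ sSup A := le_csSup hAb ⟨g, hg, rfl⟩
  have ha0 : 0 < ‖a‖ := by
    apply norm_pos_iff.2
    intro h0; exact hc z0 hz0 (by rw [hf.zero, h0])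
  have hk : 1 + δ ^ 2 / 8 ≤ (1 + ‖a‖) / (2 * Real.sqrt ‖a‖) := by
    set t := Real.sqrt ‖a‖ with ht
    have htt : t ^ 2 = ‖a‖ := Real.sq_sqrt ha0.le
    have ht0 : 0 < t := Real.sqrt_pos.2 ha0
    rw [← htt] at ha ⊢
    rw [le_div_iff₀ (by positivity)]
    have ht1 : t ≤ 1 := by nlinarith
    have h1 : δ / 2 ≤ 1 - t := by nlinarith
    have h2 : (δ / 2) ^ 2 ≤ (1 - t) ^ 2 := pow_le_pow_left₀ (by positivity) h1 2
    nlinarith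
  rw [div_lt_iff₀ (by positivity)] at hft
  have := mul_le_mul_of_nonneg_right hk (norm_nonneg (deriv f z0))
  rw [← hge] at this
  nlinarith

/-- Schwarz-Harnack for positive real part. -/
lemma posre_schwarz {h : ℂ → ℂ} {c z : ℂ} {R : ℝ} (hd : DifferentiableOn ℂ h (ball c R))
    (hp : ∀ w ∈ ball c R, 0 < (h w).re) (hz : z ∈ ball c R) :
    ‖h z - h c‖ ≤ dist z c / R * (‖h z - h c‖ + 2 * (h c).re) := by
  have hR : 0 < R := lt_of_le_of_lt dist_nonneg hz
  have hc : c ∈ ball c R := mem_ball_self hR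
  have hden : ∀ w ∈ ball c R, h w + (starRingEnd ℂ) (h c) ≠ 0 := by
    intro w hw h0
    have := congrArg Complex.re h0
    simp at this
    linarith [hp w hw, hp c hc]
  set F : ℂ → ℂ := fun w => (h w - h c) / (h w + (starRingEnd ℂ) (h c)) with hF
  have hFd : DifferentiableOn ℂ F (ball c R) :=
    (hd.sub_const _).div (hd.add_const _) hden
  have hFc : F c = 0 := by simp [hF]
  have hmaps : MapsTo F (ball c R) (ball (F c) 1) := by
    intro w hw
    rw [hFc, mem_ball_zero_iff, hF]
    simp only
    rw [norm_div, div_lt_one (norm_pos_iff.2 (hden w hw))]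
    apply lt_of_pow_lt_pow_left₀ 2 (norm_nonneg _)
    rw [← Complex.normSq_eq_norm_sq, ← Complex.normSq_eq_norm_sq]
    simp only [Complex.normSq_apply, Complex.sub_re, Complex.sub_im, Complex.add_re,
      Complex.add_im, Complex.conj_re, Complex.conj_im]
    nlinarith [mul_pos (hp w hw) (hp c hc)]
  have key := Complex.dist_le_div_mul_dist_of_mapsTo_ball hFd (hmaps.mono_right ball_subset_closedBall) hz
  rw [hFc, dist_zero_right, hF] at key
  simp only at key
  rw [norm_div, div_le_iff₀ (norm_pos_iff.2 (hden z hz))] at key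
  have h2 : ‖h z + (starRingEnd ℂ) (h c)‖ ≤ ‖h z - h c‖ + 2 * (h c).re := by
    have e : h z + (starRingEnd ℂ) (h c) = (h z - h c) + ((2 * (h c).re : ℝ) : ℂ) := by
      apply Complex.ext <;> simp <;> ring
    rw [e]
    refine (norm_add_le _ _).trans ?_
    rw [Complex.norm_real, Real.norm_eq_abs, abs_of_pos (by linarith [hp c hc])]
  calc ‖h z - h c‖ ≤ _ := key
    _ ≤ dist z c / R * (‖h z - h c‖ + 2 * (h c).re) := by
        rw [one_div, inv_mul_eq_div]
        gcongr

lemma posre_harnack {h : ℂ → ℂ} {c z : ℂ} {R : ℝ} (hd : DifferentiableOn ℂ h (ball c R))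
    (hp : ∀ w ∈ ball c R, 0 < (h w).re) (hR : 0 < R) (hz : dist z c ≤ R / 8) :
    5 / 7 * (h c).re ≤ (h z).re := by
  have h1 := posre_schwarz hd hp (z := z) (by rw [mem_ball]; linarith)
  have hq : dist z c / R ≤ 1 / 8 := by rw [div_le_iff₀ hR]; linarith
  have hc := hp c (mem_ball_self hR)
  have h2 : ‖h z - h c‖ ≤ 1 / 8 * (‖h z - h c‖ + 2 * (h c).re) :=
    h1.trans (by gcongr)
  have h3 := (abs_le.1 (Complex.abs_re_le_norm (h z - h c))).1
  rw [Complex.sub_re] at h3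
  linarith

lemma posre_deriv {h : ℂ → ℂ} {c : ℂ} {R : ℝ} (hd : DifferentiableOn ℂ h (ball c R))
    (hp : ∀ w ∈ ball c R, 0 < (h w).re) (hR : 0 < R) :
    ‖deriv h c‖ ≤ 4 * (h c).re / R := by
  have hc := hp c (mem_ball_self hR)
  have hda : HasDerivAt h (deriv h c) c :=
    (hd.differentiableAt (ball_mem_nhds c hR)).hasDerivAt
  apply hda.le_of_lip' (by positivity)
  filter_upwards [ball_mem_nhds c (half_pos hR)] with w hw
  rw [mem_ball] at hw
  have h1 := posre_schwarz hd hp (z := w) (by rw [mem_ball]; linarith)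
  have hq : dist w c / R ≤ 1 / 2 := by rw [div_le_iff₀ hR]; linarith
  have h2 : ‖h w - h c‖ ≤ 2 * (h c).re := by
    have : ‖h w - h c‖ ≤ 1 / 2 * (‖h w - h c‖ + 2 * (h c).re) := h1.trans (by gcongr)
    linarith
  calc _ ≤ _ := h1
    _ ≤ dist w c / R * (2 * (h c).re + 2 * (h c).re) := by gcongr
    _ = _ := by rw [← dist_eq_norm]; ring


def CChain (U : Set ℂ) (N : ℕ) (x y : ℂ) : Prop := ∃ f : ℕ → ℂ, f 0 = x ∧ f N = y ∧
  (∀ i < N, dist (f i) (f (i + 1)) ≤ infDist (f i) Uᶜ / 8) ∧ (∀ i ≤ N, f i ∈ U)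

lemma cdpos {U : Set ℂ} (hU : IsOpen U) (hne : Uᶜ.Nonempty) {z : ℂ} (hz : z ∈ U) :
    0 < infDist z Uᶜ :=
  (hU.isClosed_compl.notMem_iff_infDist_pos hne).1 (fun h => h hz)

lemma exists_unit (w : ℂ) : ∃ e : ℂ, ‖e‖ = 1 ∧ w = ‖w‖ * e :=
  ⟨Complex.exp (Complex.arg w * Complex.I), Complex.norm_exp_ofReal_mul_I _,
    (Complex.norm_mul_exp_arg_mul_I w).symm⟩

lemma unit_re {e w : ℂ} (he : ‖e‖ = 1) : ((starRingEnd ℂ) e * w).re ≤ ‖w‖ := by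
  refine (Complex.re_le_norm _).trans ?_
  rw [norm_mul, RCLike.norm_conj, he, one_mul]

lemma Fam.lower {U : Set ℂ} {z0 x : ℂ} {f : ℂ → ℂ} (h : Fam U z0 f) (hU : IsOpen U)
    (hne : Uᶜ.Nonempty) {N : ℕ} (hch : CChain U N z0 x) : (5 / 7 : ℝ) ^ N ≤ 1 - ‖f x‖ := by
  obtain ⟨c, hc0, hcN, hca, hcU⟩ := hch
  obtain ⟨e, he, hfe⟩ := exists_unit (f x)
  set H : ℂ → ℂ := fun z => 1 - (starRingEnd ℂ) e * f z with hH
  have hHd : DifferentiableOn ℂ H U := (h.diff.const_mul _).const_sub 1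
  have hHp : ∀ z ∈ U, 0 < (H z).re := by
    intro z hz
    have := unit_re (w := f z) he
    simp only [hH, Complex.sub_re, Complex.one_re]
    linarith [h.maps z hz]
  have key : ∀ i ≤ N, (5 / 7 : ℝ) ^ i ≤ (H (c i)).re := by
    intro i
    induction i with
    | zero => intro _; simp [hH, hc0, h.zero]
    | succ i ih =>
      intro hi
      have h1 := ih (by omega)
      have hb : ball (c i) (infDist (c i) Uᶜ) ⊆ U := Metric.ball_infDist_compl_subset
      have h2 := posre_harnack (hHd.mono hb) (fun w hw => hHp w (hb hw))
        (cdpos hU hne (hcU i (by omega))) (z := c (i + 1))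
        (by rw [dist_comm]; exact hca i (by omega))
      rw [pow_succ]
      linarith
  have h3 := key N le_rfl
  rw [hcN] at h3
  have h4 : H x = ((1 - ‖f x‖ : ℝ) : ℂ) := by
    simp only [hH]
    conv_lhs => rw [hfe]
    have : (starRingEnd ℂ) e * e = 1 := by
      rw [conj_mul_self_norm, he]; simp
    push_cast
    linear_combination (-(‖f x‖ : ℂ)) * this
  rw [h4, Complex.ofReal_re] at h3
  exact h3

lemma koebe_q {U : Set ℂ} (hU : IsOpen U) (hsc : IsSimplyConnected U) {z a : ℂ} {d : ℝ}
    (hd : 0 < d) (haU : a ∉ U) (hza : dist z a = d) (hb : ball z d ⊆ U) :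
    ∃ q : ℂ → ℂ, DifferentiableOn ℂ q U ∧ (∀ ζ ∈ U, q ζ ^ 2 = (ζ - a) / (z - a)) ∧ q z = 1 ∧
      ∀ ζ ∈ U, 1 / 4 ≤ ‖q ζ + 1‖ := by
  have hza0 : z - a ≠ 0 := by
    rw [← norm_pos_iff, ← dist_eq_norm, hza]; exact hd
  have hzU : z ∈ U := hb (mem_ball_self hd)
  have hGd : DifferentiableOn ℂ (fun ζ => (ζ - a) / (z - a)) U := by fun_prop
  obtain ⟨q0, hq0, hq0e⟩ := sqrt_branch hU hsc hGd (by
    intro ζ hζ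
    refine div_ne_zero (sub_ne_zero.2 ?_) hza0
    rintro rfl
    exact haU hζ)
  have hex : ∃ q : ℂ → ℂ, DifferentiableOn ℂ q U ∧ (∀ ζ ∈ U, q ζ ^ 2 = (ζ - a) / (z - a)) ∧
      q z = 1 := by
    have h1 := hq0e z hzU
    rw [div_self hza0] at h1
    rcases (show q0 z = 1 ∨ q0 z = -1 from by simpa using h1) with h2 | h2
    · exact ⟨q0, hq0, hq0e, h2⟩
    · refine ⟨fun ζ => - q0 ζ, hq0.neg, fun ζ hζ => ?_, by simp [h2]⟩
      rw [neg_sq]; exact hq0e ζ hζ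
  obtain ⟨q, hq, hqe, hqz⟩ := hex
  have hdist : ∀ ζ ∈ U, ‖q ζ ^ 2 - 1‖ * d = dist ζ z := by
    intro ζ hζ
    rw [hqe ζ hζ, ← hza, dist_eq_norm, dist_eq_norm, ← norm_mul]
    congr 1
    field_simp
    ring
  have hre0 : ∀ ζ ∈ ball z d, (q ζ).re ≠ 0 := by
    intro ζ hζ h0
    have h1 := hdist ζ (hb hζ)
    rw [mem_ball] at hζ
    have h2 : ‖q ζ ^ 2 - 1‖ < 1 := by
      by_contra hc
      push Not at hc
      nlinarith
    have h3 := (abs_le.1 (Complex.abs_re_le_norm (q ζ ^ 2 - 1))).1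
    rw [pow_two, Complex.sub_re, Complex.mul_re, h0, Complex.one_re] at h3
    rw [pow_two] at h2
    nlinarith [mul_self_nonneg (q ζ).im]
  have hre : ∀ ζ ∈ ball z d, 0 < (q ζ).re := by
    intro ζ hζ
    by_contra hc
    push Not at hc
    have hpre : IsPreconnected (ball z d) := (convex_ball z d).isPreconnected
    have hcont : ContinuousOn (fun ζ => (q ζ).re) (ball z d) :=
      Complex.continuous_re.comp_continuousOn (hq.continuousOn.mono hb)
    have := hpre.intermediate_value hζ (mem_ball_self hd) hcont
      (show (0:ℝ) ∈ Icc _ _ from ⟨hc, by rw [hqz]; simp⟩)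
    obtain ⟨ξ, hξ, hξ0⟩ := this
    exact hre0 ξ hξ hξ0
  refine ⟨q, hq, hqe, hqz, ?_⟩
  intro ζ hζ
  by_contra hc
  push Not at hc
  have h1 := hdist ζ hζ
  have e : q ζ ^ 2 - 1 = (q ζ + 1) * (q ζ + 1 - 2) := by ring
  have h2 : ‖q ζ ^ 2 - 1‖ < 1 := by
    rw [e, norm_mul]
    have : ‖q ζ + 1 - 2‖ ≤ ‖q ζ + 1‖ + 2 := by
      refine (norm_sub_le _ _).trans ?_
      simp
    nlinarith [norm_nonneg (q ζ + 1)]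
  have h3 : ζ ∈ ball z d := by
    rw [mem_ball, ← h1]; nlinarith
  have h4 := hre ζ h3
  have h5 := (Complex.re_le_norm (q ζ + 1))
  simp at h5
  linarith

lemma koebe_step {U : Set ℂ} (hU : IsOpen U) (hsc : IsSimplyConnected U) (hne : Uᶜ.Nonempty)
    {φ : ℂ → ℂ} {w w' : ℂ} {ρ : ℝ} (hφ : DifferentiableOn ℂ φ (ball w ρ))
    (hm : MapsTo φ (ball w ρ) U) (hρ : 0 < ρ) (hw : dist w' w ≤ ρ / 1024) :
    dist (φ w) (φ w') ≤ infDist (φ w) Uᶜ / 8 := by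
  have hwm : w ∈ ball w ρ := mem_ball_self hρ
  have hwm' : w' ∈ ball w ρ := by rw [mem_ball]; linarith
  obtain ⟨a, haU, hza⟩ := hU.isClosed_compl.exists_infDist_eq_dist hne (φ w)
  set d := infDist (φ w) Uᶜ with hd
  have hdp : 0 < d := cdpos hU hne (hm hwm)
  obtain ⟨q, hq, hqe, hqz, hq4⟩ := koebe_q hU hsc hdp haU hza.symm
    Metric.ball_infDist_compl_subset
  have hza0 : φ w - a ≠ 0 := by
    rw [← norm_pos_iff, ← dist_eq_norm, ← hza]; exact hdp
  set h : ℂ → ℂ := fun ζ => (q (φ ζ) + 1)⁻¹ with hh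
  have hq0 : ∀ ζ ∈ ball w ρ, q (φ ζ) + 1 ≠ 0 := by
    intro ζ hζ
    rw [← norm_pos_iff]
    linarith [hq4 _ (hm hζ)]
  have hhd : DifferentiableOn ℂ h (ball w ρ) :=
    ((hq.comp hφ hm).add_const 1).inv hq0
  have hhw : h w = 1 / 2 := by simp [hh, hqz]; norm_num
  have hh4 : ∀ ζ ∈ ball w ρ, ‖h ζ‖ ≤ 4 := by
    intro ζ hζ
    rw [hh]
    simp only [norm_inv]
    have := inv_anti₀ (by norm_num) (hq4 _ (hm hζ))
    simpa using this
  have key := Complex.dist_le_div_mul_dist_of_mapsTo_ball (R₂ := 8) hhd (by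
    intro ζ hζ
    rw [mem_closedBall, dist_eq_norm, hhw]
    refine (norm_sub_le _ _).trans ?_
    have := hh4 ζ hζ
    norm_num
    linarith) hwm'
  have k2 : ‖h w' - 1 / 2‖ ≤ 1 / 128 := by
    rw [dist_eq_norm, hhw] at key
    refine key.trans ?_
    have := mul_le_mul_of_nonneg_left hw (show 0 ≤ 8 / ρ by positivity)
    refine this.trans (le_of_eq ?_)
    field_simp
    norm_num
  have k3 : 63 / 128 ≤ ‖h w'‖ := by
    have h1 : ‖(1 / 2 : ℂ)‖ ≤ ‖h w'‖ + ‖1 / 2 - h w'‖ := by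
      calc ‖(1 / 2 : ℂ)‖ = ‖h w' + (1 / 2 - h w')‖ := by congr 1; ring
        _ ≤ _ := norm_add_le _ _
    rw [norm_sub_rev (1 / 2 : ℂ)] at h1
    norm_num at h1 k2 ⊢
    linarith
  have hh0 : h w' ≠ 0 := by rw [← norm_pos_iff]; linarith
  have e1 : φ w - φ w' = (φ w - a) * (2 * (h w' - 1 / 2) / h w' ^ 2) := by
    have h1 := hqe _ (hm hwm')
    have h2 : q (φ w') = (h w')⁻¹ - 1 := by simp [hh]
    rw [h2, eq_div_iff hza0] at h1
    have h3 : φ w - φ w' = (φ w - a) - ((h w')⁻¹ - 1) ^ 2 * (φ w - a) := by rw [h1]; ring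
    rw [h3]
    field_simp
    ring
  rw [dist_eq_norm, e1, norm_mul, ← dist_eq_norm, ← hza, norm_div, norm_mul, norm_pow,
    Complex.norm_ofNat]
  have k4 : 2 * ‖h w' - 1 / 2‖ / ‖h w'‖ ^ 2 ≤ 1 / 8 := by
    rw [div_le_iff₀ (by positivity)]
    nlinarith
  nlinarith

lemma Fam.inverse {U : Set ℂ} {z0 : ℂ} {f : ℂ → ℂ} (h : Fam U z0 f) (hU : IsOpen U) {R : ℝ}
    (hcov : ∀ a : ℂ, ‖a‖ ≤ R → ∃ z ∈ U, f z = a) :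
    ∃ φ : ℂ → ℂ, DifferentiableOn ℂ φ (ball 0 R) ∧ MapsTo φ (ball 0 R) U ∧
      ∀ a ∈ ball (0:ℂ) R, f (φ a) = a := by
  choose! φ hφU hφf using hcov
  have hle : ∀ a ∈ ball (0:ℂ) R, ‖a‖ ≤ R := fun a ha => (mem_ball_zero_iff.1 ha).le
  refine ⟨φ, ?_, fun a ha => hφU a (hle a ha), fun a ha => hφf a (hle a ha)⟩
  intro a ha
  have haU := hφU a (hle a ha)
  have haf := hφf a (hle a ha)
  have han : ball (0:ℂ) R ∈ nhds a := isOpen_ball.mem_nhds ha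
  have hstr := (h.diff.analyticAt (hU.mem_nhds haU)).hasStrictDerivAt
  have hmap := hstr.map_nhds_eq (h.der _ haU)
  rw [haf] at hmap
  have hcont : ContinuousAt φ a := by
    intro V hV
    have h1 : f '' (V ∩ U) ∈ nhds a := by
      rw [← hmap]
      exact Filter.image_mem_map (Filter.inter_mem hV (hU.mem_nhds haU))
    rw [Filter.mem_map]
    filter_upwards [h1, han] with b hb hbb
    obtain ⟨v, ⟨hvV, hvU⟩, hvb⟩ := hb
    have : v = φ b := h.inj hvU (hφU b (hle b hbb)) (by rw [hvb, hφf b (hle b hbb)])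
    rw [mem_preimage, ← this]; exact hvV
  have := HasDerivAt.of_local_left_inverse hcont (h.hasDeriv hU haU) (h.der _ haU)
    (by filter_upwards [han] with b hb using hφf b (hle b hb))
  exact this.differentiableAt.differentiableWithinAt

lemma Fam.chain {U : Set ℂ} {z0 x : ℂ} {f : ℂ → ℂ} (h : Fam U z0 f) (hU : IsOpen U)
    (hsc : IsSimplyConnected U) (hne : Uᶜ.Nonempty) (hz0 : z0 ∈ U) (hx : x ∈ U) {δ : ℝ}
    (hδ : 0 < δ) (hcov : ∀ a : ℂ, ‖a‖ ≤ 1 - δ → ∃ z ∈ U, f z = a)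
    (hδη : δ ≤ (1 - ‖f x‖) / 2) {n : ℕ} (hn : 2 / (1 - ‖f x‖) ≤ (1 + 1 / 1024 : ℝ) ^ n) :
    CChain U n x z0 := by
  obtain ⟨φ, hφd, hφU, hφf⟩ := h.inverse hU hcov
  obtain ⟨e, he, hfe⟩ := exists_unit (f x)
  have hfx := h.maps x hx
  have hfx0 := norm_nonneg (f x)
  set η := 1 - ‖f x‖ with hη
  have hη0 : 0 < η := by linarith
  set κ : ℝ := 1 + 1 / 1024 with hκ
  set R := 1 - δ with hR
  have hηδ : 0 < η - δ := by linarith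
  set t : ℕ → ℝ := fun j => max 0 (R - (η - δ) * κ ^ j) with ht
  have htR : ∀ j, t j < R := by
    intro j
    have : 0 < (η - δ) * κ ^ j := by positivity
    exact max_lt (by linarith) (by linarith)
  have ht0 : ∀ j, 0 ≤ t j := fun j => le_max_left _ _
  have hnorm : ∀ j, ‖(t j : ℂ) * e‖ = t j := by
    intro j
    rw [norm_mul, he, mul_one, Complex.norm_real, Real.norm_eq_abs, abs_of_nonneg (ht0 j)]
  have hmem : ∀ j, (t j : ℂ) * e ∈ ball (0:ℂ) R := by
    intro j; rw [mem_ball_zero_iff, hnorm]; exact htR j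
  refine ⟨fun j => φ (t j * e), ?_, ?_, ?_, fun j _ => hφU (hmem j)⟩
  · have h1 : t 0 = ‖f x‖ := by
      simp only [ht, pow_zero, mul_one]
      rw [max_eq_right] <;> linarith
    refine h.inj (hφU (hmem 0)) hx ?_
    rw [hφf _ (hmem 0), h1]; exact hfe.symm
  · have h1 : t n = 0 := by
      apply max_eq_left
      rw [div_le_iff₀ hη0] at hn
      nlinarith [pow_pos (show 0 < κ by positivity) n]
    refine h.inj (hφU (hmem n)) hz0 ?_
    rw [hφf _ (hmem n), h1, h.zero]; simp
  · intro j _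
    have hsub : ball ((t j : ℂ) * e) (R - t j) ⊆ ball 0 R := by
      apply ball_subset_ball'
      rw [dist_zero_right, hnorm]; linarith
    apply koebe_step hU hsc hne (hφd.mono hsub) (hφU.mono_left hsub) (by linarith [htR j])
    rw [dist_eq_norm, ← sub_mul, norm_mul, he, mul_one, ← Complex.ofReal_sub, Complex.norm_real,
      Real.norm_eq_abs]
    have hmono : R - (η - δ) * κ ^ (j + 1) ≤ R - (η - δ) * κ ^ j := by
      have : κ ^ j ≤ κ ^ (j + 1) := pow_le_pow_right₀ (by rw [hκ]; norm_num) (by omega)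
      nlinarith
    have hp : 0 < (η - δ) * κ ^ j := by positivity
    have hstep : (η - δ) * κ ^ (j + 1) = (η - δ) * κ ^ j + (η - δ) * κ ^ j / 1024 := by
      rw [pow_succ, hκ]; ring
    rcases le_total (R - (η - δ) * κ ^ j) 0 with h1 | h1
    · have e1 : t j = 0 := max_eq_left h1
      have e2 : t (j + 1) = 0 := max_eq_left (hmono.trans h1)
      rw [e1, e2]
      simp
      linarith
    · have e1 : t j = R - (η - δ) * κ ^ j := max_eq_right h1
      have e2 : R - (η - δ) * κ ^ (j + 1) ≤ t (j + 1) := le_max_right _ _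
      have e3 : t (j + 1) ≤ t j := max_le_max le_rfl hmono
      rw [abs_sub_comm, abs_of_nonneg (by linarith)]
      rw [hstep] at e2
      generalize (η - δ) * κ ^ j = X at *
      rw [e1]
      linarith


lemma rot_inv {Ψ : ℂ → ℝ≥0∞} (hΨ : Measurable Ψ) (c : ℂ) (r θ : ℝ) :
    ∫⁻ w in ball (0:ℂ) r, Ψ (c + circleMap 0 1 θ * w) = ∫⁻ z in ball c r, Ψ z := by
  have h1 : MeasurePreserving (fun w : ℂ => c + circleMap 0 1 θ * w) volume volume := by
    have a := (rotation (Circle.exp θ)).measurePreserving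
    have b := measurePreserving_add_left (volume : Measure ℂ) c
    have e : (fun w : ℂ => c + circleMap 0 1 θ * w) =
        (fun x => c + x) ∘ (rotation (Circle.exp θ)) := by
      funext w
      simp [circleMap]
    rw [e]
    exact b.comp a
  have h2 := h1.setLIntegral_comp_preimage (s := ball c r) measurableSet_ball hΨ
  rw [← h2]
  congr 2
  ext w
  simp

lemma submean {F : ℂ → ℂ} {c : ℂ} {r : ℝ} (hF : DifferentiableOn ℂ F (ball c r))
    (hm : Measurable F) : ‖F c‖ₑ * volume (ball c r) ≤ ∫⁻ z in ball c r, ‖F z‖ₑ := by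
  have hmean : ∀ w ∈ ball (0:ℂ) r, ENNReal.ofReal (2 * Real.pi) * ‖F c‖ₑ ≤
      ∫⁻ θ in Ioc (0:ℝ) (2 * Real.pi), ‖F (c + circleMap 0 1 θ * w)‖ₑ := by
    intro w hw
    rw [mem_ball_zero_iff] at hw
    have hdiff : DiffContOnCl ℂ (fun ζ => F (c + ζ * w)) (ball 0 |1|) := by
      have h1 : DifferentiableOn ℂ (fun ζ => F (c + ζ * w))
          ((fun ζ => c + ζ * w) ⁻¹' (ball c r)) :=
        hF.comp (by fun_prop) (fun z hz => hz)
      apply h1.diffContOnCl_ball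
      intro ζ hζ
      rw [abs_one, mem_closedBall_zero_iff] at hζ
      simp only [mem_preimage, mem_ball, dist_eq_norm, add_sub_cancel_left, norm_mul]
      nlinarith [norm_nonneg w, norm_nonneg ζ]
    have h2 := hdiff.circleAverage
    simp only [zero_mul, add_zero, Real.circleAverage] at h2
    have h3 : (2 * Real.pi : ℝ) • F c =
        ∫ θ in Ioc (0:ℝ) (2 * Real.pi), F (c + circleMap 0 1 θ * w) := by
      rw [← h2, smul_smul, mul_inv_cancel₀ (by positivity), one_smul,
        intervalIntegral.integral_of_le (by positivity)]
    calc _ = ‖(2 * Real.pi : ℝ) • F c‖ₑ := by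
          rw [enorm_smul, Real.enorm_eq_ofReal (by positivity)]
      _ ≤ _ := by
          rw [h3]
          exact enorm_integral_le_lintegral_enorm _
  have hpi : ENNReal.ofReal (2 * Real.pi) ≠ 0 := by
    simp [Real.pi_pos]
  have hpi' : ENNReal.ofReal (2 * Real.pi) ≠ ⊤ := ENNReal.ofReal_ne_top
  have key : ENNReal.ofReal (2 * Real.pi) * (‖F c‖ₑ * volume (ball c r)) ≤
      ENNReal.ofReal (2 * Real.pi) * ∫⁻ z in ball c r, ‖F z‖ₑ := by
    calc _ = ∫⁻ w in ball (0:ℂ) r, ENNReal.ofReal (2 * Real.pi) * ‖F c‖ₑ := by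
          rw [setLIntegral_const, Complex.volume_ball, Complex.volume_ball, mul_assoc]
      _ ≤ ∫⁻ w in ball (0:ℂ) r, ∫⁻ θ in Ioc (0:ℝ) (2 * Real.pi),
            ‖F (c + circleMap 0 1 θ * w)‖ₑ := setLIntegral_mono' measurableSet_ball hmean
      _ = ∫⁻ θ in Ioc (0:ℝ) (2 * Real.pi), ∫⁻ w in ball (0:ℂ) r,
            ‖F (c + circleMap 0 1 θ * w)‖ₑ := by
          apply lintegral_lintegral_swap
          apply Measurable.aemeasurable
          apply (hm.comp _).enorm
          have : Continuous (fun p : ℂ × ℝ => c + circleMap 0 1 p.2 * p.1) := by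
            have := continuous_circleMap (0:ℂ) 1
            fun_prop
          exact this.measurable
      _ = ∫⁻ θ in Ioc (0:ℝ) (2 * Real.pi), ∫⁻ z in ball c r, ‖F z‖ₑ := by
          congr 1
          ext θ
          exact rot_inv hm.enorm c r θ
      _ = _ := by
          rw [setLIntegral_const, Real.volume_Ioc, sub_zero, mul_comm]
  exact (ENNReal.mul_le_mul_iff_right hpi hpi').1 key

lemma measurable_ind {E : Type*} [NormedAddCommGroup E] [MeasurableSpace E] [BorelSpace E]
    {U : Set ℂ} (hU : IsOpen U) {f : ℂ → E} (hf : ContinuousOn f U) :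
    Measurable (U.indicator f) := by
  classical
  rw [← Set.piecewise_eq_indicator]
  exact hf.measurable_piecewise continuousOn_const hU.measurableSet


lemma vball (c : ℂ) {r : ℝ} (hr : 0 ≤ r) : volume (ball c r) = ENNReal.ofReal (Real.pi * r ^ 2) := by
  rw [Complex.volume_ball, mul_comm Real.pi, ENNReal.ofReal_mul (by positivity),
    ENNReal.ofReal_pow hr]
  congr 1
  exact (ENNReal.ofReal_coe_nnreal (p := NNReal.pi)).symm

lemma cdlip (U : Set ℂ) (x y : ℂ) : infDist x Uᶜ ≤ infDist y Uᶜ + dist x y :=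
  infDist_le_infDist_add_dist

lemma enorm_sq_le {w : ℂ} {a : ℝ} (ha : 0 ≤ a) (h : ‖w‖ ≤ a) :
    ‖w‖ₑ ^ 2 ≤ ENNReal.ofReal (a ^ 2) := by
  rw [ENNReal.ofReal_pow ha, ← ofReal_norm]
  gcongr

lemma grad_exists {U : Set ℂ} (hU : IsOpen U) (hne : Uᶜ.Nonempty) {L : ℂ → ℂ}
    (hL : DifferentiableOn ℂ L U) (hL4 : ∀ z ∈ U, ‖deriv L z‖ ≤ 4 / infDist z Uᶜ) {A : ℝ}
    (hA : ∫⁻ z in U, ‖deriv L z‖ₑ ^ 2 ≤ ENNReal.ofReal A) {s : ℝ} (hs : 0 < s) (hs1 : s ≤ 1) :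
    ∃ g : ℂ → ℝ, Measurable g ∧ (∀ z, 0 ≤ g z) ∧
      (∀ z ∈ U, ∀ z' ∈ U, dist z z' < infDist z Uᶜ / 2 →
        |(L z).re - (L z').re| ≤ dist z z' ^ s * (g z + g z')) ∧
      ∫⁻ z in U, ENNReal.ofReal (g z ^ (2 / s)) ≤
        ENNReal.ofReal ((48 : ℝ) ^ (2 * (1 - s) / s) * 441 * A) := by
  have hpi := Real.pi_pos
  set d : ℂ → ℝ := fun z => infDist z Uᶜ with hd
  have hdm : Measurable d := (continuous_infDist_pt _).measurable
  have hdp : ∀ z ∈ U, 0 < d z := fun z hz => cdpos hU hne hz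
  have hdl : ∀ x y, d x ≤ d y + dist x y := cdlip U
  have hdL : DifferentiableOn ℂ (deriv L) U := hL.deriv hU
  set k : ℂ → ℂ := U.indicator (deriv L) with hk
  have hkm : Measurable k := measurable_ind hU hdL.continuousOn
  have hkU : ∀ z ∈ U, k z = deriv L z := fun z hz => indicator_of_mem hz _
  set T : ℂ → ℂ → ℝ≥0∞ := fun y z => if dist z y < 3 / 4 * d y then
    ENNReal.ofReal (16 / (Real.pi * d y ^ 2)) * ‖k z‖ₑ ^ 2 else 0 with hT
  have hTm : Measurable (Function.uncurry T) := by
    have hd1 : Measurable (fun p : ℂ × ℂ => d p.1) := hdm.comp measurable_fst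
    apply Measurable.ite
    · exact measurableSet_lt (measurable_snd.dist measurable_fst) (hd1.const_mul _)
    · refine Measurable.fun_mul ?_ ?_
      · exact (((hd1.pow_const 2).const_mul _).const_div _).ennreal_ofReal
      · exact (hkm.comp measurable_snd).enorm.pow_const 2
    · exact measurable_const
  set W : ℂ → ℝ≥0∞ := fun y => ∫⁻ z, T y z with hW
  have hWm : Measurable W := hTm.lintegral_prod_right
  have hWe : ∀ y, W y = ENNReal.ofReal (16 / (Real.pi * d y ^ 2)) *
      ∫⁻ z in ball y (3 / 4 * d y), ‖k z‖ₑ ^ 2 := by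
    intro y
    rw [← lintegral_const_mul _ (hkm.enorm.pow_const 2),
      ← lintegral_indicator measurableSet_ball]
    apply lintegral_congr
    intro z
    simp only [hT, indicator, mem_ball]
  have hbU : ∀ y, ball y (d y) ⊆ U := fun y => Metric.ball_infDist_compl_subset
  -- upper bound
  have hWub : ∀ y ∈ U, W y ≤ ENNReal.ofReal ((48 / d y) ^ 2) := by
    intro y hy
    have hdy := hdp y hy
    rw [hWe]
    have h1 : ∫⁻ z in ball y (3 / 4 * d y), ‖k z‖ₑ ^ 2 ≤
        ENNReal.ofReal ((16 / d y) ^ 2) * ENNReal.ofReal (Real.pi * (3 / 4 * d y) ^ 2) := by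
      rw [← vball y (by positivity), ← setLIntegral_const]
      apply setLIntegral_mono' measurableSet_ball
      intro z hz
      rw [mem_ball] at hz
      have hzU : z ∈ U := hbU y (by rw [mem_ball]; linarith)
      apply enorm_sq_le (by positivity)
      rw [hkU z hzU]
      refine (hL4 z hzU).trans ?_
      have : d y / 4 ≤ d z := by
        have := hdl y z
        rw [dist_comm] at this
        linarith
      rw [div_le_div_iff₀ (hdp z hzU) hdy]
      simp only [hd] at this ⊢
      linarith
    refine (mul_le_mul_right h1 _).trans ?_
    rw [← ENNReal.ofReal_mul (by positivity), ← ENNReal.ofReal_mul (by positivity)]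
    apply ENNReal.ofReal_le_ofReal
    apply le_of_eq
    field_simp
    norm_num
  have hWlb : ∀ y ∈ U, ∀ z ∈ ball y (d y / 2), ‖k z‖ₑ ^ 2 ≤ W y := by
    intro y hy z hz
    have hdy := hdp y hy
    rw [mem_ball] at hz
    have hs1 : ball z (d y / 4) ⊆ ball y (3 / 4 * d y) := by
      apply ball_subset_ball'; linarith
    have hs2 : ball z (d y / 4) ⊆ U :=
      hs1.trans ((ball_subset_ball (by linarith)).trans (hbU y))
    have h1 := submean (F := fun z => k z ^ 2) (c := z) (r := d y / 4)
      (by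
        have : DifferentiableOn ℂ (fun z => deriv L z ^ 2) (ball z (d y / 4)) :=
          (hdL.mono hs2).pow 2
        refine this.congr ?_
        intro w hw
        simp only [hkU w (hs2 hw)]) (hkm.pow_const 2)
    rw [vball z (by positivity)] at h1
    simp only [enorm_pow] at h1
    rw [hWe]
    calc ‖k z‖ₑ ^ 2 = ENNReal.ofReal (16 / (Real.pi * d y ^ 2)) *
          (‖k z‖ₑ ^ 2 * ENNReal.ofReal (Real.pi * (d y / 4) ^ 2)) := by
          rw [mul_comm (‖k z‖ₑ ^ 2), ← mul_assoc, ← ENNReal.ofReal_mul (by positivity)]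
          have : 16 / (Real.pi * d y ^ 2) * (Real.pi * (d y / 4) ^ 2) = 1 := by
            field_simp; norm_num
          rw [this]; simp
      _ ≤ _ := by
          gcongr
          exact h1.trans (lintegral_mono_set hs1)
  have hWint : ∫⁻ y in U, W y ≤ ENNReal.ofReal (441 * A) := by
    calc ∫⁻ y in U, W y = ∫⁻ z, ∫⁻ y in U, T y z :=
          lintegral_lintegral_swap hTm.aemeasurable
      _ ≤ ∫⁻ z, ENNReal.ofReal 441 * ‖k z‖ₑ ^ 2 := by
          apply lintegral_mono
          intro z
          by_cases hz : z ∈ U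
          · have hdz := hdp z hz
            calc ∫⁻ y in U, T y z ≤ ∫⁻ y in U, (ball z (3 * d z)).indicator
                  (fun _ => ENNReal.ofReal (49 / (Real.pi * d z ^ 2)) * ‖k z‖ₑ ^ 2) y := by
                  apply setLIntegral_mono' hU.measurableSet
                  intro y hy
                  have hdy := hdp y hy
                  simp only [hT]
                  split_ifs with h
                  · have h1 : d y < 4 * d z := by
                      have := hdl y z
                      rw [dist_comm] at this
                      linarith
                    have h2 : d z ≤ 7 / 4 * d y := by
                      have := hdl z y
                      linarith
                    rw [indicator_of_mem (by rw [mem_ball, dist_comm]; linarith)]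
                    gcongr ENNReal.ofReal ?_ * _
                    rw [div_le_div_iff₀ (by positivity) (by positivity)]
                    nlinarith [mul_le_mul_of_nonneg_left (pow_le_pow_left₀ hdz.le h2 2) hpi.le]
                  · exact bot_le
              _ ≤ ∫⁻ y, (ball z (3 * d z)).indicator
                  (fun _ => ENNReal.ofReal (49 / (Real.pi * d z ^ 2)) * ‖k z‖ₑ ^ 2) y :=
                  setLIntegral_le_lintegral _ _
              _ = _ := by
                  rw [lintegral_indicator measurableSet_ball, setLIntegral_const,
                    vball z (by positivity), mul_right_comm,
                    ← ENNReal.ofReal_mul (by positivity)]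
                  congr 2
                  field_simp
                  norm_num
          · have : k z = 0 := indicator_of_notMem hz _
            simp [hT, this]
      _ = ENNReal.ofReal 441 * ∫⁻ z in U, ‖deriv L z‖ₑ ^ 2 := by
          rw [lintegral_const_mul _ (hkm.enorm.pow_const 2), ← lintegral_indicator hU.measurableSet]
          congr 2
          ext z
          by_cases hz : z ∈ U
          · simp [hk, hz]
          · simp [hk, hz]
      _ ≤ _ := by
          rw [ENNReal.ofReal_mul (by norm_num)]
          gcongr
  set G : ℂ → ℝ := fun y => Real.sqrt (W y).toReal with hG
  have hGm : Measurable G := hWm.ennreal_toReal.sqrt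
  have hG0 : ∀ y, 0 ≤ G y := fun y => Real.sqrt_nonneg _
  have hGsq : ∀ y ∈ U, ENNReal.ofReal (G y ^ 2) = W y := by
    intro y hy
    rw [hG]
    simp only
    rw [Real.sq_sqrt ENNReal.toReal_nonneg, ENNReal.ofReal_toReal]
    exact ne_top_of_le_ne_top ENNReal.ofReal_ne_top (hWub y hy)
  have hGub : ∀ y ∈ U, d y * G y ≤ 48 := by
    intro y hy
    have hdy := hdp y hy
    have h1 := hWub y hy
    rw [← hGsq y hy, ENNReal.ofReal_le_ofReal_iff (by positivity)] at h1
    have h2 := le_of_sq_le_sq h1 (by positivity)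
    rw [le_div_iff₀ hdy] at h2
    linarith
  have hGlb : ∀ y ∈ U, ∀ z ∈ ball y (d y / 2), ‖deriv L z‖ ≤ G y := by
    intro y hy z hz
    have hdy := hdp y hy
    have h1 := hWlb y hy z hz
    have hzU : z ∈ U := hbU y (ball_subset_ball (by linarith) hz)
    rw [← hGsq y hy, hkU z hzU, ← ofReal_norm, ← ENNReal.ofReal_pow (norm_nonneg _),
      ENNReal.ofReal_le_ofReal_iff (by positivity)] at h1
    exact le_of_sq_le_sq h1 (hG0 y)
  refine ⟨U.indicator (fun y => d y ^ (1 - s) * G y), ?_, ?_, ?_, ?_⟩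
  · exact ((hdm.pow_const _).mul hGm).indicator hU.measurableSet
  · intro y
    apply indicator_nonneg
    intro y hy
    have := hdp y hy
    have := hG0 y
    positivity
  · intro z hz z' hz' hzz
    have hdz := hdp z hz
    rw [indicator_of_mem hz]
    have hnn : 0 ≤ U.indicator (fun y => d y ^ (1 - s) * G y) z' := by
      rw [indicator_of_mem hz']
      have := hdp z' hz'
      have := hG0 z'
      positivity
    have hsub : ball z (d z / 2) ⊆ U := (ball_subset_ball (by linarith)).trans (hbU z)
    have h1 := (convex_ball z (d z / 2)).norm_image_sub_le_of_norm_deriv_le (f := L)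
      (fun w hw => hL.differentiableAt (hU.mem_nhds (hsub hw)))
      (fun w hw => hGlb z hz w hw) (x := z') (y := z)
      (by rw [mem_ball, dist_comm]; exact hzz) (mem_ball_self (by linarith))
    have h2 : |(L z).re - (L z').re| ≤ G z * dist z z' := by
      rw [← Complex.sub_re, dist_eq_norm]
      exact (Complex.abs_re_le_norm _).trans h1
    have h3 : dist z z' ≤ dist z z' ^ s * d z ^ (1 - s) := by
      rcases eq_or_lt_of_le (dist_nonneg (x := z) (y := z')) with h0 | h0
      · rw [← h0]; positivity
      · calc dist z z' = dist z z' ^ s * dist z z' ^ (1 - s) := by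
              rw [← Real.rpow_add h0]; simp
          _ ≤ _ := by
              gcongr
              linarith
    calc _ ≤ _ := h2
      _ ≤ G z * (dist z z' ^ s * d z ^ (1 - s)) := by
          have := hG0 z
          gcongr
      _ = dist z z' ^ s * (d z ^ (1 - s) * G z) := by ring
      _ ≤ _ := by gcongr; linarith
  · have hα : 0 ≤ 2 * (1 - s) / s := by
      apply div_nonneg _ hs.le; linarith
    calc _ ≤ ∫⁻ y in U, ENNReal.ofReal ((48 : ℝ) ^ (2 * (1 - s) / s)) * W y := by
          apply setLIntegral_mono' hU.measurableSet
          intro y hy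
          have hdy := hdp y hy
          have hGy := hG0 y
          rw [indicator_of_mem hy, ← hGsq y hy, ← ENNReal.ofReal_mul (by positivity)]
          apply ENNReal.ofReal_le_ofReal
          have e : (2 / s) = 2 * (1 - s) / s + 2 := by field_simp; ring
          calc (d y ^ (1 - s) * G y) ^ (2 / s) = d y ^ (2 * (1 - s) / s) * G y ^ (2 / s) := by
                rw [Real.mul_rpow (by positivity) hGy, ← Real.rpow_mul hdy.le]
                congr 2
                field_simp
            _ = (d y * G y) ^ (2 * (1 - s) / s) * G y ^ 2 := by
                rw [e, Real.rpow_add_of_nonneg hGy hα (by norm_num), Real.mul_rpow hdy.le hGy,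
                  Real.rpow_two, mul_assoc]
            _ ≤ _ := by
                gcongr
                exact hGub y hy
      _ = ENNReal.ofReal ((48 : ℝ) ^ (2 * (1 - s) / s)) * ∫⁻ y in U, W y :=
          lintegral_const_mul _ hWm
      _ ≤ _ := by
          rw [mul_assoc, ENNReal.ofReal_mul (by positivity)]
          gcongr


lemma annuli (p : ℂ) {η : ℝ} (hη : 0 < η) (m : ℕ) :
    ∫⁻ ζ in {ζ | η ≤ dist ζ p ∧ dist ζ p < 2 ^ m * η}, ENNReal.ofReal ((dist ζ p ^ 2)⁻¹) ≤
      ENNReal.ofReal (4 * Real.pi * m) := by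
  induction m with
  | zero =>
    have : {ζ | η ≤ dist ζ p ∧ dist ζ p < 2 ^ 0 * η} = ∅ := by
      ext ζ
      simp
    rw [this]; simp
  | succ m ih =>
    have hsub : {ζ | η ≤ dist ζ p ∧ dist ζ p < 2 ^ (m + 1) * η} ⊆
        {ζ | η ≤ dist ζ p ∧ dist ζ p < 2 ^ m * η} ∪
        (ball p (2 ^ (m + 1) * η) ∩ {ζ | 2 ^ m * η ≤ dist ζ p}) := by
      rintro ζ ⟨h1, h2⟩
      rcases lt_or_ge (dist ζ p) (2 ^ m * η) with h | h
      · exact Or.inl ⟨h1, h⟩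
      · exact Or.inr ⟨h2, h⟩
    have hms : MeasurableSet (ball p (2 ^ (m + 1) * η) ∩ {ζ | 2 ^ m * η ≤ dist ζ p}) :=
      measurableSet_ball.inter (isClosed_le continuous_const (by fun_prop)).measurableSet
    have hsec : ∫⁻ ζ in ball p (2 ^ (m + 1) * η) ∩ {ζ | 2 ^ m * η ≤ dist ζ p},
        ENNReal.ofReal ((dist ζ p ^ 2)⁻¹) ≤ ENNReal.ofReal (4 * Real.pi) := by
      calc _ ≤ ∫⁻ ζ in ball p (2 ^ (m + 1) * η) ∩ {ζ | 2 ^ m * η ≤ dist ζ p},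
              ENNReal.ofReal (((2 ^ m * η) ^ 2)⁻¹) := by
            apply setLIntegral_mono' hms
            intro ζ hζ
            apply ENNReal.ofReal_le_ofReal
            have := hζ.2
            simp only [mem_ofPred_eq] at this
            gcongr
        _ ≤ ∫⁻ ζ in ball p (2 ^ (m + 1) * η), ENNReal.ofReal (((2 ^ m * η) ^ 2)⁻¹) :=
            lintegral_mono_set inter_subset_left
        _ = _ := by
            rw [setLIntegral_const, vball p (by positivity), ← ENNReal.ofReal_mul (by positivity)]
            congr 1
            field_simp
            ring
    calc _ ≤ _ := lintegral_mono_set hsub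
      _ ≤ _ := lintegral_union_le _ _ _
      _ ≤ _ := add_le_add ih hsec
      _ = _ := by
          rw [← ENNReal.ofReal_add (by positivity) (by positivity)]
          congr 1
          push_cast
          ring

lemma det_mul_real (a : ℂ) : |((ContinuousLinearMap.toSpanSingleton ℂ a).restrictScalars ℝ).det|
    = ‖a‖ ^ 2 := by
  simp [ContinuousLinearMap.det, LinearMap.det_restrictScalars,
      Algebra.norm_complex_eq, Complex.normSq_eq_norm_sq]

lemma Fam.test {U : Set ℂ} {z0 x : ℂ} {f : ℂ → ℂ} (h : Fam U z0 f) (hU : IsOpen U)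
    (hne : Uᶜ.Nonempty) (hx : x ∈ U) :
    ∃ L : ℂ → ℂ, DifferentiableOn ℂ L U ∧ (∀ z ∈ U, ‖deriv L z‖ ≤ 4 / infDist z Uᶜ) ∧
      ∫⁻ z in U, ‖deriv L z‖ₑ ^ 2 ≤
        ENNReal.ofReal (4 * Real.pi * (2 * -Real.log (1 - ‖f x‖) + 5)) ∧
      (L z0).re = 0 ∧ -Real.log (1 - ‖f x‖) - 1 ≤ (L x).re := by
  have hpi := Real.pi_pos
  obtain ⟨e, he, hfe⟩ := exists_unit (f x)
  have hfx := h.maps x hx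
  have hfx0 := norm_nonneg (f x)
  set η := 1 - ‖f x‖ with hη
  have hη0 : 0 < η := by linarith
  have hη1 : η ≤ 1 := by linarith
  have he0 : e ≠ 0 := by rw [← norm_pos_iff, he]; norm_num
  set p : ℂ := ((1 + η : ℝ) : ℂ) * e with hp
  have hpn : ‖p‖ = 1 + η := by
    rw [hp, norm_mul, he, mul_one, Complex.norm_real, Real.norm_eq_abs, abs_of_pos (by linarith)]
  have hp0 : p ≠ 0 := by rw [← norm_pos_iff, hpn]; linarith
  set H : ℂ → ℂ := fun z => 1 - f z / p with hH
  have hHd : ∀ z ∈ U, HasDerivAt H (-(deriv f z / p)) z := fun z hz =>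
    ((h.hasDeriv hU hz).div_const p).const_sub 1
  have hHre : ∀ z ∈ U, 0 < (H z).re := by
    intro z hz
    have h1 : ‖f z / p‖ < 1 := by
      rw [norm_div, hpn, div_lt_one (by linarith)]
      linarith [h.maps z hz]
    have h2 := Complex.re_le_norm (f z / p)
    simp only [hH, Complex.sub_re, Complex.one_re]
    linarith
  have hHdiff : DifferentiableOn ℂ H U := fun z hz =>
    (hHd z hz).differentiableAt.differentiableWithinAt
  have hH0 : ∀ z ∈ U, H z ≠ 0 := by
    intro z hz h0
    have := hHre z hz
    rw [h0] at this
    simp at this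
  have hLd : ∀ z ∈ U, HasDerivAt (fun z => -Complex.log (H z)) (-(-(deriv f z / p) / H z)) z :=
    fun z hz => ((hHd z hz).clog (Or.inl (hHre z hz))).neg
  refine ⟨fun z => -Complex.log (H z), ?_, ?_, ?_, ?_, ?_⟩
  · exact fun z hz => (hLd z hz).differentiableAt.differentiableWithinAt
  · intro z hz
    rw [(hLd z hz).deriv, norm_neg, norm_div]
    have hdz := cdpos hU hne hz
    have hb : ball z (infDist z Uᶜ) ⊆ U := Metric.ball_infDist_compl_subset
    have h1 := posre_deriv (hHdiff.mono hb) (fun w hw => hHre w (hb hw)) hdz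
    rw [(hHd z hz).deriv] at h1
    rw [div_le_iff₀ (norm_pos_iff.2 (hH0 z hz))]
    refine h1.trans ?_
    rw [div_mul_eq_mul_div]
    gcongr
    exact Complex.re_le_norm _
  · have himg := lintegral_image_eq_lintegral_abs_det_fderiv_mul (volume : Measure ℂ)
      hU.measurableSet
      (f' := fun z => (ContinuousLinearMap.toSpanSingleton ℂ (deriv f z)).restrictScalars ℝ)
      (fun z hz => (((h.hasDeriv hU hz).hasFDerivAt).restrictScalars ℝ).hasFDerivWithinAt)
      h.inj (fun ζ => ENNReal.ofReal ((dist ζ p ^ 2)⁻¹))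
    have e1 : ∫⁻ z in U, ‖deriv (fun z => -Complex.log (H z)) z‖ₑ ^ 2 =
        ∫⁻ ζ in f '' U, ENNReal.ofReal ((dist ζ p ^ 2)⁻¹) := by
      rw [himg]
      apply setLIntegral_congr_fun hU.measurableSet
      intro z hz
      simp only
      rw [det_mul_real, ← ENNReal.ofReal_mul (by positivity), (hLd z hz).deriv, ← ofReal_norm,
        ← ENNReal.ofReal_pow (norm_nonneg _)]
      congr 1
      have e2 : -(-(deriv f z / p) / H z) = deriv f z / (p - f z) := by
        have h1 := hH0 z hz
        have h2 : p - f z = p * H z := by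
          simp only [hH]; field_simp
        rw [h2]
        field_simp
      rw [e2, norm_div, dist_eq_norm, norm_sub_rev (f z) p, div_pow, div_eq_mul_inv]
    rw [e1]
    set m := ⌈Real.log (3 / η) / Real.log 2⌉₊ with hm
    have hl2 : 0 < Real.log 2 := Real.log_pos (by norm_num)
    have hm1 : 3 ≤ 2 ^ m * η := by
      have h1 : Real.log (3 / η) / Real.log 2 ≤ m := Nat.le_ceil _
      rw [div_le_iff₀ hl2, ← Real.log_pow, Real.log_le_log_iff (by positivity) (by positivity),
        div_le_iff₀ hη0] at h1
      exact h1
    have hl3 : Real.log (3 / η) = Real.log 3 - Real.log η :=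
      Real.log_div (by norm_num) hη0.ne'
    have hlη : Real.log η ≤ 0 := Real.log_nonpos hη0.le hη1
    have hl30 : 0 < Real.log 3 := Real.log_pos (by norm_num)
    have hl33 : Real.log 3 ≤ 2 := by
      have := Real.log_le_sub_one_of_pos (show (0:ℝ) < 3 by norm_num)
      linarith
    have hm2 : (m : ℝ) ≤ 2 * -Real.log η + 5 := by
      have h1 : (m : ℝ) < Real.log (3 / η) / Real.log 2 + 1 := Nat.ceil_lt_add_one (by
        rw [hl3]
        apply div_nonneg _ hl2.le
        linarith)
      have h2 : Real.log (3 / η) / Real.log 2 ≤ 2 * Real.log (3 / η) := by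
        rw [div_le_iff₀ hl2]
        have := Real.log_two_gt_d9
        rw [hl3]
        nlinarith
      rw [hl3] at h1 h2
      linarith
    calc _ ≤ ∫⁻ ζ in {ζ | η ≤ dist ζ p ∧ dist ζ p < 2 ^ m * η},
          ENNReal.ofReal ((dist ζ p ^ 2)⁻¹) := by
          apply lintegral_mono_set
          rintro _ ⟨z, hz, rfl⟩
          have h1 := h.maps z hz
          rw [mem_ofPred_eq, dist_eq_norm]
          constructor
          · have := norm_sub_norm_le p (f z)
            rw [norm_sub_rev] at this
            rw [hpn] at this
            linarith
          · have := norm_sub_le (f z) p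
            rw [hpn] at this
            linarith
      _ ≤ _ := annuli p hη0 m
      _ ≤ _ := by
          apply ENNReal.ofReal_le_ofReal
          gcongr
  · simp [hH, h.zero]
  · have e3 : H x = ((2 * η / (1 + η) : ℝ) : ℂ) := by
      have h1 : f x / p = (((1 - η) / (1 + η) : ℝ) : ℂ) := by
        have h2 : ‖f x‖ = 1 - η := by rw [hη]; ring
        rw [hfe, hp, h2]
        push_cast
        field_simp
      simp only [hH]
      rw [h1]
      have : 1 - (1 - η) / (1 + η) = 2 * η / (1 + η) := by
        field_simp; ring
      rw [← this]
      push_cast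
      rfl
    rw [Complex.neg_re, Complex.log_re, e3, Complex.norm_real, Real.norm_eq_abs,
      abs_of_pos (by positivity)]
    have h4 : 2 * η / (1 + η) ≤ 2 * η := div_le_self (by positivity) (by linarith)
    have h5 := Real.log_le_log (by positivity) h4
    rw [Real.log_mul (by norm_num) hη0.ne'] at h5
    have h6 := Real.log_two_lt_d9
    linarith


abbrev PhiC : ℂ ≃ₗᵢ[ℝ] Eu 2 := Complex.orthonormalBasisOneI.repr

lemma infDist_PhiC (Ω : Set (Eu 2)) (z : ℂ) :
    infDist (PhiC z) Ωᶜ = infDist z (PhiC ⁻¹' Ω)ᶜ := by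
  rw [← Metric.infDist_image PhiC.isometry, ← preimage_compl,
    image_preimage_eq _ PhiC.surjective]

lemma ht_complex {Ω : Set (Eu 2)} (hO : IsOpen Ω) (hne : Ωᶜ.Nonempty) {s : ℝ} (hs : 0 < s)
    (hs1 : s ≤ 1) (hHT : SupportsHT Ω s) :
    ∃ C : ℝ, 0 < C ∧ ∀ u g : ℂ → ℝ, Measurable u → Measurable g → (∀ z, 0 ≤ g z) →
      (∀ z ∈ PhiC ⁻¹' Ω, ∀ z' ∈ PhiC ⁻¹' Ω, dist z z' < infDist z (PhiC ⁻¹' Ω)ᶜ / 2 →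
        |u z - u z'| ≤ dist z z' ^ s * (g z + g z')) →
      ∀ Gc : ℝ, 0 < Gc → ∫⁻ z in PhiC ⁻¹' Ω, ENNReal.ofReal (g z ^ (2 / s)) ≤ ENNReal.ofReal Gc →
      ∃ m : ℝ, ∫⁻ z in PhiC ⁻¹' Ω, ENNReal.ofReal
        (Real.exp ((|u z - m| / (2 * C * Gc ^ (s / 2))) ^ (2 / (2 - s))) - 1) ≤ 1 := by
  obtain ⟨C, hC, hHT⟩ := hHT
  refine ⟨C, hC, ?_⟩
  intro u g hu hg hg0 hgrad Gc hGc hInt0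
  have hmp := PhiC.measurePreserving
  have hemb : MeasurableEmbedding PhiC := PhiC.toHomeomorph.measurableEmbedding
  have hsm : Measurable (PhiC.symm : Eu 2 → ℂ) := PhiC.symm.continuous.measurable
  set u' : Eu 2 → ℝ := fun x => u (PhiC.symm x) with hu'
  set g' : Eu 2 → ℝ := fun x => g (PhiC.symm x) with hg'
  have hmem : g' ∈ DBall Ω s (1 / 2) u' := by
    refine ⟨hg.comp hsm, fun x => hg0 _, ∅, empty_subset _, measure_empty, ?_⟩
    intro x hx y hy hxy
    have hxy' := (edist_cond hne x y).1 hxy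
    have h1 : ∀ x : Eu 2, PhiC (PhiC.symm x) = x := fun x => PhiC.apply_symm_apply x
    have h2 : dist (PhiC.symm x) (PhiC.symm y) = dist x y := PhiC.symm.dist_map x y
    have h3 := hgrad (PhiC.symm x) (by rw [mem_preimage, h1]; exact hx.1) (PhiC.symm y)
      (by rw [mem_preimage, h1]; exact hy.1) (by rw [← infDist_PhiC, h1, h2]; exact hxy')
    rw [h2] at h3
    exact h3
  have hnorm : ballNorm Ω s (((2:ℕ) : ℝ) / s) u' ≤ ENNReal.ofReal (Gc ^ (s / 2)) := by
    refine (iInf₂_le g' hmem).trans ?_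
    have h2s : 0 < 2 / s := by positivity
    rw [Nat.cast_ofNat, eLpNorm_eq_lintegral_rpow_enorm_toReal (by simpa using hs)
      ENNReal.ofReal_ne_top, ENNReal.toReal_ofReal h2s.le]
    have e1 : ∫⁻ x in Ω, ‖g' x‖ₑ ^ (2 / s) = ∫⁻ z in PhiC ⁻¹' Ω, ENNReal.ofReal (g z ^ (2 / s)) := by
      rw [← hmp.setLIntegral_comp_preimage_emb hemb]
      congr 1
      ext z
      rw [hg']
      simp only [LinearIsometryEquiv.symm_apply_apply]
      rw [Real.enorm_eq_ofReal (hg0 z), ENNReal.ofReal_rpow_of_nonneg (hg0 z) h2s.le]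
    rw [e1, ← ENNReal.ofReal_rpow_of_pos hGc]
    have e2 : 1 / (2 / s) = s / 2 := by field_simp
    rw [e2]
    exact ENNReal.rpow_le_rpow hInt0 (by positivity)
  have hM : MemMball Ω s (((2:ℕ) : ℝ) / s) u' :=
    ⟨hu.comp hsm, lt_of_le_of_lt hnorm ENNReal.ofReal_lt_top⟩
  have hlux := hHT u' hM
  set m := ⨍ y in Ω, u' y with hm
  have hGs : 0 < Gc ^ (s / 2) := Real.rpow_pos_of_pos hGc _
  have hlt : phiLux Ω s (fun x => u' x - m) < ENNReal.ofReal (2 * C * Gc ^ (s / 2)) := by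
    refine lt_of_le_of_lt (hlux.trans (mul_le_mul_right hnorm _)) ?_
    rw [← ENNReal.ofReal_mul hC.le, ENNReal.ofReal_lt_ofReal_iff (by positivity)]
    nlinarith [mul_pos hC hGs]
  obtain ⟨_, ⟨t, ⟨ht0, ht⟩, rfl⟩, htT⟩ := sInf_lt_iff.1 hlt
  rw [ENNReal.ofReal_lt_ofReal_iff (by positivity)] at htT
  refine ⟨m, le_trans ?_ ht⟩
  rw [← hmp.setLIntegral_comp_preimage_emb hemb]
  apply lintegral_mono
  intro z
  simp only [hu', LinearIsometryEquiv.symm_apply_apply, Nat.cast_ofNat]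
  apply ENNReal.ofReal_le_ofReal
  gcongr
  apply div_nonneg (by norm_num)
  linarith


lemma re_close {U : Set ℂ} (hU : IsOpen U) (hne : Uᶜ.Nonempty) {L : ℂ → ℂ}
    (hL : DifferentiableOn ℂ L U) (hL4 : ∀ z ∈ U, ‖deriv L z‖ ≤ 4 / infDist z Uᶜ) {c z : ℂ}
    (hc : c ∈ U) (hz : z ∈ ball c (infDist c Uᶜ / 2)) : |(L z).re - (L c).re| ≤ 4 := by
  have hd := cdpos hU hne hc
  have hsub : ball c (infDist c Uᶜ / 2) ⊆ U :=
    (ball_subset_ball (by linarith)).trans Metric.ball_infDist_compl_subset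
  have h1 := (convex_ball c (infDist c Uᶜ / 2)).norm_image_sub_le_of_norm_deriv_le (f := L)
    (C := 8 / infDist c Uᶜ)
    (fun w hw => hL.differentiableAt (hU.mem_nhds (hsub hw)))
    (fun w hw => by
      refine (hL4 w (hsub hw)).trans ?_
      have h2 := cdlip U c w
      rw [mem_ball, dist_comm] at hw
      rw [div_le_div_iff₀ (cdpos hU hne (hsub (by rwa [mem_ball, dist_comm]))) hd]
      linarith) (x := c) (y := z) (mem_ball_self (by linarith)) hz
  rw [← Complex.sub_re]
  refine (Complex.abs_re_le_norm _).trans (h1.trans ?_)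
  rw [mem_ball, dist_eq_norm] at hz
  calc 8 / infDist c Uᶜ * ‖z - c‖ ≤ 8 / infDist c Uᶜ * (infDist c Uᶜ / 2) := by gcongr
    _ = 4 := by field_simp; norm_num

lemma exp_ball {U : Set ℂ} {v : ℂ → ℝ} {q T X r ρ : ℝ} {c : ℂ}
    (hInt0 : ∫⁻ z in U, ENNReal.ofReal (Real.exp ((|v z| / T) ^ q) - 1) ≤ 1) (hT : 0 < T)
    (hq : 0 ≤ q) (hX : 0 ≤ X) (hρ : 0 < ρ) (hρr : ρ ≤ r) (hb : ball c r ⊆ U)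
    (hv : ∀ z ∈ ball c r, X ≤ |v z|) :
    (X / T) ^ q ≤ Real.log (1 + 1 / (Real.pi * ρ ^ 2)) := by
  have hpi := Real.pi_pos
  have hXT : 0 ≤ (X / T) ^ q := by positivity
  have he : 0 ≤ Real.exp ((X / T) ^ q) - 1 := by
    linarith [Real.one_le_exp hXT]
  have h1 : ENNReal.ofReal ((Real.exp ((X / T) ^ q) - 1) * (Real.pi * ρ ^ 2)) ≤ 1 := by
    rw [ENNReal.ofReal_mul he, ← vball c hρ.le, ← setLIntegral_const]
    refine le_trans ?_ hInt0
    have hs : ball c ρ ⊆ ball c r := ball_subset_ball hρr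
    refine le_trans ?_ (lintegral_mono_set (hs.trans hb))
    apply setLIntegral_mono' measurableSet_ball
    intro z hz
    have := hv z (hs hz)
    apply ENNReal.ofReal_le_ofReal
    gcongr
  rw [ENNReal.ofReal_le_one] at h1
  rw [Real.le_log_iff_exp_le (by positivity)]
  have : Real.exp ((X / T) ^ q) - 1 ≤ 1 / (Real.pi * ρ ^ 2) := by
    rw [le_div_iff₀ (by positivity)]; exact h1
  linarith

lemma solve_N {s N Λ C B : ℝ} (hs : 0 < s) (hs1 : s ≤ 1) (hC : 0 < C) (hB : 0 < B)
    (hN : 20 < N)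
    (h : ((N / 2 - 5) / (2 * C * (B * (4 * Real.pi * (2 * N + 5))) ^ (s / 2))) ^ (2 / (2 - s)) ≤ Λ) :
    N ≤ (8 * C * (12 * Real.pi * B) ^ (s / 2)) ^ (2 / (2 - s)) * Λ := by
  have hpi := Real.pi_pos
  have hq : 0 < 2 / (2 - s) := by apply div_pos <;> linarith
  have hN0 : 0 < N := by linarith
  have hT : 2 * C * (B * (4 * Real.pi * (2 * N + 5))) ^ (s / 2) ≤
      2 * C * ((12 * Real.pi * B) ^ (s / 2) * N ^ (s / 2)) := by
    rw [← Real.mul_rpow (by positivity) (by positivity)]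
    gcongr 2 * C * ?_ ^ (s / 2)
    nlinarith [mul_pos hB hpi]
  set K := (12 * Real.pi * B) ^ (s / 2) with hK
  have hKp : 0 < K := by positivity
  have hNs : 0 < N ^ (s / 2) := by positivity
  have h1 : N ^ (1 - s / 2) / (8 * C * K) ≤
      (N / 2 - 5) / (2 * C * (B * (4 * Real.pi * (2 * N + 5))) ^ (s / 2)) := by
    calc N ^ (1 - s / 2) / (8 * C * K) = (N / 4) / (2 * C * (K * N ^ (s / 2))) := by
          rw [Real.rpow_sub hN0, Real.rpow_one]
          field_simp
          norm_num
      _ ≤ _ := by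
          apply div_le_div₀
          · linarith
          · linarith
          · positivity
          · exact hT
  have h2 : (N ^ (1 - s / 2) / (8 * C * K)) ^ (2 / (2 - s)) ≤ Λ :=
    le_trans (Real.rpow_le_rpow (by positivity) h1 hq.le) h
  rw [Real.div_rpow (by positivity) (by positivity), ← Real.rpow_mul hN0.le] at h2
  have e : (1 - s / 2) * (2 / (2 - s)) = 1 := by
    have : 2 - s ≠ 0 := by linarith
    field_simp
  rw [e, Real.rpow_one, div_le_iff₀ (by positivity)] at h2
  linarith

lemma N_bound {U : Set ℂ} (hU : IsOpen U) (hne : Uᶜ.Nonempty) {s : ℝ} (hs : 0 < s)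
    (hs1 : s ≤ 1) {C : ℝ} (hC : 0 < C)
    (hH : ∀ u g : ℂ → ℝ, Measurable u → Measurable g → (∀ z, 0 ≤ g z) →
      (∀ z ∈ U, ∀ z' ∈ U, dist z z' < infDist z Uᶜ / 2 →
        |u z - u z'| ≤ dist z z' ^ s * (g z + g z')) →
      ∀ Gc : ℝ, 0 < Gc → ∫⁻ z in U, ENNReal.ofReal (g z ^ (2 / s)) ≤ ENNReal.ofReal Gc →
      ∃ m : ℝ, ∫⁻ z in U, ENNReal.ofReal
        (Real.exp ((|u z - m| / (2 * C * Gc ^ (s / 2))) ^ (2 / (2 - s))) - 1) ≤ 1)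
    {z0 : ℂ} (hz0 : z0 ∈ U) :
    ∃ M : ℝ, 0 ≤ M ∧ ∀ f, Fam U z0 f → ∀ x ∈ U, -Real.log (1 - ‖f x‖) ≤
      20 + M * Real.log (1 + 1 / (Real.pi * (min (infDist z0 Uᶜ) (infDist x Uᶜ) / 2) ^ 2)) := by
  have hpi := Real.pi_pos
  set B : ℝ := (48 : ℝ) ^ (2 * (1 - s) / s) * 441 with hB
  have hBp : 0 < B := by positivity
  refine ⟨(8 * C * (12 * Real.pi * B) ^ (s / 2)) ^ (2 / (2 - s)), by positivity, ?_⟩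
  intro f hf x hx
  have hd0 := cdpos hU hne hz0
  have hdx := cdpos hU hne hx
  set ρ := min (infDist z0 Uᶜ) (infDist x Uᶜ) / 2 with hρ
  have hρ0 : 0 < ρ := by
    have := lt_min hd0 hdx
    linarith
  have hΛ : 0 ≤ Real.log (1 + 1 / (Real.pi * ρ ^ 2)) := by
    apply Real.log_nonneg
    have : 0 ≤ 1 / (Real.pi * ρ ^ 2) := by positivity
    linarith
  obtain ⟨L, hL, hL4, hA, hLz0, hLx⟩ := hf.test hU hne hx
  set N := -Real.log (1 - ‖f x‖) with hN
  rcases le_or_gt N 20 with hN20 | hN20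
  · have : 0 ≤ (8 * C * (12 * Real.pi * B) ^ (s / 2)) ^ (2 / (2 - s)) *
        Real.log (1 + 1 / (Real.pi * ρ ^ 2)) := by positivity
    linarith
  obtain ⟨g, hgm, hg0, hgrad, hgint⟩ := grad_exists hU hne hL hL4 hA hs hs1
  set u : ℂ → ℝ := U.indicator (fun z => (L z).re) with hu
  have huU : ∀ z ∈ U, u z = (L z).re := fun z hz => indicator_of_mem hz _
  have hum : Measurable u :=
    measurable_ind hU (Complex.continuous_re.comp_continuousOn hL.continuousOn)
  rw [← hB] at hgint
  have hGc : 0 < B * (4 * Real.pi * (2 * N + 5)) := by positivity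
  obtain ⟨m, hm⟩ := hH u g hum hgm hg0 (by
    intro z hz z' hz' hzz
    rw [huU z hz, huU z' hz']
    exact hgrad z hz z' hz' hzz) _ hGc hgint
  have hq : 0 ≤ 2 / (2 - s) := by apply div_nonneg <;> linarith
  have hTp : 0 < 2 * C * (B * (4 * Real.pi * (2 * N + 5))) ^ (s / 2) := by positivity
  have hsub : ∀ c ∈ U, ball c (infDist c Uᶜ / 2) ⊆ U := fun c hc =>
    (ball_subset_ball (by linarith [cdpos hU hne hc])).trans Metric.ball_infDist_compl_subset
  have hmain : ((N / 2 - 5) / (2 * C * (B * (4 * Real.pi * (2 * N + 5))) ^ (s / 2))) ^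
      (2 / (2 - s)) ≤ Real.log (1 + 1 / (Real.pi * ρ ^ 2)) := by
    rcases le_or_gt (N / 2) m with hmN | hmN
    · refine exp_ball (v := fun z => u z - m) (c := z0) (r := infDist z0 Uᶜ / 2) hm hTp hq
        (by linarith) hρ0 (by rw [hρ]; linarith [min_le_left (infDist z0 Uᶜ) (infDist x Uᶜ)])
        (hsub z0 hz0) ?_
      intro z hz
      have h1 := re_close hU hne hL hL4 hz0 hz
      rw [hLz0] at h1
      rw [huU z (hsub z0 hz0 hz), abs_sub_comm]
      refine le_trans ?_ (le_abs_self _)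
      linarith [(abs_le.1 h1).2]
    · refine exp_ball (v := fun z => u z - m) (c := x) (r := infDist x Uᶜ / 2) hm hTp hq
        (by linarith) hρ0 (by rw [hρ]; linarith [min_le_right (infDist z0 Uᶜ) (infDist x Uᶜ)])
        (hsub x hx) ?_
      intro z hz
      have h1 := re_close hU hne hL hL4 hx hz
      rw [huU z (hsub x hx hz)]
      refine le_trans ?_ (le_abs_self _)
      linarith [(abs_le.1 h1).1]
  have := solve_N hs hs1 hC hBp hN20 hmain
  linarith


set_option maxHeartbeats 4000000 in
lemma HT_carrot {Ω : Set (Eu 2)} (hO : IsOpen Ω) (hne : Ωᶜ.Nonempty) (hΩ : Ω.Nonempty)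
    (hbd : Bornology.IsBounded Ω) (hc : IsPreconnected Ω) (hsc : SimplyConnectedSpace Ω)
    {s : ℝ} (hs : 0 < s) (hs1 : s ≤ 1) (hHT : SupportsHT Ω s) : IsWeakCarrot Ω := by
  have hpi := Real.pi_pos
  obtain ⟨C, hC, hH⟩ := ht_complex hO hne hs hs1 hHT
  set U : Set ℂ := PhiC ⁻¹' Ω with hUdef
  have hU : IsOpen U := hO.preimage PhiC.continuous
  have hUsc : IsSimplyConnected U := by
    have h1 : IsSimplyConnected Ω := hsc
    exact (PhiC.toHomeomorph.isSimplyConnected_preimage).2 h1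
  have hUne : Uᶜ.Nonempty := by
    obtain ⟨y, hy⟩ := hne
    refine ⟨PhiC.symm y, ?_⟩
    intro h
    apply hy
    rw [hUdef, mem_preimage, PhiC.apply_symm_apply] at h
    exact h
  have hUbd : Bornology.IsBounded U := by
    have h1 := PhiC.symm.lipschitz.isBounded_image hbd
    refine h1.subset ?_
    intro z hz
    exact ⟨PhiC z, hz, PhiC.symm_apply_apply z⟩
  obtain ⟨x0, hx0⟩ := hΩ
  set z0 := PhiC.symm x0 with hz0def
  have hPs : ∀ x : Eu 2, PhiC (PhiC.symm x) = x := fun x => PhiC.apply_symm_apply x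
  have hsU : ∀ x ∈ Ω, PhiC.symm x ∈ U := fun x hx => by
    rw [hUdef, mem_preimage, hPs]; exact hx
  have hds : ∀ x, infDist (PhiC.symm x) Uᶜ = infDist x Ωᶜ := fun x => by
    rw [hUdef, ← infDist_PhiC, hPs]
  have hz0 : z0 ∈ U := hsU x0 hx0
  obtain ⟨M, hM0, hM⟩ := N_bound hU hUne hs hs1 hC hH hz0
  obtain ⟨D, hD, hdD⟩ := exists_D hne hbd
  set κ : ℝ := 1 + 1 / 1024 with hκ
  have hlκ : 0 < Real.log κ := Real.log_pos (by rw [hκ]; norm_num)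
  have hd0 := dpos hO hne hx0
  set d0 := infDist x0 Ωᶜ with hd0def
  set E : ℝ := D + 2 * D / d0 with hE
  set a : ℝ := 21 / Real.log κ + 1 with ha
  set b : ℝ := 2 * M / Real.log κ with hb
  have hEp : 0 < E := by positivity
  have hap : 0 < a := by positivity
  have hbp : 0 ≤ b := by positivity
  refine ⟨x0, hx0, a + b + E + 3 * D + 1, by linarith, ?_⟩
  intro x hx
  have hdx := dpos hO hne hx
  have hdxD := hdD x hx
  have hd0D := hdD x0 hx0
  set d := infDist x Ωᶜ with hddef
  set z := PhiC.symm x with hzdef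
  have hz : z ∈ U := hsU x hx
  -- chain from z0 to z
  obtain ⟨N', hN'⟩ : ∃ N', CChain U N' z0 z := by
    obtain ⟨k, hk⟩ := chain_exists hO hne hc hx0 hx
    obtain ⟨n, hn⟩ := exists_nat_ge (9 * k)
    obtain ⟨N', -, c, hc0, hcN, hca, hcU⟩ := QC_to_chain hO hne n x0 x k hk (by linarith)
    refine ⟨N', fun i => PhiC.symm (c i), by simp only [hc0, hz0def], by simp only [hcN, hzdef],
      fun i hi => ?_, fun i hi => hsU _ (hcU i hi)⟩
    rw [hds, PhiC.symm.dist_map]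
    exact hca i hi
  set δ : ℝ := (5 / 7 : ℝ) ^ N' / 2 with hδ
  have h57 : (5 / 7 : ℝ) ^ N' ≤ 1 := pow_le_one₀ (by norm_num) (by norm_num)
  have hδ0 : 0 < δ := by positivity
  obtain ⟨f, hf, hcov⟩ := near_ext hU hUsc hz0 hUbd hδ0 (by linarith)
  have hlow := hf.lower hU hUne hN'
  have hNb := hM f hf z hz
  set η := 1 - ‖f z‖ with hη
  have hη0 : 0 < η := by linarith [hf.maps z hz]
  have hη1 : η ≤ 1 := by linarith [norm_nonneg (f z)]
  have hlη : Real.log η ≤ 0 := Real.log_nonpos hη0.le hη1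
  set n := ⌈Real.log (2 / η) / Real.log κ⌉₊ with hn
  have hl2 : Real.log (2 / η) = Real.log 2 - Real.log η := Real.log_div (by norm_num) hη0.ne'
  have hl20 : 0 < Real.log 2 := Real.log_pos (by norm_num)
  have hκn : 2 / η ≤ κ ^ n := by
    have h1 : Real.log (2 / η) / Real.log κ ≤ n := Nat.le_ceil _
    rw [div_le_iff₀ hlκ, ← Real.log_pow, Real.log_le_log_iff (by positivity) (by positivity)] at h1
    exact h1
  obtain ⟨c, hc0, hcN, hca, hcU⟩ := hf.chain hU hUsc hUne hz0 hz hδ0 hcov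
    (by rw [← hη]; linarith) hκn
  have hch : Chain Ω n x x0 := by
    refine ⟨fun i => PhiC (c i), by simp only [hc0, hzdef, hPs], by simp only [hcN, hz0def, hPs],
      fun i hi => ?_, fun i hi => hcU i hi⟩
    unfold Adj
    rw [infDist_PhiC, PhiC.dist_map]
    exact hca i hi
  obtain ⟨k, hk, hQC⟩ := hch.to_QC hO hne
  have hqh : qhDist Ω x x0 ≤ n := (qhDist_le_of_QC hQC).trans hk
  have hnb : (n : ℝ) ≤ (Real.log 2 - Real.log η) / Real.log κ + 1 := by
    have := Nat.ceil_lt_add_one (a := Real.log (2 / η) / Real.log κ) (by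
      rw [hl2]; apply div_nonneg _ hlκ.le; linarith)
    rw [hl2] at this
    rw [hn, hl2]
    exact this.le
  rw [hz0def, hzdef, hds, hds, ← hd0def, ← hddef] at hNb
  set ρ := min d0 d / 2 with hρ
  have hρlb : d * d0 / (2 * D) ≤ ρ := by
    rw [hρ, div_le_div_iff₀ (by positivity) (by norm_num)]
    have : d * d0 ≤ min d0 d * D := by
      rcases min_choice d0 d with h | h <;> rw [h] <;> nlinarith
    linarith
  have hρ0 : 0 < ρ := lt_of_lt_of_le (by positivity) hρlb
  have hΛ : Real.log (1 + 1 / (Real.pi * ρ ^ 2)) ≤ 2 * Real.log (E / d) := by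
    have e1 : 2 * Real.log (E / d) = Real.log ((E / d) ^ 2) := by
      rw [Real.log_pow]; norm_num
    rw [e1]
    apply Real.log_le_log (by positivity)
    have h1 : 1 / (Real.pi * ρ ^ 2) ≤ (2 * D / (d * d0)) ^ 2 := by
      calc 1 / (Real.pi * ρ ^ 2) ≤ 1 / (1 * (d * d0 / (2 * D)) ^ 2) := by
            gcongr
            linarith [Real.pi_gt_three]
        _ = _ := by field_simp
    have h2 : (1:ℝ) ≤ (D / d) ^ 2 := by
      apply one_le_pow₀
      rw [one_le_div hdx]; exact hdxD
    have h3 : E / d = D / d + 2 * D / (d * d0) := by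
      rw [hE]; field_simp
    rw [h3]
    have h4 : 0 ≤ D / d * (2 * D / (d * d0)) := by positivity
    nlinarith
  have hfin : (n : ℝ) ≤ a + b * Real.log (E / d) := by
    have h1 : Real.log 2 - Real.log η ≤ 21 + M * (2 * Real.log (E / d)) := by
      have := mul_le_mul_of_nonneg_left hΛ hM0
      have := Real.log_two_lt_d9
      linarith
    calc (n : ℝ) ≤ _ := hnb
      _ ≤ (21 + M * (2 * Real.log (E / d))) / Real.log κ + 1 := by gcongr
      _ = _ := by rw [ha, hb]; field_simp; ring
  set C1 := a + b + E + 3 * D + 1 with hC1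
  have hlog1 : 1 ≤ Real.log (C1 / d) := by
    rw [Real.le_log_iff_exp_le (by positivity), le_div_iff₀ hdx]
    have := Real.exp_one_lt_d9
    nlinarith
  have hlogE : Real.log (E / d) ≤ Real.log (C1 / d) := by
    apply Real.log_le_log (by positivity)
    gcongr
    linarith
  calc qhDist Ω x x0 ≤ n := hqh
    _ ≤ a + b * Real.log (E / d) := hfin
    _ ≤ a * Real.log (C1 / d) + b * Real.log (C1 / d) := by
        have := mul_le_mul_of_nonneg_left hlogE hbp
        nlinarith
    _ = (a + b) * Real.log (C1 / d) := by ring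
    _ ≤ C1 * Real.log (C1 / d) := by
        gcongr
        linarith


/-- For a bounded simply connected planar domain, being a weak carrot domain
is equivalent to supporting an `s`-Hajłasz–Trudinger imbedding for all (equivalently, some)
`s ∈ (0,1]`. -/
theorem stmt8 (Ω : Set (Eu 2)) (hΩ : IsDomainEu Ω) (hbd : Bornology.IsBounded Ω)
    (hsc : SimplyConnectedSpace Ω) :
    (IsWeakCarrot Ω ↔ ∀ s ∈ Set.Ioc (0:ℝ) 1, SupportsHT Ω s) ∧
    (IsWeakCarrot Ω ↔ ∃ s ∈ Set.Ioc (0:ℝ) 1, SupportsHT Ω s) := by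
  obtain ⟨hO, hne0, hc⟩ := hΩ
  have hne : Ωᶜ.Nonempty := by
    rw [nonempty_compl]
    rintro rfl
    exact NormedSpace.unbounded_univ ℝ (Eu 2) hbd
  have h1 : IsWeakCarrot Ω → ∀ s ∈ Set.Ioc (0:ℝ) 1, SupportsHT Ω s := fun hw s hs =>
    carrot_HT hO hne hne0 hbd hc hw hs.1 hs.2
  have h2 : (∃ s ∈ Set.Ioc (0:ℝ) 1, SupportsHT Ω s) → IsWeakCarrot Ω := by
    rintro ⟨s, hs, h⟩
    exact HT_carrot hO hne hne0 hbd hc hsc hs.1 hs.2 h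
  have h1m : (1:ℝ) ∈ Set.Ioc (0:ℝ) 1 := ⟨one_pos, le_rfl⟩
  exact ⟨⟨h1, fun h => h2 ⟨1, h1m, h 1 h1m⟩⟩, ⟨fun h => ⟨1, h1m, h1 h 1 h1m⟩, h2⟩⟩
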